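/- Let f(x) = (x² − x + 1)·(x⁶ + x⁵ − 6x⁴ − 3x³ + 14x² − 7x + 1). For every quadratic field k and all x, y ∈ k with y² = f(x), if x is not rational then at least one of the following holds in k: (2x − 2)² = 2, or (x + 1)² = 2, or x² = 2, or (2x − 1)² = −3. -/

import Mathlib

namespace Q14

/-- additive discrete valuations, with junk at zero -/
structure DV (K : Type*) [Field K] where
  v : K → ℤ
  mul' : ∀ x y, x ≠ 0 → y ≠ 0 → v (x * y) = v x + v y
  add' : ∀ x y, x ≠ 0 → y ≠ 0 → x + y ≠ 0 → min (v x) (v y) ≤ v (x + y)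

namespace DV
variable {K : Type*} [Field K] (V : DV K)

lemma one : V.v 1 = 0 := by
  have := V.mul' 1 1 one_ne_zero one_ne_zero
  rw [mul_one] at this; omega

lemma neg_one : V.v (-1) = 0 := by
  have := V.mul' (-1) (-1) (by simp) (by simp)
  rw [neg_mul_neg, mul_one, V.one] at this; omega

lemma neg (x : K) : V.v (-x) = V.v x := by
  by_cases hx : x = 0
  · simp [hx]
  · have := V.mul' (-1) x (by simp) hx
    rw [neg_one_mul, V.neg_one] at this; omega

lemma pow {x : K} (hx : x ≠ 0) (n : ℕ) : V.v (x ^ n) = n * V.v x := by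
  induction n with
  | zero => simp [V.one]
  | succ n ih => rw [pow_succ, V.mul' _ _ (pow_ne_zero _ hx) hx, ih]; push_cast; ring

lemma inv {x : K} (hx : x ≠ 0) : V.v x⁻¹ = - V.v x := by
  have := V.mul' x x⁻¹ hx (inv_ne_zero hx)
  rw [mul_inv_cancel₀ hx, V.one] at this; omega

lemma div {x y : K} (hx : x ≠ 0) (hy : y ≠ 0) : V.v (x / y) = V.v x - V.v y := by
  rw [div_eq_mul_inv, V.mul' _ _ hx (inv_ne_zero hy), V.inv hy]; ring

lemma zpow {x : K} (hx : x ≠ 0) (n : ℤ) : V.v (x ^ n) = n * V.v x := by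
  cases n with
  | ofNat n => simpa using V.pow hx n
  | negSucc n =>
    rw [zpow_negSucc, V.inv (pow_ne_zero _ hx), V.pow hx, Int.negSucc_eq]; push_cast; ring

/-- valuation at least `n` -/
def ge (n : ℤ) (x : K) : Prop := x = 0 ∨ n ≤ V.v x

variable {V}
lemma ge_add {n : ℤ} {x y : K} (hx : V.ge n x) (hy : V.ge n y) : V.ge n (x + y) := by
  by_cases h0 : x = 0
  · simpa [h0] using hy
  by_cases h1 : y = 0
  · simpa [h1] using hx
  by_cases h2 : x + y = 0
  · exact Or.inl h2
  have := V.add' x y h0 h1 h2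
  rcases hx with hx | hx
  · exact absurd hx h0
  rcases hy with hy | hy
  · exact absurd hy h1
  exact Or.inr ((le_min hx hy).trans this)

lemma ge_neg {n : ℤ} {x : K} (hx : V.ge n x) : V.ge n (-x) := by
  rcases hx with h | h
  · exact Or.inl (by simp [h])
  · exact Or.inr (by rwa [V.neg])

lemma ge_sub {n : ℤ} {x y : K} (hx : V.ge n x) (hy : V.ge n y) : V.ge n (x - y) := by
  rw [sub_eq_add_neg]; exact ge_add hx (ge_neg hy)

lemma ge_mul {m n : ℤ} {x y : K} (hx : V.ge m x) (hy : V.ge n y) : V.ge (m + n) (x * y) := by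
  by_cases h0 : x = 0
  · exact Or.inl (by simp [h0])
  by_cases h1 : y = 0
  · exact Or.inl (by simp [h1])
  rcases hx with hx | hx
  · exact absurd hx h0
  rcases hy with hy | hy
  · exact absurd hy h1
  exact Or.inr (by rw [V.mul' _ _ h0 h1]; omega)

lemma ge_mul0 {n : ℤ} {x y : K} (hx : V.ge 0 x) (hy : V.ge n y) : V.ge n (x * y) := by
  simpa using ge_mul hx hy

lemma ge_mono {m n : ℤ} {x : K} (h : m ≤ n) (hx : V.ge n x) : V.ge m x := by
  rcases hx with hx | hx
  · exact Or.inl hx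
  · exact Or.inr (h.trans hx)

lemma ge_one : V.ge 0 (1 : K) := Or.inr (by rw [V.one])

lemma ge_nat (n : ℕ) : V.ge 0 (n : K) := by
  induction n with
  | zero => exact Or.inl (by simp)
  | succ n ih => push_cast; exact ge_add ih ge_one

lemma ge_int (n : ℤ) : V.ge 0 (n : K) := by
  obtain ⟨m, rfl | rfl⟩ := n.eq_nat_or_neg
  · simpa using ge_nat m
  · simpa using ge_neg (ge_nat m)

lemma ge_ofNat (n : ℕ) [n.AtLeastTwo] : V.ge 0 (OfNat.ofNat n : K) := by
  have h := ge_nat (V := V) (OfNat.ofNat n)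
  rwa [Nat.cast_ofNat] at h

lemma ge_pow {x : K} (hx : V.ge 0 x) (n : ℕ) : V.ge 0 (x ^ n) := by
  induction n with
  | zero => simpa using ge_one
  | succ n ih => rw [pow_succ]; exact ge_mul0 ih hx

lemma not_ge {n : ℤ} {x : K} (h0 : x ≠ 0) (h : V.v x < n) : ¬ V.ge n x := by
  rintro (h1 | h1)
  · exact h0 h1
  · omega

lemma v_of_ge {n : ℤ} {x : K} (h : V.ge n x) (h0 : x ≠ 0) : n ≤ V.v x := h.resolve_left h0

lemma add_eq {x y : K} (hx : x ≠ 0) (hy : V.ge (V.v x + 1) y) :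
    x + y ≠ 0 ∧ V.v (x + y) = V.v x := by
  have h1 : x + y ≠ 0 := by
    intro h
    have : x = -y := eq_neg_of_add_eq_zero_left h
    have h2 := ge_neg hy
    rw [← this] at h2
    exact not_ge hx (by omega) h2
  refine ⟨h1, ?_⟩
  have h2 : V.ge (V.v x) (x + y) := ge_add (Or.inr le_rfl) (ge_mono (by omega) hy)
  have h3 := v_of_ge h2 h1
  by_contra hne
  have h4 : V.ge (V.v x + 1) (x + y - y) := ge_sub (Or.inr (by omega)) hy
  rw [add_sub_cancel_right] at h4
  exact not_ge hx (by omega) h4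

variable (V)

/-- all root differences of the cubic have the same even valuation -/
lemma root_diff [CharZero K] (h3 : V.v 3 = 0) (a b c : K)
    (h1 : a + b + c = -1) (h2 : a * b + b * c + c * a = -114) (h4 : a * b * c = -1893 / 4) :
    a - b ≠ 0 ∧ 3 * V.v (a - b) = 4 * V.v 7 - 2 * V.v 2 := by
  have hc : c = -1 - a - b := by linear_combination h1
  subst hc
  set E : K := (a - b) ^ 2 / 343 with hE
  have key : E * (E - 1) ^ 2 = -3 / 112 := by
    rw [hE]; field_simp
    ring_nf
    ring_nf at h2 h4
    have h2' : a ^ 2 = 114 - a - a * b - b - b ^ 2 := by linear_combination -h2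
    have h4' : b ^ 3 = -b ^ 2 + 114 * b - 1893 / 4 := by
      have : b * (114 - a * b - b ^ 2 - a - b) = b * a ^ 2 := by rw [h2']; ring
      linear_combination h4 - this
    grind
  have hE0 : E ≠ 0 := by
    intro h; rw [h] at key; norm_num at key
  have hE1 : E - 1 ≠ 0 := by
    intro h; rw [h] at key; norm_num at key
  have hab : a - b ≠ 0 := by
    intro h; apply hE0; rw [hE, h]; simp
  refine ⟨hab, ?_⟩
  have h7 : (7 : K) ≠ 0 := by norm_num
  have h20 : (2 : K) ≠ 0 := by norm_num
  have v7 : 0 ≤ V.v 7 := v_of_ge (ge_ofNat 7) h7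
  have v2 : 0 ≤ V.v 2 := v_of_ge (ge_ofNat 2) h20
  have e1 : V.v (-3 / 112 : K) = - 4 * V.v 2 - V.v 7 := by
    rw [V.div (by norm_num) (by norm_num), V.neg, h3,
      show (112 : K) = 2 ^ 4 * 7 by norm_num, V.mul' _ _ (by positivity) h7, V.pow h20]
    push_cast; ring
  have e2 : V.v E + 2 * V.v (E - 1) = - 4 * V.v 2 - V.v 7 := by
    rw [← e1, ← key, V.mul' _ _ hE0 (pow_ne_zero _ hE1), V.pow hE1]; push_cast; ring
  have e3 : V.v E = 2 * V.v (a - b) - 3 * V.v 7 := by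
    rw [hE, V.div (pow_ne_zero _ hab) (by norm_num), V.pow hab,
      show (343 : K) = 7 ^ 3 by norm_num, V.pow h7]; push_cast; ring
  have e4 : 3 * V.v E = - 4 * V.v 2 - V.v 7 := by
    rcases lt_trichotomy (V.v E) 0 with h | h | h
    · have := (add_eq (V := V) hE0 (y := -1) (ge_neg (ge_mono (by omega) ge_one))).2
      rw [← sub_eq_add_neg] at this
      omega
    · have h5 : V.ge 0 (E - 1) := ge_sub (Or.inr h.ge) ge_one
      have := v_of_ge h5 hE1
      omega
    · have := (add_eq (V := V) (x := -1) (y := E) (by simp)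
        (by rw [V.neg_one]; exact Or.inr (by omega))).2
      rw [neg_add_eq_sub, V.neg_one] at this
      omega
  omega

lemma even_root [CharZero K] (h3 : V.v 3 = 0) (a b c : K)
    (h1 : a + b + c = -1) (h2 : a * b + b * c + c * a = -114) (h4 : a * b * c = -1893 / 4)
    (X Y : K) (hY : Y ≠ 0) (hXY : Y ^ 2 = (X - a) * (X - b) * (X - c)) :
    Even (V.v (X - a)) := by
  obtain ⟨n1, d1⟩ := V.root_diff h3 a b c h1 h2 h4
  obtain ⟨n2, d2⟩ := V.root_diff h3 b c a (by linear_combination h1) (by linear_combination h2)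
    (by linear_combination h4)
  obtain ⟨n3, d3⟩ := V.root_diff h3 c a b (by linear_combination h1) (by linear_combination h2)
    (by linear_combination h4)
  have hne : (X - a) * (X - b) * (X - c) ≠ 0 := by rw [← hXY]; exact pow_ne_zero _ hY
  have ha : X - a ≠ 0 := by intro h; simp [h] at hne
  have hb : X - b ≠ 0 := by intro h; simp [h] at hne
  have hc : X - c ≠ 0 := by intro h; simp [h] at hne
  have hs : V.v (X - a) + V.v (X - b) + V.v (X - c) = 2 * V.v Y := by
    rw [← V.mul' _ _ ha hb, ← V.mul' _ _ (mul_ne_zero ha hb) hc, ← hXY, V.pow hY]; rfl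
  have key : ∀ p q : K, p - q ≠ 0 → X - p ≠ 0 → X - q ≠ 0 →
      (V.v (X - p) < V.v (p - q) → V.v (X - q) = V.v (X - p)) ∧
      (V.v (X - p) > V.v (p - q) → V.v (X - q) = V.v (p - q)) := by
    intro p q hpq hp hq
    constructor
    · intro h
      have := (add_eq (V := V) hp (y := p - q) (Or.inr (by omega))).2
      rwa [sub_add_sub_cancel] at this
    · intro h
      have := (add_eq (V := V) hpq (y := X - p) (Or.inr (by omega))).2
      rwa [add_comm, sub_add_sub_cancel] at this
  have kab := key a b n1 ha hb
  have kbc := key b c n2 hb hc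
  have kca := key c a n3 hc ha
  rw [Int.even_iff]
  have s1 : V.v (b - a) = V.v (a - b) := by rw [← V.neg]; ring_nf
  have s2 : V.v (a - c) = V.v (c - a) := by rw [← V.neg]; ring_nf
  have s3 : V.v (c - b) = V.v (b - c) := by rw [← V.neg]; ring_nf
  have kba := key b a (by rwa [← neg_sub, neg_ne_zero]) hb ha
  have kac := key a c (by rwa [← neg_sub, neg_ne_zero]) ha hc
  have kcb := key c b (by rwa [← neg_sub, neg_ne_zero]) hc hb
  omega

end DV
end Q14

namespace Q14
open IsDedekindDomain NumberField

/-- the additive valuation of a prime -/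
noncomputable def ordv {K : Type*} [Field K] [NumberField K] (w : HeightOneSpectrum (𝓞 K)) :
    DV K where
  v x := - WithZero.log (w.valuation K x)
  mul' x y hx hy := by
    rw [map_mul, WithZero.log_mul (by simpa using hx) (by simpa using hy)]; ring
  add' x y hx hy hxy := by
    have h := (w.valuation K).map_add x y
    have h1 : w.valuation K x ≠ 0 := by simpa using hx
    have h2 : w.valuation K y ≠ 0 := by simpa using hy
    have h3 : w.valuation K (x + y) ≠ 0 := by simpa using hxy
    rcases le_max_iff.1 h with h | h
    · have := (WithZero.log_le_log h3 h1).2 h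
      exact (min_le_left _ _).trans (by omega)
    · have := (WithZero.log_le_log h3 h2).2 h
      exact (min_le_right _ _).trans (by omega)

lemma ordv_nonneg {K : Type*} [Field K] [NumberField K] (w : HeightOneSpectrum (𝓞 K)) (x : 𝓞 K) :
    (ordv w).ge 0 (x : K) := by
  by_cases hx : (x : K) = 0
  · exact Or.inl hx
  · right
    have h := w.valuation_le_one (K := K) x
    have h1 : w.valuation K (x : K) ≠ 0 := by simpa using hx
    have := (WithZero.log_le_log h1 one_ne_zero).2 h
    rw [WithZero.log_one] at this
    show 0 ≤ - _
    linarith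

lemma ordv_integral {K : Type*} [Field K] [NumberField K] (w : HeightOneSpectrum (𝓞 K)) (x : K)
    (hx : IsIntegral ℤ x) : (ordv w).ge 0 x := ordv_nonneg w ⟨x, hx⟩

lemma ordv_eq_zero {K : Type*} [Field K] [NumberField K] (w : HeightOneSpectrum (𝓞 K)) (x : 𝓞 K)
    (hx : x ∉ w.asIdeal) : (ordv w).v (x : K) = 0 := by
  have : w.valuation K (x : K) = 1 := (w.valuation_eq_one_iff_notMem).2 hx
  show - _ = _
  rw [this]; simp

lemma ordv_pos {K : Type*} [Field K] [NumberField K] (w : HeightOneSpectrum (𝓞 K)) (x : 𝓞 K)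
    (hx : x ∈ w.asIdeal) (h0 : x ≠ 0) : 0 < (ordv w).v (x : K) := by
  have h : w.valuation K (x : K) < 1 := (w.valuation_lt_one_iff_mem x).2 hx
  have h1 : w.valuation K (x : K) ≠ 0 := by simpa using h0
  have := (WithZero.log_lt_log h1 one_ne_zero).2 h
  rw [WithZero.log_one] at this
  show 0 < - _
  linarith

set_option linter.deprecated false in
/-- a prime of odd ramification in an extension of odd degree -/
theorem odd_ramification {M Ω : Type*} [Field M] [NumberField M] [Field Ω] [NumberField Ω]
    [Algebra M Ω] (hodd : Odd (Module.finrank M Ω)) (p : HeightOneSpectrum (𝓞 M)) :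
    ∃ (P : HeightOneSpectrum (𝓞 Ω)) (n : ℕ), Odd n ∧
      ∀ m : M, (ordv P).v (algebraMap M Ω m) = n * (ordv p).v m := by
  have : p.asIdeal.IsMaximal := p.isMaximal
  have hs := Ideal.sum_ramification_inertia (𝓞 Ω) M Ω (p := p.asIdeal) p.ne_bot
  rw [← hs] at hodd
  have : ∃ P ∈ IsDedekindDomain.primesOverFinset p.asIdeal (𝓞 Ω),
      Odd (Ideal.ramificationIdx' p.asIdeal P) := by
    by_contra hcon
    push Not at hcon
    rw [← Nat.not_even_iff_odd] at hodd
    apply hodd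
    apply Finset.even_sum
    intro P hP
    have := hcon P hP
    rw [Nat.not_odd_iff_even] at this
    exact this.mul_right _
  obtain ⟨P, hP, hPo⟩ := this
  rw [IsDedekindDomain.mem_primesOverFinset_iff p.ne_bot] at hP
  obtain ⟨hP1, hP2⟩ := hP
  have hPb : P ≠ ⊥ := Ideal.ne_bot_of_liesOver_of_ne_bot p.ne_bot P
  let W : HeightOneSpectrum (𝓞 Ω) := ⟨P, hP1, hPb⟩
  have : W.asIdeal.LiesOver p.asIdeal := hP2
  refine ⟨W, _, hPo, fun m => ?_⟩
  have h := HeightOneSpectrum.valuation_liesOver (K := M) Ω p W m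
  show - WithZero.log (W.valuation Ω _) = _ * - WithZero.log (p.valuation M m)
  rw [← h, WithZero.log_pow]
  simp [W]

end Q14

namespace Q14
open IsDedekindDomain NumberField

section ringids
variable {R : Type*} [CommRing R]

/-- the sextic -/
def m6 (p : R) : R := p^6 + p^5 + 4*p^4 + 5*p^3 + 4*p^2 + 3*p + 1
def om (p : R) : R := -4 - 6*p - 6*p^2 - 8*p^3 - p^4 - 2*p^5
def qq (p : R) : R := 4 + 7*p + 6*p^2 + 8*p^3 + p^4 + 2*p^5

lemma qq_eq (p : R) : qq p = p - om p := by unfold qq om; ring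

lemma om_eq {p : R} (h : m6 p = 0) : om p ^ 2 + om p + 1 = 0 := by
  unfold m6 at h; unfold om
  linear_combination (13 + 3*p + 17*p^2 + 4*p^4) * h

lemma cub_eq {p : R} (h : m6 p = 0) : p^3 - om p * p^2 + (1 - om p) * p + 1 = 0 := by
  unfold m6 at h; unfold om
  linear_combination (1 + 2*p) * h

lemma q3_eq {p : R} (h : m6 p = 0) : qq p ^ 3 = 2 * (-2 - 3*p - p^3) := by
  have h1 := om_eq h
  have h2 := cub_eq h
  rw [qq_eq]
  have h3 : om p = -4 - 6*p - 6*p^2 - 8*p^3 - p^4 - 2*p^5 := rfl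
  unfold m6 at h
  grind

lemma uu_eq {p : R} (h : m6 p = 0) :
    (8 + 12*p + 14*p^2 + 19*p^3 + 2*p^4 + 5*p^5) * (-2 - 3*p - p^3) = 1 := by
  unfold m6 at h
  linear_combination (-17 + 3*p - 5*p^2) * h

lemma uA_eq {p : R} (h : m6 p = 0) :
    (-1 - p - p^2 - p^3) * (4*p + 4*p^2 + 4*p^3 + p^4 + p^5) = 1 := by
  unfold m6 at h
  linear_combination (-1 - p - p^2) * h

lemma uB_eq {p : R} (h : m6 p = 0) :
    (-1 - p - p^3) * (12 + 21*p + 22*p^2 + 34*p^3 + 3*p^4 + 9*p^5) = 1 := by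
  unfold m6 at h
  linear_combination (-13 + 6*p - 9*p^2) * h

lemma cA_eq {p : R} (h : m6 p = 0) :
    (-1 - p - p^2 - p^3)^3 = 1 + qq p * (om p + qq p * (-1 - 2*p + 2*p^2 + 7*p^4 + 3*p^5)) := by
  unfold m6 at h; unfold qq om
  linear_combination (30 + 47*p + 24*p^3 - 145*p^4 - 64*p^5 - 136*p^6 - 51*p^7 - 28*p^8
    - 12*p^9) * h

lemma cB_eq {p : R} (h : m6 p = 0) :
    (-1 - p - p^3)^3 = 1 + qq p * (1 + qq p * (3 + 2*p + p^2 + p^3 - 4*p^4 + p^5)) := by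
  unfold m6 at h; unfold qq
  linear_combination (-54 - 48*p - 68*p^2 - 56*p^3 + 36*p^4 - 30*p^5 + 61*p^6 - 21*p^7 + 16*p^8
    - 4*p^9) * h

lemma s3_eq {p : R} (h : m6 p = 0) : (2 * om p + 1) ^ 2 = -3 := by
  linear_combination 4 * om_eq h

end ringids

section norms
variable {M : Type*} [Field M] [NumberField M] {p : 𝓞 M}

lemma natAbs_norm_nat (n : ℕ) : (Algebra.norm ℤ (n : 𝓞 M)).natAbs = n ^ Module.finrank ℚ M := by
  have : (n : 𝓞 M) = algebraMap ℤ (𝓞 M) n := by simp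
  rw [this, Algebra.norm_algebraMap, RingOfIntegers.rank]
  simp [Int.natAbs_pow]

lemma natAbs_norm_unit {a b : 𝓞 M} (h : a * b = 1) : (Algebra.norm ℤ a).natAbs = 1 := by
  have : IsUnit (Algebra.norm ℤ a) := (IsUnit.of_mul_eq_one b h).map _
  exact Int.isUnit_iff_natAbs_eq.1 this

lemma norm_q (h : m6 p = 0) :
    (Algebra.norm ℤ (qq p)).natAbs ^ 3 = 2 ^ Module.finrank ℚ M := by
  have h1 := congrArg (fun z => (Algebra.norm ℤ z).natAbs) (q3_eq h)
  simp only [map_pow, map_mul, Int.natAbs_pow, Int.natAbs_mul] at h1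
  rw [natAbs_norm_unit (a := (-2 - 3*p - p^3)) (by rw [mul_comm]; exact uu_eq h), mul_one] at h1
  rw [h1]; exact_mod_cast natAbs_norm_nat (M := M) 2

lemma norm_s (h : m6 p = 0) :
    (Algebra.norm ℤ (2 * om p + 1)).natAbs ^ 2 = 3 ^ Module.finrank ℚ M := by
  have h1 := congrArg (fun z => (Algebra.norm ℤ z).natAbs) (s3_eq h)
  simp only [map_pow, Int.natAbs_pow] at h1
  rw [h1, show (-3 : 𝓞 M) = (-1) * (3 : ℕ) by norm_num, map_mul, Int.natAbs_mul,
    natAbs_norm_nat, natAbs_norm_unit (a := (-1 : 𝓞 M)) (b := -1) (by norm_num), one_mul]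

lemma pow_exp_dvd {a n q d : ℕ} (hn : n ≠ 0) (hq : q.Prime) (h : a ^ n = q ^ d) : n ∣ d := by
  have h1 : a ∣ q ^ d := by
    rw [← h]; exact dvd_pow_self a hn
  obtain ⟨k, _, rfl⟩ := (Nat.dvd_prime_pow hq).1 h1
  rw [← pow_mul] at h
  exact ⟨k, by rw [mul_comm]; exact (Nat.pow_right_injective hq.two_le h).symm⟩

lemma six_dvd (h : m6 p = 0) : 6 ∣ Module.finrank ℚ M := by
  have h1 := pow_exp_dvd (by norm_num) Nat.prime_two (norm_q h)
  have h2 := pow_exp_dvd (by norm_num) Nat.prime_three (norm_s h)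
  omega

lemma absNorm_q (h : m6 p = 0) (h6 : Module.finrank ℚ M = 6) :
    Ideal.absNorm (Ideal.span {qq p}) = 4 := by
  rw [Ideal.absNorm_span_singleton]
  have h1 := norm_q h
  rw [h6, show 2 ^ 6 = 4 ^ 3 by norm_num] at h1
  exact Nat.pow_left_injective (by norm_num) h1

lemma absNorm_s (h : m6 p = 0) (h6 : Module.finrank ℚ M = 6) :
    Ideal.absNorm (Ideal.span {2 * om p + 1}) = 27 := by
  rw [Ideal.absNorm_span_singleton]
  have h1 := norm_s h
  rw [h6, show 3 ^ 6 = 27 ^ 2 by norm_num] at h1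
  exact Nat.pow_left_injective (by norm_num) h1

lemma residue_pow (I : Ideal (𝓞 M)) [hI : I.IsPrime] (h0 : I ≠ ⊥) (x : 𝓞 M ⧸ I) :
    x ^ (Ideal.absNorm I) = x := by
  have : I.IsMaximal := Ideal.IsPrime.isMaximal hI h0
  let := Ideal.Quotient.field I
  have : Finite (𝓞 M ⧸ I) := Ideal.finiteQuotientOfFreeOfNeBot I h0
  let := Fintype.ofFinite (𝓞 M ⧸ I)
  have h := FiniteField.pow_card x
  rwa [← Nat.card_eq_fintype_card] at h

lemma absNorm_ne_two (h : m6 p = 0) (I : Ideal (𝓞 M)) [hI : I.IsPrime] (h0 : I ≠ ⊥) :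
    Ideal.absNorm I ≠ 2 := by
  intro h2
  have e1 := residue_pow I h0 (Ideal.Quotient.mk I (om p))
  have e2 : Ideal.Quotient.mk I (om p ^ 2 + om p + 1) = 0 := by rw [om_eq h, map_zero]
  have e3 : (Ideal.Quotient.mk I) ((2 : ℕ) : 𝓞 M) = 0 := by
    rw [Ideal.Quotient.eq_zero_iff_mem, ← h2]; exact Ideal.absNorm_mem I
  rw [h2] at e1
  simp only [map_add, map_pow, map_one, map_natCast] at e1 e2 e3
  push_cast at e3
  have : (1 : 𝓞 M ⧸ I) = 0 := by
    linear_combination e2 - e1 - (Ideal.Quotient.mk I (om p)) * e3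
  exact one_ne_zero this

lemma absNorm_three (h : m6 p = 0) (I : Ideal (𝓞 M)) [hI : I.IsPrime] (h0 : I ≠ ⊥)
    (h3 : (3 : 𝓞 M) ∈ I) : Ideal.absNorm I ≠ 3 ∧ Ideal.absNorm I ≠ 9 := by
  have e3 : (Ideal.Quotient.mk I) (3 : 𝓞 M) = 0 := by
    rwa [Ideal.Quotient.eq_zero_iff_mem]
  rw [map_ofNat] at e3
  set y := Ideal.Quotient.mk I p with hy
  set w := Ideal.Quotient.mk I (om p) with hw
  have e2 : w ^ 2 + w + 1 = 0 := by
    have := congrArg (Ideal.Quotient.mk I) (om_eq h)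
    simpa using this
  have e4 : y^3 - w * y^2 + (1 - w) * y + 1 = 0 := by
    have := congrArg (Ideal.Quotient.mk I) (cub_eq h)
    simpa using this
  have hw1 : w = 1 := by
    have : (w - 1) ^ 2 = 0 := by linear_combination e2 - w * e3
    have := pow_eq_zero_iff (two_ne_zero) |>.1 this
    linear_combination this
  rw [hw1] at e4
  have key : y ^ 9 ≠ y := by
    intro e5
    apply one_ne_zero (α := 𝓞 M ⧸ I)
    clear_value y
    grind
  constructor <;> intro hn
  · have := residue_pow I h0 y
    rw [hn] at this
    exact key (by rw [show 9 = 3 * 3 by norm_num, pow_mul, this, this])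
  · have := residue_pow I h0 y
    rw [hn] at this
    exact key this

lemma dvd_eq_of_absNorm {I J : Ideal (𝓞 M)} (hle : J ≤ I) (hJ : J ≠ ⊥)
    (h : Ideal.absNorm I = Ideal.absNorm J) : I = J := by
  obtain ⟨K, hK⟩ := Ideal.dvd_iff_le.2 hle
  have h1 : Ideal.absNorm J ≠ 0 := by
    rwa [Ne, Ideal.absNorm_eq_zero_iff]
  have h2 := congrArg Ideal.absNorm hK
  rw [map_mul, h] at h2
  have h3 : Ideal.absNorm K = 1 := by
    have : Ideal.absNorm J * 1 = Ideal.absNorm J * Ideal.absNorm K := by rw [mul_one]; exact h2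
    exact (Nat.eq_of_mul_eq_mul_left (Nat.pos_of_ne_zero h1) this).symm
  rw [Ideal.absNorm_eq_one_iff] at h3
  rw [hK, h3, Ideal.mul_top]

lemma q_ne (h : m6 p = 0) : qq p ≠ 0 := by
  intro h0
  have h1 := q3_eq h
  have h2 := uu_eq h
  rw [h0] at h1
  have : (2 : 𝓞 M) = 0 := by
    linear_combination (-(2 : 𝓞 M)) * h2 -
      (8 + 12*p + 14*p^2 + 19*p^3 + 2*p^4 + 5*p^5) * h1
  exact two_ne_zero this

lemma prime_two (h : m6 p = 0) (h6 : Module.finrank ℚ M = 6)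
    (I : Ideal (𝓞 M)) [hI : I.IsPrime] (h0 : I ≠ ⊥)
    (h2 : (2 : 𝓞 M) ∈ I) : I = Ideal.span {qq p} := by
  have hq : qq p ∈ I := by
    apply hI.mem_of_pow_mem 3
    rw [q3_eq h]; exact I.mul_mem_right _ h2
  have hle : Ideal.span {qq p} ≤ I := by rwa [Ideal.span_singleton_le_iff_mem]
  apply dvd_eq_of_absNorm hle (by simpa using q_ne h)
  rw [absNorm_q h h6]
  have hd : Ideal.absNorm I ∣ 4 := by
    rw [← absNorm_q h h6]; exact Ideal.absNorm_dvd_absNorm_of_le hle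
  have h3 := absNorm_ne_two h I h0
  have h4 : Ideal.absNorm I ≠ 1 := by rw [Ne, Ideal.absNorm_eq_one_iff]; exact hI.ne_top
  have h5 := Nat.le_of_dvd (by norm_num) hd
  interval_cases Ideal.absNorm I <;> simp_all

lemma prime_three (h : m6 p = 0) (h6 : Module.finrank ℚ M = 6)
    (I : Ideal (𝓞 M)) [hI : I.IsPrime] (h0 : I ≠ ⊥)
    (h2 : (3 : 𝓞 M) ∈ I) : I = Ideal.span {2 * om p + 1} := by
  have hq : 2 * om p + 1 ∈ I := by
    apply hI.mem_of_pow_mem 2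
    rw [s3_eq h]; exact I.neg_mem h2
  have hle : Ideal.span {2 * om p + 1} ≤ I := by rwa [Ideal.span_singleton_le_iff_mem]
  have hne : Ideal.span {2 * om p + 1} ≠ ⊥ := by
    intro hb
    have := absNorm_s h h6
    rw [hb] at this; simp at this
  apply dvd_eq_of_absNorm hle hne
  rw [absNorm_s h h6]
  have hd : Ideal.absNorm I ∣ 3 ^ 3 := by
    rw [show 3 ^ 3 = 27 by norm_num, ← absNorm_s h h6]; exact Ideal.absNorm_dvd_absNorm_of_le hle
  have h3 := absNorm_three h I h0 h2
  have h4 : Ideal.absNorm I ≠ 1 := by rw [Ne, Ideal.absNorm_eq_one_iff]; exact hI.ne_top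
  obtain ⟨k, hk, e⟩ := (Nat.dvd_prime_pow Nat.prime_three).1 hd
  interval_cases k <;> simp_all

lemma principal_small (h : m6 p = 0) (h6 : Module.finrank ℚ M = 6)
    (I : Ideal (𝓞 M)) [hI : I.IsPrime] (h0 : I ≠ ⊥) (hn : Ideal.absNorm I < 5) :
    Submodule.IsPrincipal I := by
  have hm := Ideal.absNorm_mem I
  have h3 := absNorm_ne_two h I h0
  have h4 : Ideal.absNorm I ≠ 1 := by rw [Ne, Ideal.absNorm_eq_one_iff]; exact hI.ne_top
  have h5 : Ideal.absNorm I ≠ 0 := by rwa [Ne, Ideal.absNorm_eq_zero_iff]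
  have h34 : Ideal.absNorm I = 3 ∨ Ideal.absNorm I = 4 := by omega
  rcases h34 with e | e
  · rw [e] at hm
    exact absurd e (absNorm_three h I h0 (by exact_mod_cast hm)).1
  · rw [e] at hm
    have h2 : (2 : 𝓞 M) ∈ I := by
      apply hI.mem_of_pow_mem 2
      convert hm using 1; norm_num
    rw [prime_two h h6 I h0 h2]
    exact ⟨⟨_, rfl⟩⟩

end norms

end Q14

namespace Q14
set_option linter.unusedSectionVars false
set_option linter.unusedSimpArgs false
open IsDedekindDomain NumberField

def C6 : Matrix (Fin 6) (Fin 6) ℤ :=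
  !![0,0,0,0,0,-1;1,0,0,0,0,-3;0,1,0,0,0,-4;0,0,1,0,0,-5;0,0,0,1,0,-4;0,0,0,0,1,-1]
def C62 : Matrix (Fin 6) (Fin 6) ℤ :=
  !![0,0,0,0,-1,1;0,0,0,0,-3,2;1,0,0,0,-4,1;0,1,0,0,-5,1;0,0,1,0,-4,-1;0,0,0,1,-1,-3]

lemma tr_C : C6.trace = -1 ∧ (C6^2).trace = -7 ∧ (C6^3).trace = -4 ∧ (C6^4).trace = 21 ∧
    (C6^5).trace = 19 := by
  have h2 : C6^2 = C62 := by rw [pow_two]; decide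
  refine ⟨by decide, by rw [h2]; decide, ?_, ?_, ?_⟩
  · rw [pow_succ, h2]; decide
  · rw [show 4 = 2*2 by norm_num, pow_mul, h2, pow_two]; decide
  · have : C6^5 = C62 * C62 * C6 := by rw [← h2]; noncomm_ring
    rw [this]
    decide +kernel

def tv : ℕ → ℤ := fun n => [6,-1,-7,-4,21,19,-58,-85,157,338,-387].getD n 0
lemma det_tv : Matrix.det (Matrix.of fun i j : Fin 6 => tv (i+j)) = -21168 := by
  decide +kernel

section disc
variable {M : Type*} [Field M] [NumberField M] {p : 𝓞 M}

lemma m6_map {R S : Type*} [CommRing R] [CommRing S] (f : R →+* S) (r : R) :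
    m6 (f r) = f (m6 r) := by
  simp only [m6, map_add, map_mul, map_pow, map_ofNat, map_one]
lemma m6_coe (h : m6 p = 0) : m6 (p : M) = 0 := by
  rw [show (p : M) = algebraMap (𝓞 M) M p from rfl, m6_map, h, map_zero]

lemma exists_basis (h : m6 p = 0) (hgen : IntermediateField.adjoin ℚ {(p : M)} = ⊤) :
    Module.finrank ℚ M = 6 ∧ ∃ b : Module.Basis (Fin 6) ℚ M, ∀ i, b i = (p : M) ^ (i : ℕ) := by
  have hint : IsIntegral ℚ (p : M) := Algebra.IsIntegral.isIntegral _
  have hpos : 0 < Module.finrank ℚ M := Module.finrank_pos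
  have hle : Module.finrank ℚ M ≤ 6 := by
    rw [← IntermediateField.finrank_top', ← hgen, IntermediateField.adjoin.finrank hint]
    have : minpoly ℚ (p : M) ∣ (Polynomial.X^6 + Polynomial.X^5 + 4*Polynomial.X^4
        + 5*Polynomial.X^3 + 4*Polynomial.X^2 + 3*Polynomial.X + 1) := by
      apply minpoly.dvd
      have := m6_coe h
      simpa [m6, map_ofNat] using this
    have hd : (Polynomial.X^6 + Polynomial.X^5 + 4*Polynomial.X^4
        + 5*Polynomial.X^3 + 4*Polynomial.X^2 + 3*Polynomial.X + 1 : Polynomial ℚ).natDegree = 6 := by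
      compute_degree!
    rw [← hd]
    apply Polynomial.natDegree_le_of_dvd this
    intro h0
    rw [h0] at hd; simp at hd
  have h6 : Module.finrank ℚ M = 6 := by
    obtain ⟨k, hk⟩ := six_dvd h; omega
  refine ⟨h6, ?_⟩
  have hdeg : (minpoly ℚ (p : M)).natDegree = 6 := by
    rw [← IntermediateField.adjoin.finrank hint, hgen, IntermediateField.finrank_top', h6]
  have hli := linearIndependent_pow (K := ℚ) (p : M)
  rw [hdeg] at hli
  refine ⟨basisOfLinearIndependentOfCardEqFinrank hli (by simp [h6]), fun i => ?_⟩
  simp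

lemma leftMul_C (h : m6 p = 0) (b : Module.Basis (Fin 6) ℚ M) (hb : ∀ i, b i = (p : M) ^ (i : ℕ)) :
    Algebra.leftMulMatrix b (p : M) = C6.map (Int.castRingHom ℚ) := by
  have h' := m6_coe h
  apply (Matrix.toLin b b).injective
  rw [← Algebra.toMatrix_lmul_eq, Matrix.toLin_toMatrix]
  apply b.ext
  intro i
  rw [Matrix.toLin_self]
  simp only [hb, Fin.sum_univ_six]
  fin_cases i <;> simp [C6, Matrix.map_apply, Algebra.smul_def] <;> unfold m6 at h' <;> first | ring1 | linear_combination h'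

lemma trace_nat (h : m6 p = 0) (b : Module.Basis (Fin 6) ℚ M) (hb : ∀ i, b i = (p : M) ^ (i : ℕ))
    (n : ℕ) : Algebra.trace ℚ M ((p : M) ^ n) = (((C6 ^ n).trace : ℤ) : ℚ) := by
  rw [Algebra.trace_eq_matrix_trace b, map_pow, leftMul_C h b hb, ← Matrix.map_pow]
  simp [Matrix.trace]

lemma trace_rec (h : m6 p = 0) (n : ℕ) :
    Algebra.trace ℚ M ((p : M) ^ (n+6)) = - Algebra.trace ℚ M ((p : M) ^ (n+5))
      - 4 * Algebra.trace ℚ M ((p : M) ^ (n+4)) - 5 * Algebra.trace ℚ M ((p : M) ^ (n+3))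
      - 4 * Algebra.trace ℚ M ((p : M) ^ (n+2)) - 3 * Algebra.trace ℚ M ((p : M) ^ (n+1))
      - Algebra.trace ℚ M ((p : M) ^ n) := by
  have h' := m6_coe h
  have : (p : M)^(n+6) = - (p:M)^(n+5) - (4:ℚ) • (p:M)^(n+4) - (5:ℚ) • (p:M)^(n+3)
     - (4:ℚ) • (p:M)^(n+2) - (3:ℚ) • (p:M)^(n+1) - (p:M)^n := by
    simp only [Algebra.smul_def, map_ofNat]
    unfold m6 at h'
    linear_combination (p:M)^n * h'
  rw [this]
  simp only [map_sub, map_neg, map_smul, smul_eq_mul]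

lemma trace_tv (h : m6 p = 0) (b : Module.Basis (Fin 6) ℚ M) (hb : ∀ i, b i = (p : M) ^ (i : ℕ))
    (n : ℕ) (hn : n ≤ 10) : Algebra.trace ℚ M ((p : M) ^ n) = tv n := by
  obtain ⟨c1, c2, c3, c4, c5⟩ := tr_C
  have t0 : Algebra.trace ℚ M ((p : M) ^ 0) = 6 := by
    rw [trace_nat h b hb]; simp
  have t1 : Algebra.trace ℚ M ((p : M) ^ 1) = -1 := by
    rw [trace_nat h b hb, pow_one, c1]; norm_num
  have t2 : Algebra.trace ℚ M ((p : M) ^ 2) = -7 := by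
    rw [trace_nat h b hb, c2]; norm_num
  have t3 : Algebra.trace ℚ M ((p : M) ^ 3) = -4 := by
    rw [trace_nat h b hb, c3]; norm_num
  have t4 : Algebra.trace ℚ M ((p : M) ^ 4) = 21 := by
    rw [trace_nat h b hb, c4]; norm_num
  have t5 : Algebra.trace ℚ M ((p : M) ^ 5) = 19 := by
    rw [trace_nat h b hb, c5]; norm_num
  have t6 := trace_rec h 0
  have t7 := trace_rec h 1
  have t8 := trace_rec h 2
  have t9 := trace_rec h 3
  have t10 := trace_rec h 4
  simp only [Nat.reduceAdd, t0, t1, t2, t3, t4, t5] at t6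
  simp only [Nat.reduceAdd, t0, t1, t2, t3, t4, t5, t6] at t7
  simp only [Nat.reduceAdd, t0, t1, t2, t3, t4, t5, t6, t7] at t8
  simp only [Nat.reduceAdd, t0, t1, t2, t3, t4, t5, t6, t7, t8] at t9
  simp only [Nat.reduceAdd, t0, t1, t2, t3, t4, t5, t6, t7, t8, t9] at t10
  interval_cases n <;> simp only [tv, List.getD_cons_zero, List.getD_cons_succ, *] <;> norm_num

lemma discr_b (h : m6 p = 0) (b : Module.Basis (Fin 6) ℚ M) (hb : ∀ i, b i = (p : M) ^ (i : ℕ)) :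
    Algebra.discr ℚ b = -21168 := by
  rw [Algebra.discr_def]
  have : Algebra.traceMatrix ℚ b
      = (Matrix.of fun i j : Fin 6 => tv (i+j)).map (Int.castRingHom ℚ) := by
    ext i j
    rw [Algebra.traceMatrix_apply, Algebra.traceForm_apply, hb, hb, ← pow_add,
      trace_tv h b hb _ (by omega)]
    simp
  rw [this, ← RingHom.mapMatrix_apply, ← RingHom.map_det, det_tv]
  norm_num

lemma discr_le (h : m6 p = 0) (hgen : IntermediateField.adjoin ℚ {(p : M)} = ⊤) :
    |NumberField.discr M| ≤ 21168 := by
  obtain ⟨h6, b, hb⟩ := exists_basis h hgen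
  have hd := discr_b h b hb
  have hcard : Fintype.card (Module.Free.ChooseBasisIndex ℤ (𝓞 M)) = 6 := by
    rw [← Module.finrank_eq_card_chooseBasisIndex, RingOfIntegers.rank, h6]
  let e := Fintype.equivFinOfCardEq hcard
  let B := (NumberField.RingOfIntegers.basis M).reindex e
  let B' := (NumberField.integralBasis M).reindex e
  let A : Matrix (Fin 6) (Fin 6) ℤ := Matrix.of fun i j => B.repr (p ^ (j : ℕ)) i
  have hB : Algebra.discr ℚ B' = NumberField.discr M := by
    rw [NumberField.coe_discr]
    have : (B' : Fin 6 → M) = (NumberField.integralBasis M) ∘ e.symm := by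
      ext i; simp [B']
    rw [this, Algebra.discr_reindex]
  have hv : (b : Fin 6 → M) = Matrix.vecMul B' ((A.map (algebraMap ℤ ℚ)).map (algebraMap ℚ M)) := by
    ext j
    rw [hb]
    have := congrArg (algebraMap (𝓞 M) M) (B.sum_repr (p ^ (j : ℕ)))
    rw [map_sum] at this
    rw [show (p : M) = algebraMap (𝓞 M) M p from rfl, ← map_pow, ← this]
    simp only [Matrix.vecMul, dotProduct]
    apply Finset.sum_congr rfl
    intro i _
    simp [B', B, A, NumberField.integralBasis_apply, mul_comm]
  rw [hv, Algebra.discr_of_matrix_vecMul, hB] at hd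
  rw [← RingHom.mapMatrix_apply, ← RingHom.map_det] at hd
  have hd' : A.det ^ 2 * NumberField.discr M = -21168 := by
    have : ((A.det ^ 2 * NumberField.discr M : ℤ) : ℚ) = ((-21168 : ℤ) : ℚ) := by
      rw [Int.cast_mul, Int.cast_pow, Int.cast_neg]
      simpa using hd
    exact_mod_cast this
  have h0 : A.det ≠ 0 := by
    intro h0; rw [h0] at hd'; norm_num at hd'
  have h1 : 1 ≤ A.det ^ 2 := by
    have := sq_pos_of_ne_zero h0; omega
  have h2 := congrArg abs hd'
  rw [abs_mul, abs_of_nonneg (by omega : 0 ≤ A.det ^ 2)] at h2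
  norm_num at h2
  nlinarith [abs_nonneg (NumberField.discr M)]

lemma no_real (h : m6 p = 0) (φ : M →+* ℂ) : ¬ ComplexEmbedding.IsReal φ := by
  intro hr
  have hc : ∀ x : M, (φ x).im = 0 := fun x => by
    have := congrArg (fun f => f x) (ComplexEmbedding.isReal_iff.1 hr)
    exact Complex.conj_eq_iff_im.1 this
  have h1 := om_eq (m6_coe h)
  have h2 := congrArg φ h1
  simp only [map_add, map_pow, map_one, map_zero] at h2
  have h3 := hc (om (p:M))
  have h4 := congrArg Complex.re h2
  simp only [Complex.add_re, pow_two, Complex.mul_re, h3, Complex.one_re, Complex.zero_re] at h4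
  nlinarith [sq_nonneg ((φ (om (p:M))).re + 1/2)]

lemma nrReal (h : m6 p = 0) : InfinitePlace.nrRealPlaces M = 0 := by
  rw [nrRealPlaces_eq_zero_iff, isTotallyComplex_iff]
  intro w
  rw [← InfinitePlace.not_isReal_iff_isComplex]
  exact fun hw => no_real h w.embedding (InfinitePlace.isReal_iff.1 hw)

lemma nrComplex (h : m6 p = 0) (h6 : Module.finrank ℚ M = 6) : InfinitePlace.nrComplexPlaces M = 3 := by
  have := InfinitePlace.card_add_two_mul_card_eq_rank M
  rw [nrReal h, h6] at this
  omega

lemma isPID (h : m6 p = 0) (hgen : IntermediateField.adjoin ℚ {(p : M)} = ⊤) :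
    IsPrincipalIdealRing (𝓞 M) := by
  have h6 := (exists_basis h hgen).1
  have hd := discr_le h hgen
  apply RingOfIntegers.isPrincipalIdealRing_of_isPrincipal_of_norm_le_of_isPrime
  intro I hI hn
  have hI' : (I : Ideal (𝓞 M)).IsPrime := hI
  apply principal_small h h6 _ (nonZeroDivisors.ne_zero I.2)
  have hb : Real.sqrt |(NumberField.discr M : ℝ)| < 146 := by
    rw [Real.sqrt_lt' (by norm_num)]
    have : (|NumberField.discr M| : ℝ) ≤ 21168 := by exact_mod_cast hd
    linarith
  rw [nrComplex h h6, h6] at hn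
  have hpi : (4 / Real.pi) < 1.2740 := by
    rw [div_lt_iff₀ Real.pi_pos]
    nlinarith [Real.pi_gt_d6]
  have hpi3 : (4 / Real.pi)^3 < 1.2740^3 := by
    gcongr
  have : ((Ideal.absNorm (I : Ideal (𝓞 M)) : ℝ)) < 5 := by
    refine lt_of_le_of_lt hn ?_
    have hpos : 0 < (4 / Real.pi)^3 := by positivity
    have hs := Real.sqrt_nonneg |(NumberField.discr M : ℝ)|
    have : (4 / Real.pi)^3 * Real.sqrt |(NumberField.discr M : ℝ)| ≤ 1.2740^3 * 146 := by
      gcongr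
    norm_num [Nat.factorial] at this ⊢
    nlinarith
  exact_mod_cast this

end disc
end Q14

namespace Q14
open IsDedekindDomain NumberField
set_option linter.unusedSectionVars false
section units
variable {M : Type*} [Field M] [NumberField M] {p : 𝓞 M}

lemma qq_prime (h : m6 p = 0) (h6 : Module.finrank ℚ M = 6) : Prime (qq p) := by
  have hne : Ideal.span {(2 : 𝓞 M)} ≠ ⊤ := by
    intro ht
    have h1 := Ideal.absNorm_span_singleton (2 : 𝓞 M)
    rw [ht, Ideal.absNorm_top, show (2 : 𝓞 M) = ((2 : ℕ) : 𝓞 M) by norm_num,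
      natAbs_norm_nat, h6] at h1
    norm_num at h1
  obtain ⟨I, hI, hle⟩ := Ideal.exists_le_maximal _ hne
  have h2 : (2 : 𝓞 M) ∈ I := hle (Ideal.mem_span_singleton_self _)
  have hI' := hI.isPrime
  have h0 : I ≠ ⊥ := by
    rintro rfl; simp at h2
  have := prime_two h h6 I h0 h2
  rw [← Ideal.span_singleton_prime (q_ne h), ← this]
  exact hI'

lemma two_eq (h : m6 p = 0) : (2 : 𝓞 M) = qq p ^ 3 * (8 + 12*p + 14*p^2 + 19*p^3 + 2*p^4 + 5*p^5) := by
  linear_combination (-2) * uu_eq h - (8 + 12*p + 14*p^2 + 19*p^3 + 2*p^4 + 5*p^5) * q3_eq h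

/-- Ch ε c : ε³ ≡ 1 + q c mod q² -/
def Ch (p ε c : 𝓞 M) : Prop := qq p ^ 2 ∣ ε ^ 3 - 1 - qq p * c

lemma cube_one (h : m6 p = 0) (h6 : Module.finrank ℚ M = 6) {x : 𝓞 M} (hx : ¬ qq p ∣ x) :
    ∃ c, Ch p x c := by
  have hp := qq_prime h h6
  have hI : (Ideal.span {qq p}).IsPrime := (Ideal.span_singleton_prime (q_ne h)).2 hp
  have h1 := residue_pow (Ideal.span {qq p}) (by simpa using q_ne h) (Ideal.Quotient.mk _ x)
  rw [absNorm_q h h6, ← map_pow, Ideal.Quotient.eq, Ideal.mem_span_singleton] at h1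
  have h2 : qq p ∣ x * (x^3 - 1) := by
    rw [show x * (x^3-1) = x^4 - x by ring]; exact h1
  obtain ⟨c, hc⟩ := (hp.dvd_or_dvd h2).resolve_left hx
  exact ⟨c, 0, by rw [hc]; ring⟩

lemma Ch.mul {ε δ c d : 𝓞 M} (h1 : Ch p ε c) (h2 : Ch p δ d) : Ch p (ε * δ) (c + d) := by
  obtain ⟨a, ha⟩ := h1
  obtain ⟨b, hb⟩ := h2
  refine ⟨a + b + c*d + qq p * (c * b + d * a) + qq p ^ 2 * a * b, ?_⟩
  have ea : ε^3 = 1 + qq p * c + qq p^2 * a := by linear_combination ha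
  have eb : δ^3 = 1 + qq p * d + qq p^2 * b := by linear_combination hb
  rw [mul_pow, ea, eb]; ring

lemma Ch.congr (h : m6 p = 0) {ε c d : 𝓞 M} (h1 : Ch p ε c) (h2 : Ch p ε d) : qq p ∣ c - d := by
  have h3 : qq p ^ 2 ∣ qq p * (c - d) := by
    have := dvd_sub h2 h1
    rwa [show ε ^ 3 - 1 - qq p * d - (ε ^ 3 - 1 - qq p * c) = qq p * (c - d) by ring] at this
  rw [pow_two] at h3
  exact (mul_dvd_mul_iff_left (q_ne h)).1 h3

lemma Ch.of_congr {ε c d : 𝓞 M} (h1 : Ch p ε c) (h2 : qq p ∣ c - d) : Ch p ε d := by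
  obtain ⟨k, hk⟩ := h2
  have := dvd_add h1 (Dvd.intro k rfl : qq p ^ 2 ∣ qq p ^2 * k)
  rwa [show ε ^ 3 - 1 - qq p * c + qq p ^ 2 * k = ε ^ 3 - 1 - qq p * d by
    linear_combination -qq p * hk] at this

lemma q_dvd_two (h : m6 p = 0) : qq p ∣ 2 := by
  rw [two_eq h]; exact (dvd_pow_self _ (by norm_num)).mul_right _

lemma Ch.sq (h : m6 p = 0) {ε c : 𝓞 M} (h1 : Ch p ε c) : Ch p (ε ^ 2) 0 := by
  rw [pow_two]
  apply (h1.mul h1).of_congr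
  rw [show c + c - 0 = 2 * c by ring]
  exact (q_dvd_two h).mul_right _

lemma no_i (h : m6 p = 0) (h6 : Module.finrank ℚ M = 6) (i : 𝓞 M) : i ^ 2 ≠ -1 := by
  intro hi
  have hp := qq_prime h h6
  obtain ⟨U, hU⟩ : ∃ U : 𝓞 M, U = (8 + 12*p + 14*p^2 + 19*p^3 + 2*p^4 + 5*p^5) := ⟨_, rfl⟩
  have h2 := two_eq h
  rw [← hU] at h2
  have hu := uu_eq h
  rw [← hU] at hu
  have h3 : qq p ∣ (i - 1)^2 := by
    refine ⟨- qq p^2 * U * i, ?_⟩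
    linear_combination hi - i * h2
  obtain ⟨a, ha⟩ := hp.dvd_of_dvd_pow h3
  have h4 : qq p ^ 2 * (qq p * U + qq p^2 * U * a + a^2) = 0 := by
    have hi' : i = 1 + qq p * a := by linear_combination ha
    rw [hi'] at hi
    linear_combination hi - (1 + qq p * a) * h2
  have h5 := (mul_eq_zero.1 h4).resolve_left (pow_ne_zero 2 (q_ne h))
  have h6 : qq p ∣ a ^ 2 := ⟨-U - qq p * U * a, by linear_combination h5⟩
  obtain ⟨b, rfl⟩ := hp.dvd_of_dvd_pow h6
  have h7 : qq p * (U + qq p ^ 2 * U * b + qq p * b^2) = 0 := by linear_combination h5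
  have h8 := (mul_eq_zero.1 h7).resolve_left (q_ne h)
  apply hp.not_isUnit
  apply IsUnit.of_mul_eq_one ((- qq p * U * b - b^2) * (-2 - 3*p - p^3))
  linear_combination hu - (-2 - 3*p - p^3) * h8

lemma unit_not_dvd (h : m6 p = 0) (h6 : Module.finrank ℚ M = 6) (u : (𝓞 M)ˣ) : ¬ qq p ∣ (u : 𝓞 M) :=
  fun hd => (qq_prime h h6).not_isUnit (isUnit_of_dvd_unit hd u.isUnit)

lemma ch_neg_one (h : m6 p = 0) : Ch p (-1) 0 := by
  refine ⟨-(qq p * (8 + 12*p + 14*p^2 + 19*p^3 + 2*p^4 + 5*p^5)), ?_⟩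
  linear_combination - two_eq h

lemma ch_one : Ch p 1 0 := ⟨0, by ring⟩

lemma Ch.pow {ε c : 𝓞 M} (h1 : Ch p ε c) (n : ℕ) : Ch p (ε ^ n) (n * c) := by
  induction n with
  | zero => simpa using ch_one
  | succ n ih =>
    rw [pow_succ]; push_cast; rw [add_mul, one_mul]; exact ih.mul h1

lemma ch_torsion (h : m6 p = 0) (h6 : Module.finrank ℚ M = 6) (z : (𝓞 M)ˣ) (hz : IsOfFinOrder z) :
    Ch p (z : 𝓞 M) 0 := by
  obtain ⟨c, hc⟩ := cube_one h h6 (unit_not_dvd h h6 z)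
  have hn := hz.orderOf_pos
  have hodd : ∀ m : ℕ, Odd m → Ch p ((z : 𝓞 M) ^ m) 0 → Ch p (z : 𝓞 M) 0 := by
    rintro m ⟨k, rfl⟩ hm
    apply hc.of_congr
    have := (hc.pow (2*k+1)).congr h hm
    push_cast at this
    have h2 : qq p ∣ 2 * (k * c) := (q_dvd_two h).mul_right _
    have := dvd_sub this h2
    rwa [show (2 * (k:𝓞 M) + 1) * c - 0 - 2 * (k * c) = c - 0 by ring] at this
  have h1 : z ^ orderOf z = 1 := pow_orderOf_eq_one z
  have h1' : (z : 𝓞 M) ^ orderOf z = 1 := by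
    rw [← Units.val_pow_eq_pow_val, h1, Units.val_one]
  rcases Nat.even_or_odd (orderOf z) with ⟨k, hk⟩ | ho
  · have h2 : ((z : 𝓞 M) ^ k - 1) * ((z : 𝓞 M) ^ k + 1) = 0 := by
      rw [hk, pow_add] at h1'; linear_combination h1'
    have h3 : (z : 𝓞 M) ^ k = -1 := by
      rcases mul_eq_zero.1 h2 with h3 | h3
      · exfalso
        have : z ^ k = 1 := by
          apply Units.ext
          rw [Units.val_pow_eq_pow_val, sub_eq_zero.1 h3, Units.val_one]
        have := orderOf_dvd_of_pow_eq_one this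
        have := Nat.le_of_dvd (by omega) this
        omega
      · linear_combination h3
    have hko : Odd k := by
      rw [← Nat.not_even_iff_odd]
      rintro ⟨j, rfl⟩
      apply no_i h h6 ((z : 𝓞 M) ^ j)
      rw [← h3]; ring
    exact hodd k hko (by rw [h3]; exact ch_neg_one h)
  · exact hodd _ ho (by rw [h1']; exact ch_one)

lemma fund_aux (n : ℕ) (hn : n = Units.rank M) : ∃ f : Fin n → (𝓞 M)ˣ, ∀ x : (𝓞 M)ˣ,
    ∃ z : (𝓞 M)ˣ, IsOfFinOrder z ∧ ∃ e : Fin n → ℤ, x = z * ∏ i, f i ^ e i := by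
  subst hn
  refine ⟨Units.fundSystem M, fun x => ?_⟩
  obtain ⟨⟨z, e⟩, hx, -⟩ := Units.exist_unique_eq_mul_prod M x
  exact ⟨z, (CommGroup.mem_torsion _).1 z.2, e, hx⟩

lemma rank_two (h : m6 p = 0) (h6 : Module.finrank ℚ M = 6) : Units.rank M = 2 := by
  unfold Units.rank
  rw [InfinitePlace.card_eq_nrRealPlaces_add_nrComplexPlaces, nrReal h, nrComplex h h6]

lemma cg_aux {G : Type*} [CommGroup G] (z A B c d : G) :
    z * (A * c * (B * d)) = z * (A * B) * (c * d) := by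
  rw [mul_mul_mul_comm, ← mul_assoc]

lemma fund (h : m6 p = 0) (h6 : Module.finrank ℚ M = 6) : ∃ f g : (𝓞 M)ˣ, ∀ x : (𝓞 M)ˣ,
    ∃ z : (𝓞 M)ˣ, IsOfFinOrder z ∧ ∃ η : (𝓞 M)ˣ, ∃ a b : Fin 2,
      x = z * η ^ 2 * (f ^ (a : ℕ) * g ^ (b : ℕ)) := by
  obtain ⟨f, hf⟩ := fund_aux (M := M) 2 (rank_two h h6).symm
  refine ⟨f 0, f 1, fun x => ?_⟩
  obtain ⟨z, hz, e, he⟩ := hf x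
  refine ⟨z, hz, f 0 ^ (e 0 / 2) * f 1 ^ (e 1 / 2), ⟨(e 0 % 2).toNat, by omega⟩,
    ⟨(e 1 % 2).toNat, by omega⟩, ?_⟩
  rw [he, Fin.prod_univ_two]
  have key : ∀ (u : (𝓞 M)ˣ) (n : ℤ), u ^ n = (u ^ (n / 2)) ^ 2 * u ^ (n % 2).toNat := by
    intro u n
    rw [← zpow_natCast (u ^ (n/2)) 2, ← zpow_natCast, ← zpow_mul, ← zpow_add,
      Int.toNat_of_nonneg (by omega)]
    congr 1; push_cast; omega
  rw [key (f 0) (e 0), key (f 1) (e 1), mul_pow]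
  dsimp only
  exact cg_aux _ _ _ _ _

lemma unit_main (h : m6 p = 0) (h6 : Module.finrank ℚ M = 6) (x : (𝓞 M)ˣ)
    (hx : qq p ^ 2 ∣ (x : 𝓞 M) ^ 3 - 1) :
    ∃ z η : (𝓞 M)ˣ, IsOfFinOrder z ∧ x = z * η ^ 2 := by
  have hp := qq_prime h h6
  obtain ⟨f, g, hfg⟩ := fund h h6
  obtain ⟨c, hc⟩ := cube_one h h6 (unit_not_dvd h h6 f)
  obtain ⟨d, hd⟩ := cube_one h h6 (unit_not_dvd h h6 g)
  have hI : (Ideal.span {qq p}).IsPrime := (Ideal.span_singleton_prime (q_ne h)).2 hp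
  let π := Ideal.Quotient.mk (Ideal.span {qq p})
  have hπ : ∀ a b : 𝓞 M, qq p ∣ a - b → π a = π b := by
    intro a b hab
    rw [Ideal.Quotient.eq, Ideal.mem_span_singleton]; exact hab
  have key : ∀ (z η : (𝓞 M)ˣ) (a b : Fin 2) (t : 𝓞 M), IsOfFinOrder z →
      Ch p ((z * η ^ 2 * (f ^ (a : ℕ) * g ^ (b : ℕ)) : (𝓞 M)ˣ) : 𝓞 M) t →
      (a : ℕ) * π c + (b : ℕ) * π d = π t := by
    intro z η a b t hz ht
    obtain ⟨e, he⟩ := cube_one h h6 (unit_not_dvd h h6 η)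
    have h1 := ((ch_torsion h h6 z hz).mul (he.sq h)).mul ((hc.pow a).mul (hd.pow b))
    have h2 := hπ _ _ (h1.congr h (by push_cast at ht; exact ht))
    rw [← h2]; simp
  obtain ⟨zA, hzA, ηA, a1, b1, hA⟩ := hfg ⟨_, _, uA_eq h, by rw [mul_comm]; exact uA_eq h⟩
  obtain ⟨zB, hzB, ηB, a2, b2, hB⟩ := hfg ⟨_, _, uB_eq h, by rw [mul_comm]; exact uB_eq h⟩
  obtain ⟨z, hz, η, a, b, hX⟩ := hfg x
  have kA := key zA ηA a1 b1 (om p) hzA (by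
    rw [← hA]; exact ⟨(-1 - 2*p + 2*p^2 + 7*p^4 + 3*p^5), by rw [cA_eq h]; ring⟩)
  have kB := key zB ηB a2 b2 1 hzB (by
    rw [← hB]; exact ⟨(3 + 2*p + p^2 + p^3 - 4*p^4 + p^5), by rw [cB_eq h]; ring⟩)
  have kX := key z η a b 0 hz (by
    rw [← hX]; unfold Ch; simpa using hx)
  have w1 : π (om p) ^ 2 + π (om p) + 1 = 0 := by
    have := congrArg π (om_eq h); simpa using this
  have w2 : (2 : 𝓞 M ⧸ Ideal.span {qq p}) = 0 := by
    have := hπ 2 0 (by simpa using q_dvd_two h); simpa [map_ofNat] using this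
  have w3 : (1 : 𝓞 M ⧸ Ideal.span {qq p}) ≠ 0 := one_ne_zero
  rw [map_one] at kB
  rw [map_zero] at kX
  have hab : a = 0 ∧ b = 0 := by
    generalize π c = C at *
    generalize π d = D at *
    generalize π (om p) = w at *
    clear hA hB hX
    fin_cases a <;> fin_cases b <;> fin_cases a1 <;> fin_cases b1 <;> fin_cases a2 <;>
      fin_cases b2 <;> simp at kA kB kX ⊢ <;> grind
  obtain ⟨rfl, rfl⟩ := hab
  exact ⟨z, η, hz, by rw [hX]; simp⟩
end units
end Q14

namespace Q14
open IsDedekindDomain NumberField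
set_option linter.unusedSectionVars false
section mmain
variable {M : Type*} [Field M] [NumberField M] {p : 𝓞 M}

lemma ge_mem (w : HeightOneSpectrum (𝓞 M)) (x : 𝓞 M) (n : ℕ) (hx : (ordv w).ge n (x : M)) :
    x ∈ w.asIdeal ^ n := by
  rcases hx with h0 | hx
  · have : x = 0 := by exact_mod_cast h0
    rw [this]; exact zero_mem _
  by_cases h0 : x = 0
  · rw [h0]; exact zero_mem _
  rw [← w.intValuation_le_pow_iff_mem, ← w.valuation_of_algebraMap (K := M)]
  have h1 : w.valuation M (x : M) ≠ 0 := by simpa using h0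
  have hx' : (n : ℤ) ≤ - WithZero.log (w.valuation M (x : M)) := hx
  change w.valuation M (x : M) ≤ _
  rw [← WithZero.exp_log h1]
  rw [WithZero.exp_le_exp]
  omega

lemma sqf_decomp {R : Type*} [CommRing R] [IsDomain R] [IsPrincipalIdealRing R] (x : R) (hx : x ≠ 0) :
    ∃ g r : R, x = g ^ 2 * r ∧ Squarefree r := by
  refine WellFounded.induction (C := fun x : R => x ≠ 0 → ∃ g r : R, x = g ^ 2 * r ∧ Squarefree r)
    (wellFounded_dvdNotUnit (α := R)) x ?_ hx
  clear hx x
  intro x ih hx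
  by_cases hs : Squarefree x
  · exact ⟨1, x, by ring, hs⟩
  · unfold Squarefree at hs
    push Not at hs
    obtain ⟨y, ⟨x', hx'⟩, hy⟩ := hs
    have hx0 : x' ≠ 0 := by rintro rfl; simp at hx'; exact hx hx'
    obtain ⟨g, r, hg, hr⟩ := ih x' ⟨hx0, y*y, fun hu => hy (isUnit_of_mul_isUnit_left hu),
      by rw [hx']; ring⟩ hx0
    exact ⟨y * g, r, by rw [hx', hg]; ring, hr⟩

lemma two_not_mem_three (w : HeightOneSpectrum (𝓞 M)) (h2 : (2 : 𝓞 M) ∈ w.asIdeal) :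
    (3 : 𝓞 M) ∉ w.asIdeal := by
  intro h3
  apply w.isPrime.ne_top
  rw [Ideal.eq_top_iff_one]
  have := sub_mem h3 h2
  rwa [show (3 : 𝓞 M) - 2 = 1 by norm_num] at this

lemma three_prime (h : m6 p = 0) (h6 : Module.finrank ℚ M = 6) : Prime (2 * om p + 1) := by
  have hne : Ideal.span {(3 : 𝓞 M)} ≠ ⊤ := by
    intro ht
    have h1 := Ideal.absNorm_span_singleton (3 : 𝓞 M)
    rw [ht, Ideal.absNorm_top, show (3 : 𝓞 M) = ((3 : ℕ) : 𝓞 M) by norm_num,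
      natAbs_norm_nat, h6] at h1
    norm_num at h1
  obtain ⟨I, hI, hle⟩ := Ideal.exists_le_maximal _ hne
  have h2 : (3 : 𝓞 M) ∈ I := hle (Ideal.mem_span_singleton_self _)
  have hI' := hI.isPrime
  have h0 : I ≠ ⊥ := by
    rintro rfl; simp at h2
  have := prime_three h h6 I h0 h2
  rw [← Ideal.span_singleton_prime, ← this]
  · exact hI'
  · intro h0
    have := s3_eq h
    rw [h0] at this; norm_num at this

lemma even_decomp (h : m6 p = 0) (hgen : IntermediateField.adjoin ℚ {(p : M)} = ⊤)
    (β : M) (hβ : β ≠ 0)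
    (heven : ∀ w : HeightOneSpectrum (𝓞 M), (3 : 𝓞 M) ∉ w.asIdeal → Even ((ordv w).v β)) :
    ∃ (ε : (𝓞 M)ˣ) (a : ℕ) (γ : M), a < 2 ∧ β = ((ε : 𝓞 M) : M) * (2 * om (p : M) + 1) ^ a * γ ^ 2 := by
  have h6 := (exists_basis h hgen).1
  have := isPID h hgen
  obtain ⟨n, d, hd, rfl⟩ := IsFractionRing.div_surjective (A := 𝓞 M) β
  have hd0 : d ≠ 0 := nonZeroDivisors.ne_zero hd
  have hn0 : n ≠ 0 := by rintro rfl; simp at hβ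
  obtain ⟨g, r, hgr, hr⟩ := sqf_decomp (n * d) (mul_ne_zero hn0 hd0)
  have hr0 : r ≠ 0 := hr.ne_zero
  have hg0 : g ≠ 0 := by
    rintro rfl
    apply mul_ne_zero hn0 hd0; rw [hgr]; ring
  have cn : (n : M) ≠ 0 := by exact_mod_cast hn0
  have cd : (d : M) ≠ 0 := by exact_mod_cast hd0
  have cg : (g : M) ≠ 0 := by exact_mod_cast hg0
  have cr : (r : M) ≠ 0 := by exact_mod_cast hr0
  have hc : (n : M) * d = g ^ 2 * r := by exact_mod_cast congrArg (algebraMap (𝓞 M) M) hgr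
  have hβ' : (n : M) / d = r * (g / d) ^ 2 := by
    field_simp; linear_combination hc
  have hpr : ∀ π : 𝓞 M, Prime π → π ∣ r → Associated π (2 * om p + 1) := by
    intro π hπ hdvd
    have hI : (Ideal.span {π}).IsPrime := (Ideal.span_singleton_prime hπ.ne_zero).2 hπ
    let w : HeightOneSpectrum (𝓞 M) := ⟨Ideal.span {π}, hI, by simpa using hπ.ne_zero⟩
    by_cases h3 : (3 : 𝓞 M) ∈ w.asIdeal
    · have := prime_three h h6 (Ideal.span {π}) (by simpa using hπ.ne_zero) h3
      exact Ideal.span_singleton_eq_span_singleton.1 this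
    · exfalso
      have he := heven w h3
      change Even ((ordv w).v ((n : M) / d)) at he
      rw [hβ', (ordv w).mul' _ _ cr (pow_ne_zero 2 (div_ne_zero cg cd)), DV.pow _ (div_ne_zero cg cd)] at he
      have h1 := ordv_pos w r (Ideal.mem_span_singleton.2 hdvd) hr0
      have h2 : ¬ (2 : ℤ) ≤ (ordv w).v (r : M) := by
        intro hle
        have := ge_mem w r 2 (Or.inr hle)
        rw [show w.asIdeal = Ideal.span {π} from rfl, Ideal.span_singleton_pow,
          Ideal.mem_span_singleton, pow_two] at this
        exact hπ.not_isUnit (hr π this)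
      have h3 : (ordv w).v (r : M) = 1 := by omega
      rw [h3] at he
      obtain ⟨k, hk⟩ := he
      push_cast at hk
      omega
  have hs := three_prime h h6
  have ss : ((2 * om p + 1 : 𝓞 M) : M) = 2 * om (p : M) + 1 := by
    simp [om, map_ofNat]
  by_cases hsr : 2 * om p + 1 ∣ r
  · obtain ⟨r', rfl⟩ := hsr
    have hu : IsUnit r' := by
      by_contra hnu
      obtain ⟨π, hπ, hd⟩ := WfDvdMonoid.exists_irreducible_factor hnu (right_ne_zero_of_mul hr0)
      have ha := hpr π hπ.prime (hd.mul_left _)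
      have : (2 * om p + 1) * (2 * om p + 1) ∣ (2 * om p + 1) * r' :=
        mul_dvd_mul_left _ (ha.dvd_iff_dvd_left.1 hd)
      exact hs.not_isUnit (hr _ this)
    obtain ⟨u, rfl⟩ := hu
    refine ⟨u, 1, g / d, by norm_num, ?_⟩
    change (n : M) / d = _
    rw [hβ', ← ss]; push_cast; ring
  · have hu : IsUnit r := by
      by_contra hnu
      obtain ⟨π, hπ, hd⟩ := WfDvdMonoid.exists_irreducible_factor hnu hr0
      have ha := hpr π hπ.prime hd
      exact hsr (ha.dvd_iff_dvd_left.1 hd)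
    obtain ⟨u, rfl⟩ := hu
    refine ⟨u, 0, g / d, by norm_num, ?_⟩
    change (n : M) / d = _
    rw [hβ']; ring

def DV.u1 {K : Type*} [Field K] (V : DV K) (z : K) : Prop := V.ge 2 (z - 1)

lemma DV.u1.ne {K : Type*} [Field K] {V : DV K} {z : K} (h : V.u1 z) : z ≠ 0 ∧ V.v z = 0 := by
  have := DV.add_eq (V := V) (x := 1) (y := z - 1) one_ne_zero
    (DV.ge_mono (by rw [V.one]; norm_num) h)
  rwa [add_sub_cancel, V.one] at this

lemma DV.u1.int {K : Type*} [Field K] {V : DV K} {z : K} (h : V.u1 z) : V.ge 0 z :=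
  Or.inr h.ne.2.ge

lemma DV.u1.mul {K : Type*} [Field K] {V : DV K} {z w : K} (h : V.u1 z) (hw : V.u1 w) :
    V.u1 (z * w) := by
  unfold DV.u1
  rw [show z * w - 1 = z * (w - 1) + (z - 1) by ring]
  exact DV.ge_add (DV.ge_mul0 h.int hw) h

lemma DV.u1.inv {K : Type*} [Field K] {V : DV K} {z : K} (h : V.u1 z) : V.u1 z⁻¹ := by
  obtain ⟨h0, h1⟩ := h.ne
  unfold DV.u1
  rw [show z⁻¹ - 1 = -(z⁻¹ * (z - 1)) by field_simp; ring]
  exact DV.ge_neg (DV.ge_mul0 (Or.inr (by rw [V.inv h0, h1]; rfl)) h)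

lemma DV.u1_one {K : Type*} [Field K] {V : DV K} : V.u1 1 := Or.inl (by ring)

lemma DV.u1.pow {K : Type*} [Field K] {V : DV K} {z : K} (h : V.u1 z) (n : ℕ) : V.u1 (z ^ n) := by
  induction n with
  | zero => simpa using DV.u1_one
  | succ n ih => rw [pow_succ]; exact ih.mul h

theorem M_main (h : m6 p = 0) (hgen : IntermediateField.adjoin ℚ {(p : M)} = ⊤)
    (β : M) (hβ : β ≠ 0)
    (heven : ∀ w : HeightOneSpectrum (𝓞 M), (3 : 𝓞 M) ∉ w.asIdeal → Even ((ordv w).v β))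
    (Q : HeightOneSpectrum (𝓞 M)) (hQ : (2 : 𝓞 M) ∈ Q.asIdeal) (m : ℤ)
    (hm : (ordv Q).u1 ((4 : M) ^ m * β)) :
    ∃ (z : M) (n a : ℕ) (γ : M), 0 < n ∧ z ^ n = 1 ∧ a < 2 ∧
      β = z * (2 * om (p : M) + 1) ^ a * γ ^ 2 := by
  have h6 := (exists_basis h hgen).1
  have := isPID h hgen
  obtain ⟨ε, a, γ, ha, hε⟩ := even_decomp h hgen β hβ heven
  have hQq : Q.asIdeal = Ideal.span {qq p} := by
    have := Q.isPrime
    exact prime_two h h6 Q.asIdeal Q.ne_bot hQ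
  set V := ordv Q with hV
  have hγ : γ ≠ 0 := by
    rintro rfl; apply hβ; rw [hε]; ring
  have hε0 : ((ε : 𝓞 M) : M) ≠ 0 := by
    have : (ε : 𝓞 M) ≠ 0 := ε.ne_zero
    exact_mod_cast this
  have h3 : ((3 : 𝓞 M) : M) = 3 := by simp [map_ofNat]
  have v3 : V.v (3 : M) = 0 := by
    rw [← h3]; exact ordv_eq_zero Q 3 (two_not_mem_three Q hQ)
  set s := 2 * om (p : M) + 1 with hs
  have hs2 : s ^ 2 = -3 := s3_eq (m6_coe h)
  have hs0 : s ≠ 0 := by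
    intro h0; rw [h0] at hs2; norm_num at hs2
  have vs : V.v s = 0 := by
    have h1 := V.pow hs0 2
    rw [hs2, DV.neg, v3] at h1
    push_cast at h1; omega
  have vε : V.v ((ε : 𝓞 M) : M) = 0 := by
    apply ordv_eq_zero Q
    rw [hQq, Ideal.mem_span_singleton]
    exact unit_not_dvd h h6 ε
  set γ' := (2 : M) ^ m * γ with hγ'
  have hγ0 : γ' ≠ 0 := mul_ne_zero (zpow_ne_zero _ two_ne_zero) hγ
  have hz : (4 : M) ^ m * β = ((ε : 𝓞 M) : M) * s ^ a * γ' ^ 2 := by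
    rw [hε, hγ', mul_pow, ← zpow_natCast ((2:M)^m) 2, ← zpow_mul, mul_comm m, zpow_mul]
    norm_num; ring
  have vγ : V.v γ' = 0 := by
    have := hm.ne.2
    rw [hz, V.mul' _ _ (mul_ne_zero hε0 (pow_ne_zero _ hs0)) (pow_ne_zero _ hγ0),
      V.mul' _ _ hε0 (pow_ne_zero _ hs0), V.pow hs0, V.pow hγ0, vs, vε] at this
    push_cast at this; omega
  have dv2 : ∀ x : 𝓞 M, qq p ^ 2 ∣ x → V.ge 2 (x : M) := by
    rintro x ⟨y, rfl⟩
    have hq : V.ge 1 ((qq p : 𝓞 M) : M) := Or.inr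
      (ordv_pos Q (qq p) (by rw [hQq]; exact Ideal.mem_span_singleton_self _) (q_ne h))
    have := DV.ge_mul (DV.ge_mul hq hq) (ordv_nonneg Q y)
    rw [show ((qq p ^ 2 * y : 𝓞 M) : M) = (qq p : 𝓞 M) * (qq p : 𝓞 M) * (y : M) by push_cast; ring]
    simpa using this
  have sixth : ∀ x : 𝓞 M, ¬ qq p ∣ x → V.u1 ((x : M) ^ 6) := by
    intro x hx
    obtain ⟨c, hc⟩ := cube_one h h6 hx
    have := hc.sq h
    have := dv2 _ this
    unfold DV.u1
    rw [show (x : M) ^ 6 - 1 = (((x^2)^3 - 1 - qq p * 0 : 𝓞 M) : M) by push_cast; ring]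
    exact this
  have u6 : V.u1 (γ' ^ 6) := by
    let nn := IsFractionRing.num (𝓞 M) γ'
    let dd : 𝓞 M := IsFractionRing.den (𝓞 M) γ'
    have hnd : γ' = (nn : M) / (dd : M) := (IsFractionRing.mk'_num_den' (𝓞 M) γ').symm
    have hrel : IsRelPrime nn dd := IsFractionRing.num_den_reduced (𝓞 M) γ'
    have hd0 : dd ≠ 0 := nonZeroDivisors.ne_zero (IsFractionRing.den (𝓞 M) γ').2
    have cd : (dd : M) ≠ 0 := by exact_mod_cast hd0
    have cn : (nn : M) ≠ 0 := by
      intro h0; rw [h0] at hnd; simp at hnd; exact hγ0 hnd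
    have hn0 : nn ≠ 0 := by rintro h0; rw [h0] at cn; simp at cn
    have hv : V.v (nn : M) = V.v (dd : M) := by
      have := vγ; rw [hnd, V.div cn cd] at this; omega
    have iff1 : ∀ x : 𝓞 M, x ≠ 0 → (qq p ∣ x ↔ 0 < V.v (x : M)) := by
      intro x hx
      constructor
      · intro hd; exact ordv_pos Q x (by rw [hQq]; exact Ideal.mem_span_singleton.2 hd) hx
      · intro hv
        by_contra hnd
        have := ordv_eq_zero Q x (by rw [hQq]; exact fun hm => hnd (Ideal.mem_span_singleton.1 hm))
        change V.v _ = 0 at this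
        omega
    have hdd : ¬ qq p ∣ dd := by
      intro hd
      have hn : qq p ∣ nn := by rw [iff1 _ hn0, hv, ← iff1 _ hd0]; exact hd
      exact (qq_prime h h6).not_isUnit (hrel hn hd)
    have hnn : ¬ qq p ∣ nn := by
      rw [iff1 _ hn0, hv, ← iff1 _ hd0]; exact hdd
    rw [hnd, div_pow, div_eq_mul_inv]
    exact (sixth _ hnn).mul (sixth _ hdd).inv
  have us : V.u1 (s ^ 3) := by
    unfold DV.u1
    rw [show s ^ 3 - 1 = 2 * (-2 - 3 * ((om p : 𝓞 M) : M)) by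
      have : ((om p : 𝓞 M) : M) = om (p : M) := by simp [om, map_ofNat]
      rw [this, pow_succ, hs2, hs]; ring]
    have : V.ge 2 (2 : M) := by
      have := dv2 2 (by rw [two_eq h]; exact (pow_dvd_pow _ (by norm_num)).mul_right _)
      simpa [map_ofNat] using this
    rw [mul_comm]
    refine DV.ge_mul0 (DV.ge_sub (DV.ge_neg (DV.ge_ofNat 2)) (DV.ge_mul0 (DV.ge_ofNat 3) ?_)) this
    exact ordv_nonneg Q _
  have uε : V.u1 (((ε : 𝓞 M) : M) ^ 3) := by
    have := ((hm.pow 3).mul (us.pow a).inv).mul u6.inv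
    rw [hz] at this
    convert this using 1
    rw [← pow_mul, mul_comm 3 a, pow_mul]
    field_simp
  have hdv : qq p ^ 2 ∣ (ε : 𝓞 M) ^ 3 - 1 := by
    have := ge_mem Q ((ε : 𝓞 M) ^ 3 - 1) 2 (by push_cast; exact uε)
    rwa [hQq, Ideal.span_singleton_pow, Ideal.mem_span_singleton] at this
  obtain ⟨z, η, hz1, hz2⟩ := unit_main h h6 ε hdv
  refine ⟨((z : 𝓞 M) : M), orderOf z, a, ((η : 𝓞 M) : M) * γ, hz1.orderOf_pos, ?_, ha, ?_⟩
  · have h1 : z ^ orderOf z = 1 := pow_orderOf_eq_one z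
    have h1' : (z : 𝓞 M) ^ orderOf z = 1 := by
      rw [← Units.val_pow_eq_pow_val, h1, Units.val_one]
    exact_mod_cast congrArg (algebraMap (𝓞 M) M) h1'
  · rw [hε, hz2]; push_cast; ring

end mmain
end Q14

namespace Q14
open IsDedekindDomain NumberField

namespace DV
variable {K : Type*} [Field K] [CharZero K] {V : DV K}

lemma v_odd (h2 : 0 < V.v 2) (m : ℤ) (hm : Odd m) : V.v (m : K) = 0 := by
  have h0 : (m : K) ≠ 0 := by
    have : m ≠ 0 := by rintro rfl; simp at hm
    exact_mod_cast this
  have h1 := v_of_ge (ge_int (V := V) m) h0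
  by_contra hne
  obtain ⟨j, rfl⟩ := hm
  have h3 : V.ge 1 (((2 * j + 1 : ℤ) : K) - j * 2) :=
    ge_sub (Or.inr (by omega)) (ge_mul0 (ge_int j) (Or.inr (by omega)))
  have h4 : (((2 * j + 1 : ℤ) : K) - j * 2) = 1 := by push_cast; ring
  rw [h4] at h3
  exact not_ge one_ne_zero (by rw [V.one]; norm_num) h3

lemma root_val (h2 : 0 < V.v 2) (x : K) (hx : 4 * x ^ 3 + 4 * x ^ 2 - 456 * x + 1893 = 0) :
    3 * V.v x = -2 * V.v 2 := by
  have h0 : x ≠ 0 := by rintro rfl; norm_num at hx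
  have h20 : (2 : K) ≠ 0 := by norm_num
  have e4 : V.v 4 = 2 * V.v 2 := by
    rw [show (4 : K) = 2 ^ 2 by norm_num, V.pow h20]; norm_cast
  have e1 : V.v (4 * x ^ 3) = 2 * V.v 2 + 3 * V.v x := by
    rw [V.mul' _ _ (by norm_num) (pow_ne_zero _ h0), V.pow h0, e4]; norm_cast
  have e2 : V.v (4 * x ^ 2) = 2 * V.v 2 + 2 * V.v x := by
    rw [V.mul' _ _ (by norm_num) (pow_ne_zero _ h0), V.pow h0, e4]; norm_cast
  have e3 : V.ge (3 * V.v 2 + V.v x) (456 * x) := by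
    have : (456 : K) * x = 57 * (2 ^ 3 * x) := by ring
    rw [this]
    refine ge_mul0 (ge_ofNat 57) (Or.inr ?_)
    rw [V.mul' _ _ (by positivity) h0, V.pow h20]; norm_cast
  have e5 : V.v 1893 = 0 := by
    have := v_odd h2 1893 (by decide)
    simpa using this
  rcases lt_trichotomy (3 * V.v x) (-2 * V.v 2) with h | h | h
  · exfalso
    have : V.ge (2 * V.v 2 + 3 * V.v x + 1) (4 * x ^ 3) := by
      have hh : 4 * x ^ 3 = 456 * x - 4 * x ^ 2 - 1893 := by linear_combination hx
      rw [hh]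
      exact ge_sub (ge_sub (ge_mono (by omega) e3) (Or.inr (by omega))) (Or.inr (by omega))
    exact not_ge (mul_ne_zero (by norm_num) (pow_ne_zero _ h0)) (by omega) this
  · exact h
  · exfalso
    have : V.ge 1 (1893 : K) := by
      have hh : (1893 : K) = 456 * x - 4 * x ^ 2 - 4 * x ^ 3 := by linear_combination hx
      rw [hh]
      exact ge_sub (ge_sub (ge_mono (by omega) e3) (Or.inr (by omega))) (Or.inr (by omega))
    exact not_ge (by norm_num) (by omega) this

lemma cub_int (x : K) (hx : x ^ 3 - 2 * x ^ 2 - x + 1 = 0) : V.ge 0 x := by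
  by_contra h
  have h0 : x ≠ 0 := by rintro rfl; norm_num at hx
  have h1 : V.v x < 0 := by
    by_contra h2; exact h (Or.inr (by omega))
  have e1 : V.v (x ^ 3) = 3 * V.v x := by rw [V.pow h0]; norm_cast
  have e2 : V.v (x ^ 2) = 2 * V.v x := by rw [V.pow h0]; norm_cast
  have hh : x ^ 3 = 2 * x ^ 2 + x - 1 := by linear_combination hx
  have : V.ge (2 * V.v x) (x ^ 3) := by
    rw [hh]
    exact ge_sub (ge_add (ge_mul0 (ge_ofNat 2) (Or.inr (by omega))) (Or.inr (by omega)))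
      (ge_mono (by omega) ge_one)
  exact not_ge (by positivity) (by omega) this

end DV

/-- the cyclic cubic field of conductor 7 -/
structure CF (F : Type) [Field F] [CharZero F] where
  e : F
  he : e ^ 3 - 2 * e ^ 2 - e + 1 = 0
  rep : ∀ x : F, ∃ a b c : ℚ, x = a + b * e + c * e ^ 2
  s : F →+* F
  hs : s e = 2 + e - e ^ 2

namespace CF
variable {F : Type} [Field F] [CharZero F]

/-- the norm form -/
def nm {R : Type*} [CommRing R] (a b c : R) : R :=
  a*b*c - a*b^2 + 5*a*c^2 + 2*a^2*b + 6*a^2*c + a^3 + b*c^2 - 2*b^2*c - b^3 + c^3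

lemma nm_eq {R : Type*} [CommRing R] (e : R) (he : e ^ 3 - 2 * e ^ 2 - e + 1 = 0) (a b c : R) :
    (a + b * e + c * e ^ 2) * ((2*a*b+6*a*c+a^2-b*c-b^2+3*c^2) + (-a*b-4*b*c-2*b^2+c^2) * e
      + (-a*c+2*b*c+b^2-c^2) * e ^ 2) = nm a b c := by
  unfold nm
  grind

lemma nm_odd (a b c : ℤ) (h : ¬ (2 ∣ a ∧ 2 ∣ b ∧ 2 ∣ c)) : Odd (nm a b c) := by
  unfold nm
  by_cases ha : Even a <;> by_cases hb : Even b <;> by_cases hc : Even c <;>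
    simp_all [Int.even_add, Int.even_sub, Int.even_mul, ← Int.not_even_iff_odd, Int.even_pow,
      ← even_iff_two_dvd, parity_simps,
      show Even (6 : ℤ) by decide, show ¬ Even (5 : ℤ) by decide]

lemma exists_odd_rep (C : CF F) (x : F) (hx : x ≠ 0) : ∃ (k D a b c : ℤ), Odd D ∧ Odd (nm a b c) ∧
    x = 2 ^ k / D * (a + b * C.e + c * C.e ^ 2) := by
  obtain ⟨a, b, c, h⟩ := C.rep x
  have h1 : ∃ (n : ℕ) (k D a b c : ℤ), Odd D ∧ n = a.natAbs + b.natAbs + c.natAbs ∧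
    x = 2 ^ k / D * (a + b * C.e + c * C.e ^ 2) := by
    have hd : (a.den * b.den * c.den : ℕ) ≠ 0 := by positivity
    obtain ⟨j, m, hm, hj⟩ := Nat.exists_eq_two_pow_mul_odd hd
    refine ⟨_, -j, m, a.num * b.den * c.den, b.num * a.den * c.den, c.num * a.den * b.den,
      by exact_mod_cast hm, rfl, ?_⟩
    have hm0 : (m : F) ≠ 0 := by
      have : m ≠ 0 := by rintro rfl; simp at hm
      exact_mod_cast this
    have hj' : (a.den * b.den * c.den : F) = 2 ^ j * m := by exact_mod_cast hj
    have da : (a.den : F) ≠ 0 := by exact_mod_cast a.den_nz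
    have db : (b.den : F) ≠ 0 := by exact_mod_cast b.den_nz
    have dc : (c.den : F) ≠ 0 := by exact_mod_cast c.den_nz
    have ea : (a : F) * a.den = a.num := by exact_mod_cast Rat.mul_den_eq_num a
    have eb : (b : F) * b.den = b.num := by exact_mod_cast Rat.mul_den_eq_num b
    have ec : (c : F) * c.den = c.num := by exact_mod_cast Rat.mul_den_eq_num c
    have : (2 : F) ^ (-(j : ℤ)) / (m : ℤ) = 1 / (a.den * b.den * c.den : F) := by
      rw [hj', zpow_neg, zpow_natCast]; push_cast; field_simp
    rw [this, h]
    push_cast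
    rw [← ea, ← eb, ← ec]
    field_simp
  clear h a b c
  obtain ⟨n, h1⟩ := h1
  induction n using Nat.strong_induction_on with
  | _ n ih =>
    obtain ⟨k, D, a, b, c, hD, hn, hx'⟩ := h1
    by_cases h : 2 ∣ a ∧ 2 ∣ b ∧ 2 ∣ c
    · obtain ⟨⟨a, rfl⟩, ⟨b, rfl⟩, ⟨c, rfl⟩⟩ := h
      have h0 : ¬ (a = 0 ∧ b = 0 ∧ c = 0) := by
        rintro ⟨rfl, rfl, rfl⟩; simp at hx'; exact hx hx'
      refine ih (a.natAbs + b.natAbs + c.natAbs) (by omega) ⟨k + 1, D, a, b, c, hD, rfl, ?_⟩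
      rw [hx', zpow_add_one₀ (by norm_num)]; push_cast; ring
    · exact ⟨k, D, a, b, c, hD, nm_odd a b c h, hx'⟩

lemma val_aux (C : CF F) (x : F) (hx : x ≠ 0) : ∃ k : ℤ, ∀ (K : Type) [Field K] [CharZero K] (V : DV K)
    (ι : F →+* K), 0 < V.v 2 → V.v (ι x) = k * V.v 2 := by
  obtain ⟨k, D, a, b, c, hD, hn, h⟩ := C.exists_odd_rep x hx
  refine ⟨k, ?_⟩
  intro K _ _ V ι h2
  have he : ι C.e ^ 3 - 2 * ι C.e ^ 2 - ι C.e + 1 = 0 := by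
    have := congrArg ι C.he
    simpa [map_ofNat] using this
  have hie : V.ge 0 (ι C.e) := DV.cub_int _ he
  have key := nm_eq (ι C.e) he a b c
  have hint : ∀ a b c : ℤ, V.ge 0 ((a : K) + b * ι C.e + c * ι C.e ^ 2) := fun a b c =>
    DV.ge_add (DV.ge_add (DV.ge_int _) (DV.ge_mul0 (DV.ge_int _) hie))
      (DV.ge_mul0 (DV.ge_int _) (DV.ge_pow hie 2))
  have hnm : (nm (a : K) b c) = ((nm a b c : ℤ) : K) := by unfold nm; push_cast; ring
  rw [hnm] at key
  have hn0 : ((nm a b c : ℤ) : K) ≠ 0 := by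
    have : nm a b c ≠ 0 := by intro h; rw [h] at hn; simp at hn
    exact_mod_cast this
  have hU : ((a : K) + b * ι C.e + c * ι C.e ^ 2) ≠ 0 := by
    intro h; rw [h, zero_mul] at key; exact hn0 key.symm
  have hA := right_ne_zero_of_mul (key ▸ hn0)
  have h1 := V.mul' _ _ hU hA
  rw [key, DV.v_odd h2 _ hn] at h1
  have h3 := DV.v_of_ge (hint a b c) hU
  have h4 : 0 ≤ V.v ((2*a*b+6*a*c+a^2-b*c-b^2+3*c^2 : K) + (-a*b-4*b*c-2*b^2+c^2) * ι C.e
      + (-a*c+2*b*c+b^2-c^2) * ι C.e ^ 2) := by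
    refine DV.v_of_ge ?_ hA
    have := hint (2*a*b+6*a*c+a^2-b*c-b^2+3*c^2) (-a*b-4*b*c-2*b^2+c^2) (-a*c+2*b*c+b^2-c^2)
    push_cast at this
    exact this
  have hD0 : (D : K) ≠ 0 := by
    have : D ≠ 0 := by rintro rfl; simp at hD
    exact_mod_cast this
  rw [h]
  simp only [map_mul, map_div₀, map_add, map_pow, map_zpow₀, map_intCast, map_ofNat]
  rw [V.mul' _ _ (div_ne_zero (zpow_ne_zero _ (by norm_num)) hD0) hU,
    V.div (zpow_ne_zero _ (by norm_num)) hD0, V.zpow (by norm_num), DV.v_odd h2 D hD]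
  omega

lemma numberField (C : CF F) : NumberField F := by
  classical
  refine @NumberField.mk F _ _ ?_
  refine ⟨⟨{1, C.e, C.e ^ 2}, ?_⟩⟩
  rw [eq_top_iff]
  rintro x -
  obtain ⟨a, b, c, h⟩ := C.rep x
  have : x = a • (1 : F) + b • C.e + c • C.e ^ 2 := by
    simp only [Rat.smul_def, mul_one]; exact h
  rw [this]
  refine add_mem (add_mem ?_ ?_) ?_ <;> refine Submodule.smul_mem _ _ (Submodule.subset_span ?_)
  all_goals simp

lemma exists_prime (K : Type) [Field K] [NumberField K] : ∃ w : HeightOneSpectrum (𝓞 K),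
    (2 : 𝓞 K) ∈ w.asIdeal := by
  have h : ¬ IsUnit (2 : 𝓞 K) := by
    intro h
    have h1 := h.map (Algebra.norm ℤ)
    have h2 := Int.isUnit_iff_natAbs_eq.1 h1
    have h3 := natAbs_norm_nat (M := K) 2
    push_cast at h3
    rw [h2] at h3
    have : 0 < Module.finrank ℚ K := Module.finrank_pos
    exact absurd h3.symm (by simp; omega)
  obtain ⟨I, hI, h2⟩ := exists_max_ideal_of_mem_nonunits h
  refine ⟨⟨I, hI.isPrime, ?_⟩, h2⟩
  rintro rfl
  simp at h2

lemma exists_V (C : CF F) : ∃ V : DV F, V.v 2 = 1 ∧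
    (∀ (K : Type) [Field K] [CharZero K] (W : DV K) (ι : F →+* K), 0 < W.v 2 →
      ∀ x, x ≠ 0 → W.v (ι x) = V.v x * W.v 2) ∧
    (∀ x, V.ge 0 x → ∃ a b c : ℤ, (a = 0 ∨ a = 1) ∧ (b = 0 ∨ b = 1) ∧ (c = 0 ∨ c = 1) ∧
      V.ge 1 (x - (a + b * C.e + c * C.e ^ 2))) := by
  have := C.numberField
  obtain ⟨w, hw⟩ := exists_prime F
  have hpos : 0 < (ordv w).v 2 := ordv_pos w 2 hw (by norm_num)
  set W := ordv w
  have hdiv : ∀ x : F, x ≠ 0 → W.v x / W.v 2 * W.v 2 = W.v x := by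
    intro x hx
    obtain ⟨k, hk⟩ := C.val_aux x hx
    have := hk F W (RingHom.id F) hpos
    simp only [RingHom.id_apply] at this
    rw [this, Int.mul_ediv_cancel _ hpos.ne']
  let V : DV F := ⟨fun x => W.v x / W.v 2, fun x y hx hy => by
      have h1 := hdiv x hx
      have h2 := hdiv y hy
      have h3 := hdiv _ (mul_ne_zero hx hy)
      rw [W.mul' _ _ hx hy] at h3
      rw [W.mul' _ _ hx hy]
      refine mul_right_cancel₀ hpos.ne' ?_
      rw [h3, add_mul, h1, h2], fun x y hx hy hxy => by
      have h := W.add' x y hx hy hxy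
      rcases min_le_iff.1 h with h | h
      · exact (min_le_left _ _).trans (Int.ediv_le_ediv hpos h)
      · exact (min_le_right _ _).trans (Int.ediv_le_ediv hpos h)⟩
  have hV : ∀ x, V.v x = W.v x / W.v 2 := fun _ => rfl
  have hV2 : V.v 2 = 1 := by rw [hV, Int.ediv_self hpos.ne']
  have hall : ∀ (K : Type) [Field K] [CharZero K] (W : DV K) (ι : F →+* K), 0 < W.v 2 →
      ∀ x, x ≠ 0 → W.v (ι x) = V.v x * W.v 2 := by
    intro K _ _ W' ι hW' x hx
    obtain ⟨k, hk⟩ := C.val_aux x hx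
    have h1 := hk F V (RingHom.id F) (by omega)
    simp only [RingHom.id_apply] at h1
    rw [hk K W' ι hW', h1, hV2, mul_one]
  refine ⟨V, hV2, hall, ?_⟩
  intro x hx
  by_cases hx0 : x = 0
  · subst hx0
    exact ⟨0, 0, 0, by simp, by simp, by simp, Or.inl (by simp)⟩
  have hk0 := DV.v_of_ge hx hx0
  obtain ⟨k, D, a, b, c, hD, hn, h⟩ := C.exists_odd_rep x hx0
  have hie : V.ge 0 C.e := DV.cub_int _ C.he
  have hint : ∀ a b c : ℤ, V.ge 0 ((a : F) + b * C.e + c * C.e ^ 2) := fun a b c =>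
    DV.ge_add (DV.ge_add (DV.ge_int _) (DV.ge_mul0 (DV.ge_int _) hie))
      (DV.ge_mul0 (DV.ge_int _) (DV.ge_pow hie 2))
  have hD0 : (D : F) ≠ 0 := by
    have : D ≠ 0 := by rintro rfl; simp at hD
    exact_mod_cast this
  have hvD := DV.v_odd (V := V) (by omega) D hD
  have hDi : V.ge 0 ((D : F)⁻¹) := Or.inr (by rw [V.inv hD0, hvD]; rfl)
  -- reduce to numerators
  have main : ∀ A B G : ℤ, D * x = A + B * C.e + G * C.e ^ 2 →
      ∃ a b c : ℤ, (a = 0 ∨ a = 1) ∧ (b = 0 ∨ b = 1) ∧ (c = 0 ∨ c = 1) ∧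
      V.ge 1 (x - (a + b * C.e + c * C.e ^ 2)) := by
    intro A B G hA
    refine ⟨A % 2, B % 2, G % 2, by omega, by omega, by omega, ?_⟩
    obtain ⟨j, rfl⟩ := hD
    have hx1 : x = A + B * C.e + G * C.e ^ 2 - 2 * (j * x) := by
      rw [← hA]; push_cast; ring
    have e1 : (A : F) = 2 * (A / 2 : ℤ) + (A % 2 : ℤ) := by
      exact_mod_cast (Int.mul_ediv_add_emod A 2).symm
    have e2 : (B : F) = 2 * (B / 2 : ℤ) + (B % 2 : ℤ) := by
      exact_mod_cast (Int.mul_ediv_add_emod B 2).symm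
    have e3 : (G : F) = 2 * (G / 2 : ℤ) + (G % 2 : ℤ) := by
      exact_mod_cast (Int.mul_ediv_add_emod G 2).symm
    have : x - ((A % 2 : ℤ) + (B % 2 : ℤ) * C.e + (G % 2 : ℤ) * C.e ^ 2)
      = ((A / 2 : ℤ) + (B / 2 : ℤ) * C.e + (G / 2 : ℤ) * C.e ^ 2 - j * x) * 2 := by
      linear_combination hx1 + e1 + C.e * e2 + C.e ^ 2 * e3
    rw [this]
    exact DV.ge_mul0 (DV.ge_sub (hint _ _ _) (DV.ge_mul0 (DV.ge_int j) hx)) (Or.inr (by omega))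
  have hk : V.v x = k := by
    have hU : V.v ((a : F) + b * C.e + c * C.e ^ 2) = 0 := by
      have key := nm_eq C.e C.he (a : F) b c
      have hnm : (nm (a : F) b c) = ((nm a b c : ℤ) : F) := by unfold nm; push_cast; ring
      rw [hnm] at key
      have hn0 : ((nm a b c : ℤ) : F) ≠ 0 := by
        have : nm a b c ≠ 0 := by intro h; rw [h] at hn; simp at hn
        exact_mod_cast this
      have hU0 := left_ne_zero_of_mul (key ▸ hn0)
      have hA := right_ne_zero_of_mul (key ▸ hn0)
      have h1 := V.mul' _ _ hU0 hA
      rw [key, DV.v_odd (by omega) _ hn] at h1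
      have h3 := DV.v_of_ge (hint a b c) hU0
      have h4 := hint (2*a*b+6*a*c+a^2-b*c-b^2+3*c^2) (-a*b-4*b*c-2*b^2+c^2) (-a*c+2*b*c+b^2-c^2)
      push_cast at h4
      have h5 := DV.v_of_ge h4 hA
      omega
    have hU0 : (a : F) + b * C.e + c * C.e ^ 2 ≠ 0 := by
      intro h'; rw [h', mul_zero] at h; exact hx0 h
    rw [h, V.mul' _ _ (div_ne_zero (zpow_ne_zero _ (by norm_num)) hD0) hU0,
      V.div (zpow_ne_zero _ (by norm_num)) hD0, V.zpow (by norm_num), hvD, hU, hV2]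
    ring
  rw [hk] at hk0
  obtain ⟨m, rfl⟩ := Int.eq_ofNat_of_zero_le hk0
  refine main (2 ^ m * a) (2 ^ m * b) (2 ^ m * c) ?_
  rw [h, zpow_natCast]; push_cast; field_simp

lemma no_root (C : CF F) (x : F) : 4 * x ^ 3 + 4 * x ^ 2 - 456 * x + 1893 ≠ 0 := by
  intro h
  obtain ⟨V, h2, -⟩ := C.exists_V
  have := DV.root_val (V := V) (by omega) x h
  omega

lemma norm_rat (C : CF F) (x : F) : ∃ q : ℚ, x * C.s x * C.s (C.s x) = q := by
  obtain ⟨a, b, c, h⟩ := C.rep x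
  have he := C.he
  have h1 : C.s x = a + b * (2 + C.e - C.e ^ 2) + c * (2 + C.e - C.e ^ 2) ^ 2 := by
    rw [h]; simp [C.hs]
  have h2 : C.s (C.s x) = a + b * (C.e ^ 2 - 2 * C.e) + c * (C.e ^ 2 - 2 * C.e) ^ 2 := by
    rw [h1]; simp only [map_add, map_mul, map_sub, map_pow, C.hs, map_ratCast, map_ofNat]
    grind
  refine ⟨nm a b c, ?_⟩
  rw [h2, h1, h]
  unfold nm
  push_cast
  grind

lemma three_not_sq (C : CF F) (x : F) : x ^ 2 ≠ 3 := by
  intro h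
  obtain ⟨q, hq⟩ := C.norm_rat x
  have h1 : (C.s x) ^ 2 = 3 := by rw [← map_pow, h]; simp [map_ofNat]
  have h2 : (C.s (C.s x)) ^ 2 = 3 := by rw [← map_pow, h1]; simp [map_ofNat]
  have h3 : (q : F) ^ 2 = 27 := by
    rw [← hq, mul_pow, mul_pow, h, h1, h2]; norm_num
  have h4 : q ^ 2 = 27 := by exact_mod_cast h3
  have h5 : (q / 3) ^ 2 = 3 := by rw [div_pow, h4]; norm_num
  have h6 : IsSquare (3 : ℚ) := ⟨q / 3, by linarith⟩
  have : IsSquare (3 : ℕ) := by exact_mod_cast (Rat.isSquare_natCast_iff (n := 3)).1 (by exact_mod_cast h6)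
  obtain ⟨r, hr⟩ := this
  have : r < 2 := by nlinarith
  interval_cases r <;> omega

lemma nm_int (n : ℕ) : ∀ a b c : ℤ, a.natAbs + b.natAbs + c.natAbs = n → nm a b c = 0 →
    a = 0 ∧ b = 0 ∧ c = 0 := by
  induction n using Nat.strong_induction_on with
  | _ n ih =>
    intro a b c hn h
    by_cases h2 : 2 ∣ a ∧ 2 ∣ b ∧ 2 ∣ c
    · obtain ⟨⟨a, rfl⟩, ⟨b, rfl⟩, ⟨c, rfl⟩⟩ := h2
      by_cases h0 : a = 0 ∧ b = 0 ∧ c = 0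
      · simp [h0]
      · have := ih (a.natAbs + b.natAbs + c.natAbs) (by omega) a b c rfl (by
          unfold nm at h ⊢; linarith)
        exact absurd this h0
    · have := nm_odd a b c h2
      rw [h] at this; simp at this

lemma nm_rat (a b c : ℚ) (h : nm a b c = 0) : a = 0 ∧ b = 0 ∧ c = 0 := by
  have da : (a.den : ℚ) ≠ 0 := by exact_mod_cast a.den_nz
  have db : (b.den : ℚ) ≠ 0 := by exact_mod_cast b.den_nz
  have dc : (c.den : ℚ) ≠ 0 := by exact_mod_cast c.den_nz
  have ea : (a.num : ℚ) = a * a.den := (Rat.mul_den_eq_num a).symm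
  have eb : (b.num : ℚ) = b * b.den := (Rat.mul_den_eq_num b).symm
  have ec : (c.num : ℚ) = c * c.den := (Rat.mul_den_eq_num c).symm
  have := nm_int _ (a.num * b.den * c.den) (b.num * a.den * c.den) (c.num * a.den * b.den) rfl (by
    have : (nm (a.num * b.den * c.den) (b.num * a.den * c.den) (c.num * a.den * b.den) : ℚ) = 0 := by
      rw [ea, eb, ec]
      have : nm (a * a.den * b.den * c.den) (b * b.den * a.den * c.den) (c * c.den * a.den * b.den)
        = (a.den * b.den * c.den : ℚ) ^ 3 * nm a b c := by unfold nm; ring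
      rw [this, h, mul_zero]
    unfold nm at this ⊢
    exact_mod_cast this)
  simpa using this

lemma coords (C : CF F) {a b c a' b' c' : ℚ}
    (h : (a : F) + b * C.e + c * C.e ^ 2 = a' + b' * C.e + c' * C.e ^ 2) :
    a = a' ∧ b = b' ∧ c = c' := by
  have h1 := nm_eq C.e C.he ((a - a' : ℚ) : F) ((b - b' : ℚ) : F) ((c - c' : ℚ) : F)
  have h2 : ((a - a' : ℚ) : F) + ((b - b' : ℚ) : F) * C.e + ((c - c' : ℚ) : F) * C.e ^ 2 = 0 := by
    push_cast; linear_combination h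
  rw [h2, zero_mul] at h1
  have h3 := nm_rat (a - a') (b - b') (c - c') (by
    unfold nm at h1 ⊢
    exact_mod_cast h1.symm)
  exact ⟨by linarith [h3.1], by linarith [h3.2.1], by linarith [h3.2.2]⟩

end CF
end Q14

namespace Q14
open IsDedekindDomain NumberField
section
variable {K : Type*} [Field K]
def gg (t : K) : K := t ^ 2 - t + 1
def hh (t : K) : K := t ^ 6 + t ^ 5 - 6 * t ^ 4 - 3 * t ^ 3 + 14 * t ^ 2 - 7 * t + 1
def xi (e t : K) : K := (-14 - 21 * e + 14 * e ^ 2) * (t - e) / gg t + 7 * e - 5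
def cc (t : K) : K := t ^ 3 + t ^ 2 - 114 * t + 1893 / 4

lemma hh_eq (p : K) (hp : m6 p = 0) : hh (p ^ 2 + 1) = 0 := by
  unfold m6 at hp; unfold hh; grind

lemma gg_ne [CharZero K] (p : K) (hp : m6 p = 0) : gg (p ^ 2 + 1) ≠ 0 := by
  intro h
  unfold m6 at hp; unfold gg at h
  grind

variable {e e1 e2 t : K}

lemma xi_sum (he : e ^ 3 - 2 * e ^ 2 - e + 1 = 0) (h1 : e1 = 2 + e - e ^ 2)
  (h2 : e2 = e ^ 2 - 2 * e) (hg : gg t ≠ 0) : xi e t + xi e1 t + xi e2 t = -1 := by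
  unfold xi
  field_simp
  unfold gg
  subst h1 h2
  grind

lemma xi_pairs (he : e ^ 3 - 2 * e ^ 2 - e + 1 = 0) (h1 : e1 = 2 + e - e ^ 2)
  (h2 : e2 = e ^ 2 - 2 * e) (hg : gg t ≠ 0) : xi e t * xi e1 t + xi e1 t * xi e2 t + xi e2 t * xi e t = -114 := by
  unfold xi
  field_simp
  unfold gg
  subst h1 h2
  grind

lemma xi_prod [CharZero K] (he : e ^ 3 - 2 * e ^ 2 - e + 1 = 0) (h1 : e1 = 2 + e - e ^ 2)
  (h2 : e2 = e ^ 2 - 2 * e) (hg : gg t ≠ 0) : xi e t * xi e1 t * xi e2 t = -1893 / 4 + 2401 * hh t / (4 * gg t ^ 3):= by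
  unfold xi
  field_simp
  unfold gg hh
  subst h1 h2
  grind

/-- the element whose norm we take -/
def bet (a b c t : K) : K :=
  CF.nm (a - (14 - 14 * t) / gg t + 5) (b + 21 * t / gg t - 7) (c - (14 * t - 7) / gg t)

lemma xi_lin (he : e ^ 3 - 2 * e ^ 2 - e + 1 = 0) (hg : gg t ≠ 0) (a b c : K) :
    a + b * e + c * e ^ 2 - xi e t =
    (a - (14 - 14 * t) / gg t + 5) + (b + 21 * t / gg t - 7) * e + (c - (14 * t - 7) / gg t) * e ^ 2 := by
  unfold xi
  field_simp
  grind

lemma nm_prod {R : Type*} [CommRing R] {e e1 e2 : R} (he : e ^ 3 - 2 * e ^ 2 - e + 1 = 0)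
    (h1 : e1 = 2 + e - e ^ 2) (h2 : e2 = e ^ 2 - 2 * e) (a b c : R) :
    (a + b * e + c * e ^ 2) * (a + b * e1 + c * e1 ^ 2) * (a + b * e2 + c * e2 ^ 2)
      = CF.nm a b c := by
  subst h1 h2
  unfold CF.nm
  grind

lemma bet_eq (he : e ^ 3 - 2 * e ^ 2 - e + 1 = 0) (h1 : e1 = 2 + e - e ^ 2)
    (h2 : e2 = e ^ 2 - 2 * e) (hg : gg t ≠ 0) (a b c : K) :
    bet a b c t = (a + b * e + c * e ^ 2 - xi e t) * (a + b * e1 + c * e1 ^ 2 - xi e1 t)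
      * (a + b * e2 + c * e2 ^ 2 - xi e2 t) := by
  have he1 : e1 ^ 3 - 2 * e1 ^ 2 - e1 + 1 = 0 := by subst h1; grind
  have he2 : e2 ^ 3 - 2 * e2 ^ 2 - e2 + 1 = 0 := by subst h2; grind
  rw [xi_lin he hg, xi_lin he1 hg, xi_lin he2 hg, nm_prod he h1 h2]
  rfl
end

section
variable {K : Type*} [Field K] [CharZero K] {W : DV K}
lemma ge_one_mul {N : ℤ} (hN : 0 ≤ N) {x y : K} (hx : W.ge N (x - 1)) (hy : W.ge N (y - 1)) :
    W.ge N (x * y - 1) := by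
  rw [show x * y - 1 = (x - 1) * (y - 1) + (x - 1) + (y - 1) by ring]
  exact DV.ge_add (DV.ge_add (DV.ge_mono (by omega) (DV.ge_mul hx hy)) hx) hy

lemma rat_unit (h2 : 0 < W.v 2) (q : ℚ) (h0 : (q : K) ≠ 0) (hq : W.v (q : K) = 0) :
    W.ge (W.v 2) ((q : K) - 1) := by
  have hd : (q.den : K) ≠ 0 := by exact_mod_cast q.den_nz
  have e1 : (q : K) * q.den = q.num := by exact_mod_cast Rat.mul_den_eq_num q
  have hn : (q.num : K) ≠ 0 := by rw [← e1]; exact mul_ne_zero h0 hd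
  have e2 := W.mul' _ _ h0 hd
  rw [e1, hq] at e2
  have hcop := q.reduced
  have hdi : ((q.den : ℤ) : K) = q.den := by simp
  have even_pos : ∀ m : ℤ, (m : K) ≠ 0 → Even m → W.v 2 ≤ W.v (m : K) := by
    intro m hm hm2
    obtain ⟨j, rfl⟩ := hm2
    refine DV.v_of_ge ?_ hm
    rw [show ((j + j : ℤ) : K) = j * 2 by push_cast; ring]
    exact DV.ge_mul0 (DV.ge_int _) (Or.inr le_rfl)
  have hdodd : Odd (q.den : ℤ) := by
    by_contra hcon
    rw [Int.not_odd_iff_even] at hcon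
    have h3 := even_pos _ (by rwa [hdi]) hcon
    rw [hdi] at h3
    have h4 : Odd q.num := by
      by_contra h5
      rw [Int.not_odd_iff_even] at h5
      have a1 : 2 ∣ q.num.natAbs := Int.natCast_dvd.1 (by exact_mod_cast h5.two_dvd)
      have a2 : 2 ∣ q.den := by exact_mod_cast hcon.two_dvd
      have := Nat.dvd_gcd a1 a2
      rw [hcop] at this; omega
    have := DV.v_odd h2 _ h4
    omega
  have h3 := DV.v_odd h2 _ hdodd
  have hnodd : Odd q.num := by
    by_contra hcon
    rw [Int.not_odd_iff_even] at hcon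
    have h5 := even_pos _ hn hcon
    rw [hdi] at h3
    omega
  have h6 : Even (q.num - q.den) := hnodd.sub_odd hdodd
  obtain ⟨j, hj⟩ := h6
  have h7 : (q : K) - 1 = ((q.den : K)⁻¹ * j) * 2 := by
    have : (q.num : K) - q.den = j + j := by exact_mod_cast congrArg (Int.cast : ℤ → K) hj
    field_simp
    linear_combination e1 + this
  rw [h7]
  refine DV.ge_mul0 (DV.ge_mul0 (Or.inr ?_) (DV.ge_int _)) (Or.inr le_rfl)
  rw [W.inv hd]; rw [hdi] at h3; omega
end

end Q14

namespace Q14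
open IsDedekindDomain NumberField

lemma cc_root {K : Type*} [Field K] {r0 r1 r2 : K} (h1 : r0 + r1 + r2 = -1)
    (h2 : r0 * r1 + r1 * r2 + r2 * r0 = -114) (h3 : r0 * r1 * r2 = -1893 / 4) (T : K) :
    cc T = (T - r0) * (T - r1) * (T - r2) := by
  unfold cc
  linear_combination T ^ 2 * h1 - T * h2 + h3

lemma cc_root4 {K : Type*} [Field K] [CharZero K] {r : K} (h : cc r = 0) :
    4 * r ^ 3 + 4 * r ^ 2 - 456 * r + 1893 = 0 := by
  unfold cc at h
  linear_combination 4 * h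

lemma CF.cc_ne {F : Type} [Field F] [CharZero F] (C : CF F) (X : F) : cc X ≠ 0 :=
  fun h => C.no_root X (cc_root4 h)

lemma two_adic {F : Type} [Field F] [CharZero F] (C : CF F) {K : Type} [Field K] [CharZero K]
    (W : DV K) (hW : 0 < W.v 2) (ι : F →+* K) (X Y : F) (hXY : Y ^ 2 = cc X) (r0 r1 r2 : K)
    (h1 : r0 + r1 + r2 = -1) (h2 : r0 * r1 + r1 * r2 + r2 * r0 = -114)
    (h3 : r0 * r1 * r2 = -1893 / 4) :
    ∃ m : ℤ, ∀ N : ℤ, 0 ≤ N → 3 * N ≤ 2 * W.v 2 → W.ge N ((4 : K) ^ m *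
      ((ι X - r0) * (ι (C.s X) - r1) * (ι (C.s (C.s X)) - r2)) - 1) := by
  obtain ⟨V, hV2, hV, -⟩ := C.exists_V
  have hr := cc_root h1 h2 h3
  have n0 : cc r0 = 0 := by rw [hr]; ring
  have n1 : cc r1 = 0 := by rw [hr]; ring
  have n2 : cc r2 = 0 := by rw [hr]; ring
  have v0 := DV.root_val hW r0 (cc_root4 n0)
  have v1 := DV.root_val hW r1 (cc_root4 n1)
  have v2 := DV.root_val hW r2 (cc_root4 n2)
  have hne : ∀ r : K, cc r = 0 → r ≠ 0 := by
    rintro r h rfl; unfold cc at h; norm_num at h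
  have z0 := hne r0 n0
  have z1 := hne r1 n1
  have z2 := hne r2 n2
  by_cases hint : V.ge 0 X
  · refine ⟨1, ?_⟩
    intro N hN0 hN
    have key : ∀ (Z : F) (r : K), r ≠ 0 → 3 * W.v r = -2 * W.v 2 → V.ge 0 Z →
        W.ge N ((1 - ι Z / r) - 1) := by
      intro Z r hr0 hr1 hZ
      rw [show (1 - ι Z / r) - 1 = - (ι Z / r) by ring]
      apply DV.ge_neg
      rcases hZ with hZ | hZ
      · left; simp [hZ]
      · by_cases hZ0 : Z = 0
        · left; simp [hZ0]
        right
        have := hV K W ι hW Z hZ0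
        rw [W.div (by simpa using hZ0) hr0, this]
        have : 0 ≤ V.v Z * W.v 2 := mul_nonneg hZ hW.le
        omega
    have hs : ∀ Z, V.ge 0 Z → V.ge 0 (C.s Z) := by
      intro Z hZ
      by_cases hZ0 : Z = 0
      · left; simp [hZ0]
      right
      rw [hV F V C.s (by omega) Z hZ0, hV2, mul_one]
      exact DV.v_of_ge hZ hZ0
    have k0 := key X r0 z0 v0 hint
    have k1 := key _ r1 z1 v1 (hs _ hint)
    have k2 := key _ r2 z2 v2 (hs _ (hs _ hint))
    have k3 : W.ge N ((1893 : K) - 1) := by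
      rw [show (1893 : K) - 1 = 473 * (2 * 2) by norm_num]
      refine DV.ge_mul0 (DV.ge_ofNat 473) (Or.inr ?_)
      rw [W.mul' _ _ (by norm_num) (by norm_num)]; omega
    have := ge_one_mul hN0 k3 (ge_one_mul hN0 (ge_one_mul hN0 k0 k1) k2)
    convert this using 2
    rw [zpow_one]
    have : (1893 : K) = -4 * (r0 * r1 * r2) := by rw [h3]; ring
    rw [this]
    field_simp
    ring
  · have hX0 : X ≠ 0 := by rintro rfl; exact hint (Or.inl rfl)
    have hj : V.v X < 0 := by
      by_contra h; exact hint (Or.inr (by omega))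
    have hY0 : Y ≠ 0 := by
      rintro rfl; exact C.cc_ne X (by rw [← hXY]; ring)
    have heven : Even (V.v X) := by
      have e1 : V.v (X ^ 3) = 3 * V.v X := by rw [V.pow hX0]; norm_cast
      have e4 : V.v 4 = 2 := by
        rw [show (4 : F) = 2 ^ 2 by norm_num, V.pow (by norm_num), hV2]; norm_cast
      have e3 : V.v (1893 / 4 : F) = -2 := by
        have := DV.v_odd (V := V) (by omega) 1893 (by decide)
        rw [V.div (by norm_num) (by norm_num), e4]
        push_cast at this; omega
      have := DV.add_eq (V := V) (x := X ^ 3) (y := X ^ 2 - 114 * X + 1893 / 4) (pow_ne_zero _ hX0)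
        (DV.ge_add (DV.ge_sub (Or.inr (by rw [e1, V.pow hX0]; push_cast; omega))
          (DV.ge_mul0 (DV.ge_ofNat 114) (Or.inr (by omega)))) (Or.inr (by omega)))
      have h5 : X ^ 3 + (X ^ 2 - 114 * X + 1893 / 4) = Y ^ 2 := by rw [hXY]; unfold cc; ring
      rw [h5, V.pow hY0, e1] at this
      have h6 := this.2
      push_cast at h6
      rw [Int.even_iff]; omega
    obtain ⟨k, hk⟩ := heven
    refine ⟨-(3 * k), ?_⟩
    intro N hN0 hN
    have hs0 : C.s X ≠ 0 := by simpa using hX0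
    have hs1 : C.s (C.s X) ≠ 0 := by simpa using hX0
    have w1 : V.v (C.s X) = V.v X := by
      rw [hV F V C.s (by omega) X hX0, hV2, mul_one]
    have w2 : V.v (C.s (C.s X)) = V.v X := by
      rw [hV F V C.s (by omega) _ hs0, hV2, mul_one, w1]
    have key : ∀ (Z : F) (r : K), Z ≠ 0 → r ≠ 0 → 3 * W.v r = -2 * W.v 2 → V.v Z = V.v X →
        W.ge N ((1 - r / ι Z) - 1) := by
      intro Z r hZ0 hr0 hr1 hZ
      rw [show (1 - r / ι Z) - 1 = - (r / ι Z) by ring]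
      apply DV.ge_neg
      right
      rw [W.div hr0 (by simpa using hZ0), hV K W ι hW Z hZ0, hZ, hk]
      have : (k + k) * W.v 2 ≤ (-2) * W.v 2 := mul_le_mul_of_nonneg_right (by omega) hW.le
      omega
    have k0 := key X r0 hX0 z0 v0 rfl
    have k1 := key _ r1 hs0 z1 v1 w1
    have k2 := key _ r2 hs1 z2 v2 w2
    obtain ⟨q, hq⟩ := C.norm_rat X
    have hq' : ι X * ι (C.s X) * ι (C.s (C.s X)) = q := by
      rw [← map_mul, ← map_mul, hq]; simp
    have i0 : ι X ≠ 0 := by simpa using hX0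
    have i1 : ι (C.s X) ≠ 0 := by simpa using hX0
    have i2 : ι (C.s (C.s X)) ≠ 0 := by simpa using hX0
    have hq0 : (q : K) ≠ 0 := by
      rw [← hq']; exact mul_ne_zero (mul_ne_zero i0 i1) i2
    have hU : (((4 : ℚ) ^ (-(3 * k)) * q : ℚ) : K) = (4 : K) ^ (-(3 * k)) * q := by push_cast; rfl
    have k3 : W.ge N ((4 : K) ^ (-(3 * k)) * q - 1) := by
      refine DV.ge_mono (n := W.v 2) (by omega) ?_
      rw [← hU]
      have h40 : (4 : K) ^ (-(3 * k)) ≠ 0 := zpow_ne_zero _ (by norm_num)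
      refine rat_unit hW _ (by rw [hU]; exact mul_ne_zero h40 hq0) ?_
      rw [hU, W.mul' _ _ h40 hq0, ← hq', W.mul' _ _ (mul_ne_zero i0 i1) i2, W.mul' _ _ i0 i1,
        hV K W ι hW _ hX0, hV K W ι hW _ hs0, hV K W ι hW _ hs1, w1, w2, hk,
        show (4 : K) = 2 ^ 2 by norm_num, W.zpow (by norm_num), W.pow (by norm_num)]
      push_cast; ring
    have := ge_one_mul hN0 k3 (ge_one_mul hN0 (ge_one_mul hN0 k0 k1) k2)
    convert this using 2
    rw [← hq']
    field_simp

theorem beta_decomp {F : Type} [Field F] [CharZero F] (C : CF F) {M Ω : Type} [Field M]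
    [NumberField M] [Field Ω] [NumberField Ω] [Algebra M Ω] (hodd : Odd (Module.finrank M Ω))
    (ι : F →+* Ω) (p : 𝓞 M) (hp : m6 p = 0)
    (hgen : IntermediateField.adjoin ℚ {(p : M)} = ⊤) (X Y : F) (hXY : Y ^ 2 = cc X)
    (a b c : ℚ) (hX : X = a + b * C.e + c * C.e ^ 2) :
    ∃ (z : M) (n a' : ℕ) (γ : M), 0 < n ∧ z ^ n = 1 ∧ a' < 2 ∧
      bet (a : M) b c ((p : M) ^ 2 + 1) = z * (2 * om (p : M) + 1) ^ a' * γ ^ 2 := by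
  obtain ⟨q, hq⟩ : ∃ q : M, q = (p : M) := ⟨_, rfl⟩
  have hpM : m6 q = 0 := by
    have := congrArg (algebraMap (𝓞 M) M) hp
    rw [← m6_map] at this
    rw [hq]; simpa using this
  set t : M := (p : M) ^ 2 + 1 with ht
  have hg : gg t ≠ 0 := by rw [ht, ← hq]; exact gg_ne q hpM
  have hh0 : hh t = 0 := by rw [ht, ← hq]; exact hh_eq q hpM
  set f := algebraMap M Ω with hf
  have hg' : gg (f t) = f (gg t) := by unfold gg; simp
  have hgΩ : gg (f t) ≠ 0 := by rw [hg']; simpa using hg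
  have hhΩ : hh (f t) = 0 := by
    have : hh (f t) = f (hh t) := by unfold hh; simp [map_ofNat]
    rw [this, hh0, map_zero]
  set e := ι C.e with he
  have hee : e ^ 3 - 2 * e ^ 2 - e + 1 = 0 := by
    have := congrArg ι C.he
    simpa [map_ofNat] using this
  have s1 := xi_sum hee rfl rfl hgΩ
  have s2 := xi_pairs hee rfl rfl hgΩ
  have s3 := xi_prod hee rfl rfl hgΩ
  rw [hhΩ, mul_zero, zero_div, add_zero] at s3
  have hb := bet_eq hee rfl rfl hgΩ (a : Ω) b c
  have hbf : f (bet (a : M) b c t) = bet (a : Ω) b c (f t) := by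
    unfold bet CF.nm
    simp [map_ofNat, hg']
  set r0 := xi e (f t)
  set r1 := xi (2 + e - e ^ 2) (f t)
  set r2 := xi (e ^ 2 - 2 * e) (f t)
  have x0 : ι X = a + b * e + c * e ^ 2 := by rw [hX]; simp [he]
  have x1 : ι (C.s X) = a + b * (2 + e - e ^ 2) + c * (2 + e - e ^ 2) ^ 2 := by
    rw [hX]; simp [he, C.hs, map_ofNat]
  have x2 : ι (C.s (C.s X)) = a + b * (e ^ 2 - 2 * e) + c * (e ^ 2 - 2 * e) ^ 2 := by
    rw [hX]; simp only [map_add, map_mul, map_sub, map_pow, C.hs, map_ratCast, map_ofNat, ← he]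
    grind
  rw [← x0, ← x1, ← x2, ← hbf] at hb
  have hY0 : Y ≠ 0 := by
    rintro rfl; exact C.cc_ne X (by rw [← hXY]; ring)
  have hr := cc_root s1 s2 s3
  have y0 : ι Y ^ 2 = (ι X - r0) * (ι X - r1) * (ι X - r2) := by
    rw [← hr, ← map_pow, hXY]; unfold cc; simp [map_ofNat]
  have y1 : ι (C.s Y) ^ 2 = (ι (C.s X) - r0) * (ι (C.s X) - r1) * (ι (C.s X) - r2) := by
    rw [← hr, ← map_pow, ← map_pow, hXY]; unfold cc; simp [map_ofNat]
  have y2 : ι (C.s (C.s Y)) ^ 2 = (ι (C.s (C.s X)) - r0) * (ι (C.s (C.s X)) - r1)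
      * (ι (C.s (C.s X)) - r2) := by
    rw [← hr, ← map_pow, ← map_pow, ← map_pow, hXY]; unfold cc; simp [map_ofNat]
  have n0 : ι Y ≠ 0 := by simpa using hY0
  have n1 : ι (C.s Y) ≠ 0 := by simpa using hY0
  have n2 : ι (C.s (C.s Y)) ≠ 0 := by simpa using hY0
  have d0 : ι X - r0 ≠ 0 := by
    intro h; rw [h] at y0; simp at y0; exact hY0 y0
  have d1 : ι (C.s X) - r1 ≠ 0 := by
    intro h; rw [h] at y1; simp at y1; exact hY0 y1
  have d2 : ι (C.s (C.s X)) - r2 ≠ 0 := by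
    intro h; rw [h] at y2; simp at y2; exact hY0 y2
  have hβ : bet (a : M) b c t ≠ 0 := by
    intro h
    rw [h, map_zero] at hb
    exact mul_ne_zero (mul_ne_zero d0 d1) d2 hb.symm
  have heven : ∀ w : HeightOneSpectrum (𝓞 M), (3 : 𝓞 M) ∉ w.asIdeal →
      Even ((ordv w).v (bet (a : M) b c t)) := by
    intro w hw
    obtain ⟨P, n, hn, hP⟩ := odd_ramification hodd w
    have h3 : (ordv P).v (3 : Ω) = 0 := by
      have h := ordv_eq_zero w 3 hw
      have h' := hP 3
      have e3 : (((3 : 𝓞 M) : M)) = 3 := by simp [map_ofNat]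
      rw [e3] at h
      rw [h, mul_zero, map_ofNat] at h'
      exact h'
    have q0 := (ordv P).even_root h3 r0 r1 r2 s1 s2 s3 _ _ n0 y0
    have q1 := (ordv P).even_root h3 r1 r2 r0 (by linear_combination s1) (by linear_combination s2)
      (by linear_combination s3) _ _ n1 (by rw [y1]; ring)
    have q2 := (ordv P).even_root h3 r2 r0 r1 (by linear_combination s1) (by linear_combination s2)
      (by linear_combination s3) _ _ n2 (by rw [y2]; ring)
    have := hP (bet (a : M) b c t)
    rw [← hf, hb, (ordv P).mul' _ _ (mul_ne_zero d0 d1) d2, (ordv P).mul' _ _ d0 d1] at this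
    have h4 : Even ((n : ℤ) * (ordv w).v (bet (a : M) b c t)) := by
      rw [← this]; exact (q0.add q1).add q2
    rcases Int.even_mul.1 h4 with h5 | h5
    · exfalso
      have : Even n := by exact_mod_cast h5
      exact Nat.not_even_iff_odd.2 hn this
    · exact h5
  obtain ⟨Q, hQ⟩ := CF.exists_prime M
  obtain ⟨P, n, hn, hP⟩ := odd_ramification hodd Q
  have hn0 : 0 < n := hn.pos
  have hv2 : 3 ≤ (ordv Q).v 2 := by
    have h6 := (exists_basis hp hgen).1
    have hQq : Q.asIdeal = Ideal.span {qq p} := by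
      have := Q.isPrime
      exact prime_two hp h6 Q.asIdeal Q.ne_bot hQ
    have hqm : qq p ∈ Q.asIdeal := by rw [hQq]; exact Ideal.mem_span_singleton_self _
    have hq0 : qq p ≠ 0 := q_ne hp
    have hq1 : 0 < (ordv Q).v (algebraMap (𝓞 M) M (qq p)) := ordv_pos Q _ hqm hq0
    have h2 := congrArg (algebraMap (𝓞 M) M) (two_eq hp)
    rw [map_mul, map_pow, map_ofNat] at h2
    have hq0' : algebraMap (𝓞 M) M (qq p) ≠ 0 := by simpa using hq0
    have : (ordv Q).ge 3 (2 : M) := by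
      rw [h2, mul_comm]
      refine DV.ge_mul0 (ordv_nonneg Q _) (Or.inr ?_)
      rw [(ordv Q).pow hq0']; push_cast; omega
    exact DV.v_of_ge this (by norm_num)
  have hP2 := hP 2
  rw [map_ofNat] at hP2
  have hnv : (n : ℤ) * 3 ≤ n * (ordv Q).v 2 := by gcongr
  obtain ⟨m, hm⟩ := two_adic C (ordv P) (by rw [hP2]; positivity) ι X Y hXY r0 r1 r2 s1 s2 s3
  refine M_main hp hgen _ hβ heven Q hQ m ?_
  have := hm (2 * n) (by positivity) (by rw [hP2]; linarith)
  rw [← hb] at this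
  have h8 : (4 : Ω) ^ m * f (bet (a : M) b c t) - 1 = f (4 ^ m * bet (a : M) b c t - 1) := by
    simp [map_ofNat]
  rw [h8] at this
  unfold DV.u1
  rcases this with h | h
  · left; exact (map_eq_zero f).1 h
  · right
    rw [hP] at h
    have : (n : ℤ) * 2 ≤ n * (ordv Q).v (4 ^ m * bet (a : M) b c t - 1) := by linarith
    exact le_of_mul_le_mul_left this (by exact_mod_cast hn0)

end Q14

namespace Q14
open IsDedekindDomain NumberField ComplexConjugate

lemma CF.he_map {F : Type} [Field F] [CharZero F] (C : CF F) {K : Type*} [Field K] (ι : F →+* K) :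
    ι C.e ^ 3 - 2 * ι C.e ^ 2 - ι C.e + 1 = 0 := by
  have := congrArg ι C.he
  simpa [map_ofNat] using this

lemma CF.real_embed {F : Type} [Field F] [CharZero F] (C : CF F) :
    ∃ ι : F →+* ℂ, ∀ x, conj (ι x) = ι x := by
  have := C.numberField
  let ι : F →+* ℂ := (IsAlgClosed.lift : F →ₐ[ℚ] ℂ).toRingHom
  refine ⟨ι, ?_⟩
  have he := C.he_map ι
  obtain ⟨r, hr⟩ : ∃ r : ℝ, r ^ 3 - 2 * r ^ 2 - r + 1 = 0 := by
    have hc : ContinuousOn (fun r : ℝ => r ^ 3 - 2 * r ^ 2 - r + 1) (Set.Icc 0 1) := by fun_prop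
    have := intermediate_value_Icc' (zero_le_one) hc
    obtain ⟨r, -, hr⟩ := this (show (0 : ℝ) ∈ _ by constructor <;> norm_num)
    exact ⟨r, hr⟩
  have hr' : (r : ℂ) ^ 3 - 2 * r ^ 2 - r + 1 = 0 := by exact_mod_cast hr
  have hcr : conj (r : ℂ) = r := Complex.conj_ofReal r
  set e := ι C.e
  have hprod : ((r : ℂ) - e) * (r - (2 + e - e ^ 2)) * (r - (e ^ 2 - 2 * e)) = 0 := by
    grind
  have hce : conj e = e := by
    rcases mul_eq_zero.1 hprod with h | h
    · rcases mul_eq_zero.1 h with h | h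
      · rw [← sub_eq_zero.1 h, hcr]
      · have : e = r ^ 2 - 2 * r := by grind
        rw [this]; simp [map_ofNat]
    · have : e = 2 + r - r ^ 2 := by grind
      rw [this]; simp [map_ofNat]
  intro x
  obtain ⟨a, b, c, rfl⟩ := C.rep x
  simp only [map_add, map_mul, map_pow, map_ratCast]
  rw [show ι C.e = e from rfl, hce]

lemma cc_disc {K : Type*} [Field K] [CharZero K] {r0 r1 r2 : K} (h1 : r0 + r1 + r2 = -1)
    (h2 : r0 * r1 + r1 * r2 + r2 * r0 = -114) (h3 : r0 * r1 * r2 = -1893 / 4) :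
    ((r0 - r1) * (r1 - r2) * (r2 - r0)) ^ 2 = -(3 * 7 ^ 8 / 16) := by
  have : r2 = -1 - r0 - r1 := by linear_combination h1
  subst this
  grind

lemma exists_real_xi {F : Type} [Field F] [CharZero F] (C : CF F) (p : ℂ) (hp : m6 p = 0) :
    ∃ ι : F →+* ℂ, (∀ x, conj (ι x) = ι x) ∧
      conj (xi (ι C.e) (p ^ 2 + 1)) = xi (ι C.e) (p ^ 2 + 1) := by
  obtain ⟨ι, hι⟩ := C.real_embed
  have he := C.he_map ι
  have hg := gg_ne p hp
  have hh0 := hh_eq p hp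
  set t := p ^ 2 + 1
  obtain ⟨r, hr⟩ : ∃ r : ℝ, cc r = 0 := by
    have hc : ContinuousOn (fun r : ℝ => cc r) (Set.Icc (-100) 0) := by unfold cc; fun_prop
    have := intermediate_value_Icc (by norm_num) hc
    obtain ⟨r, -, hr⟩ := this (show (0 : ℝ) ∈ _ by constructor <;> norm_num [cc])
    exact ⟨r, hr⟩
  have hr' : cc (r : ℂ) = 0 := by
    unfold cc at hr ⊢
    have := congrArg Complex.ofReal hr
    push_cast at this
    exact this
  have s3 := xi_prod he rfl rfl hg
  rw [hh0, mul_zero, zero_div, add_zero] at s3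
  rw [cc_root (xi_sum he rfl rfl hg) (xi_pairs he rfl rfl hg) s3] at hr'
  have hcr : conj (r : ℂ) = r := Complex.conj_ofReal r
  rcases mul_eq_zero.1 hr' with h | h
  · rcases mul_eq_zero.1 h with h | h
    · refine ⟨ι, hι, ?_⟩
      rw [← sub_eq_zero.1 h, hcr]
    · refine ⟨ι.comp C.s, fun x => hι _, ?_⟩
      have : (ι.comp C.s) C.e = 2 + ι C.e - ι C.e ^ 2 := by simp [C.hs, map_ofNat]
      rw [this, ← sub_eq_zero.1 h, hcr]
  · refine ⟨(ι.comp C.s).comp C.s, fun x => hι _, ?_⟩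
    have : ((ι.comp C.s).comp C.s) C.e = ι C.e ^ 2 - 2 * ι C.e := by
      simp [C.hs, map_ofNat]; grind
    rw [this, ← sub_eq_zero.1 h, hcr]

open Polynomial in
lemma odd_ext (M : IntermediateField ℚ ℂ) (e : ℂ) (he : e ^ 3 - 2 * e ^ 2 - e + 1 = 0) :
    Odd (Module.finrank M (IntermediateField.adjoin M {e})) ∧
    FiniteDimensional M (IntermediateField.adjoin M {e}) := by
  set f : M[X] := X ^ 3 - 2 * X ^ 2 - X + 1 with hf
  have hdeg : f.natDegree = 3 := by rw [hf]; compute_degree!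
  have hmon : f.Monic := by rw [hf]; monicity!
  have hroot : aeval e f = 0 := by
    rw [hf]; simpa [map_ofNat] using he
  have hint : IsIntegral M e := ⟨f, hmon, by simpa [aeval_def] using hroot⟩
  refine ⟨?_, IntermediateField.adjoin.finiteDimensional hint⟩
  by_cases heM : e ∈ M
  · have : IntermediateField.adjoin M {e} = ⊥ := by
      rw [IntermediateField.adjoin_simple_eq_bot_iff, IntermediateField.mem_bot]
      exact ⟨⟨e, heM⟩, rfl⟩
    rw [this, IntermediateField.finrank_bot]; decide
  · have hirr : Irreducible f := by
      refine Polynomial.irreducible_of_degree_le_three_of_not_isRoot (by rw [hdeg]; decide) ?_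
      intro r hr
      have h1 : (r : ℂ) ^ 3 - 2 * r ^ 2 - r + 1 = 0 := by
        have : r ^ 3 - 2 * r ^ 2 - r + 1 = 0 := by
          simpa [hf, IsRoot] using hr
        have h := congrArg M.val this
        simp only [map_sub, map_add, map_mul, map_pow, map_ofNat, map_one, map_zero] at h
        exact h
      have hprod : (e - r) * (e - (2 + r - r ^ 2)) * (e - (r ^ 2 - 2 * r)) = 0 := by
        grind
      apply heM
      rcases mul_eq_zero.1 hprod with h | h
      · rcases mul_eq_zero.1 h with h | h
        · rw [sub_eq_zero.1 h]; exact r.2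
        · rw [sub_eq_zero.1 h]
          exact (2 + r - r ^ 2).2
      · rw [sub_eq_zero.1 h]
        exact (r ^ 2 - 2 * r).2
    have := minpoly.eq_of_irreducible_of_monic hirr hroot hmon
    rw [IntermediateField.adjoin.finrank hint, ← this, hdeg]; decide

end Q14

namespace Q14
open IsDedekindDomain NumberField ComplexConjugate

lemma adjoin_top_transfer {K : Type*} [Field K] {S : Set K} {A B : Algebra ℚ K}
    (h : @IntermediateField.adjoin ℚ _ K _ A S = ⊤) : @IntermediateField.adjoin ℚ _ K _ B S = ⊤ := by
  have : A = B := Subsingleton.elim _ _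
  subst this
  exact h

theorem complex_decomp {F : Type} [Field F] [CharZero F] (C : CF F) (ι : F →+* ℂ)
    (p : ℂ) (hp : m6 p = 0) (X Y : F) (hXY : Y ^ 2 = cc X)
    (a b c : ℚ) (hX : X = a + b * C.e + c * C.e ^ 2) :
    ∃ (z : ℂ) (n a' : ℕ) (γ : ℂ), γ ∈ Algebra.adjoin ℚ {p} ∧ 0 < n ∧ z ^ n = 1 ∧ a' < 2 ∧
      bet (a : ℂ) b c (p ^ 2 + 1) = z * (2 * om p + 1) ^ a' * γ ^ 2 := by
  have hint : IsIntegral ℤ p := by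
    refine ⟨Polynomial.X ^ 6 + Polynomial.X ^ 5 + 4 * Polynomial.X ^ 4 + 5 * Polynomial.X ^ 3
      + 4 * Polynomial.X ^ 2 + 3 * Polynomial.X + 1, by monicity!, ?_⟩
    unfold m6 at hp
    simpa [Polynomial.eval₂_add, Polynomial.eval₂_mul] using hp
  have hintQ : IsIntegral ℚ p := hint.tower_top
  set M := IntermediateField.adjoin ℚ {p} with hM
  have : FiniteDimensional ℚ M := IntermediateField.adjoin.finiteDimensional hintQ
  have : NumberField M := ⟨⟩
  have hpM : p ∈ M := IntermediateField.mem_adjoin_simple_self ℚ p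
  let pM : M := ⟨p, hpM⟩
  have hpi : IsIntegral ℤ pM := by
    rw [← isIntegral_algebraMap_iff (B := ℂ) (algebraMap M ℂ).injective]
    exact hint
  let P : 𝓞 M := ⟨pM, hpi⟩
  have hP : m6 P = 0 := by
    let φ : 𝓞 M →+* ℂ := (algebraMap M ℂ).comp (algebraMap (𝓞 M) M)
    apply (show Function.Injective φ from (algebraMap M ℂ).injective.comp
      RingOfIntegers.coe_injective)
    rw [← m6_map, map_zero]
    exact hp
  have hgen : IntermediateField.adjoin ℚ {(P : M)} = ⊤ := by
    refine adjoin_top_transfer (A := M.algebra') ?_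
    apply IntermediateField.map_injective M.val
    rw [IntermediateField.adjoin_map, ← AlgHom.fieldRange_eq_map, IntermediateField.fieldRange_val,
      Set.image_singleton]
    rfl
  obtain ⟨hodd, hfd⟩ := odd_ext M (ι C.e) (C.he_map ι)
  set Ω := IntermediateField.adjoin M {ι C.e} with hΩ
  have : FiniteDimensional ℚ Ω := FiniteDimensional.trans ℚ M Ω
  have : NumberField Ω := ⟨⟩
  have hmem : ∀ x, ι x ∈ Ω := by
    intro x
    obtain ⟨a, b, c, rfl⟩ := C.rep x
    have he : ι C.e ∈ Ω := IntermediateField.mem_adjoin_simple_self M (ι C.e)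
    have hq : ∀ q : ℚ, (q : ℂ) ∈ Ω := fun q => by
      exact SubfieldClass.ratCast_mem Ω q
    simp only [map_add, map_mul, map_pow, map_ratCast]
    exact add_mem (add_mem (hq _) (mul_mem (hq _) he)) (mul_mem (hq _) (pow_mem he 2))
  let ιΩ : F →+* Ω := ι.codRestrict Ω hmem
  obtain ⟨z, n, a', γ, hn, hz, ha, h⟩ := beta_decomp C hodd ιΩ P hP hgen X Y hXY a b c hX
  refine ⟨z, n, a', γ, ?_, hn, ?_, ha, ?_⟩
  · rw [← IntermediateField.adjoin_simple_toSubalgebra_of_isAlgebraic hintQ.isAlgebraic]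
    exact γ.2
  · have := congrArg M.val hz
    rw [map_pow, map_one] at this
    exact this
  · have := congrArg M.val h
    have hb : M.val (bet (a : M) b c ((P : M) ^ 2 + 1)) = bet (a : ℂ) b c (p ^ 2 + 1) := by
      have hg : M.val (gg ((P : M) ^ 2 + 1)) = gg (p ^ 2 + 1) := by
        unfold gg
        simp only [map_sub, map_add, map_pow, map_one]
        rfl
      unfold bet CF.nm
      simp only [map_sub, map_add, map_mul, map_pow, map_ofNat, map_one, map_ratCast, map_div₀, hg]
      rfl
    have ho : M.val (om (P : M)) = om p := by
      unfold om
      simp only [map_sub, map_mul, map_pow, map_ofNat, map_neg]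
      rfl
    rw [hb] at this
    rw [this]
    simp only [map_add, map_mul, map_pow, map_ofNat, map_one, ho]
    rfl
end Q14

namespace Q14
open ComplexConjugate

lemma exists_m6 : ∃ p : ℂ, m6 p = 0 := by
  have hdeg : (Polynomial.X ^ 6 + Polynomial.X ^ 5 + 4 * Polynomial.X ^ 4 + 5 * Polynomial.X ^ 3
      + 4 * Polynomial.X ^ 2 + 3 * Polynomial.X + 1 : Polynomial ℂ).natDegree = 6 := by
    compute_degree!
  obtain ⟨p, hp⟩ := IsAlgClosed.exists_root (Polynomial.X ^ 6 + Polynomial.X ^ 5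
    + 4 * Polynomial.X ^ 4 + 5 * Polynomial.X ^ 3
      + 4 * Polynomial.X ^ 2 + 3 * Polynomial.X + 1 : Polynomial ℂ) (by
      intro h
      have := Polynomial.natDegree_eq_of_degree_eq_some (n := 0) h
      omega)
  refine ⟨p, ?_⟩
  unfold m6
  simpa [Polynomial.IsRoot] using hp

lemma not_all_real {r0 r1 r2 : ℂ} (h1 : r0 + r1 + r2 = -1)
    (h2 : r0 * r1 + r1 * r2 + r2 * r0 = -114) (h3 : r0 * r1 * r2 = -1893 / 4)
    (c0 : conj r0 = r0) (c1 : conj r1 = r1) : False := by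
  have h := cc_disc h1 h2 h3
  have : r2 = -1 - r0 - r1 := by linear_combination h1
  subst this
  obtain ⟨a, rfl⟩ := Complex.conj_eq_iff_real.1 c0
  obtain ⟨b, rfl⟩ := Complex.conj_eq_iff_real.1 c1
  have h' : ((a - b) * (b - (-1 - a - b)) * (-1 - a - b - a)) ^ 2 = -(3 * 7 ^ 8 / 16 : ℝ) := by
    have h2 : ((((a - b) * (b - (-1 - a - b)) * (-1 - a - b - a)) ^ 2 : ℝ) : ℂ)
        = ((-(3 * 7 ^ 8 / 16) : ℝ) : ℂ) := by push_cast; linear_combination h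
    exact Complex.ofReal_injective h2
  nlinarith [sq_nonneg ((a - b) * (b - (-1 - a - b)) * (-1 - a - b - a))]

lemma conj_xi (e t : ℂ) (he : conj e = e) : conj (xi e t) = xi e (conj t) := by
  unfold xi gg
  simp [map_ofNat, he]

lemma conj_cc (t : ℂ) : conj (cc t) = cc (conj t) := by
  unfold cc
  simp [map_ofNat]

open Polynomial in
lemma adjoin_rep {F : Type} [Field F] [CharZero F] [Algebra F ℂ] (x : ℂ) (hx : cc x = 0) (y : ℂ)
    (hy : y ∈ IntermediateField.adjoin F {x}) :
    ∃ u v w : F, y = algebraMap F ℂ u + algebraMap F ℂ v * x + algebraMap F ℂ w * x ^ 2 := by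
  set f : F[X] := X ^ 3 + X ^ 2 - 114 * X + C (1893 / 4) with hf
  have hdeg : f.natDegree = 3 := by rw [hf]; compute_degree!
  have hmon : f.Monic := by rw [hf]; monicity!
  have hroot : aeval x f = 0 := by
    rw [hf]; unfold cc at hx; simpa [map_ofNat] using hx
  have hint : IsIntegral F x := ⟨f, hmon, by simpa [aeval_def] using hroot⟩
  have hy' : y ∈ Algebra.adjoin F {x} := by
    rw [← IntermediateField.adjoin_simple_toSubalgebra_of_isAlgebraic hint.isAlgebraic]
    exact hy
  rw [Algebra.adjoin_singleton_eq_range_aeval] at hy'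
  obtain ⟨g, rfl⟩ := hy'
  have h1 : aeval x g = aeval x (g %ₘ f) := by
    conv_lhs => rw [← modByMonic_add_div g f]
    simp [hroot]
  have h2 : (g %ₘ f).natDegree < 3 := by
    rw [← hdeg]; exact natDegree_modByMonic_lt _ hmon (by intro h; rw [h] at hdeg; simp at hdeg)
  refine ⟨(g %ₘ f).coeff 0, (g %ₘ f).coeff 1, (g %ₘ f).coeff 2, ?_⟩
  show aeval x g = _
  rw [h1, aeval_eq_sum_range' h2]
  simp [Finset.sum_range_succ, Algebra.smul_def]

lemma e_tw {e : ℂ} (hee : e ^ 3 - 2 * e ^ 2 - e + 1 = 0) :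
    2 + (2 + e - e ^ 2) - (2 + e - e ^ 2) ^ 2 = e ^ 2 - 2 * e := by
  linear_combination (-e) * hee

lemma k1_ne {e : ℂ} (hee : e ^ 3 - 2 * e ^ 2 - e + 1 = 0) :
    (-14 - 21 * e + 14 * e ^ 2) ≠ 0 := by
  intro h
  grind

lemma pt_eq {p : ℂ} (hp : m6 p = 0) :
    p = -5/2+9/2*(p^2+1-1)+11/2*(p^2+1-1)^2-29/2*(p^2+1-1)^3-19/2*(p^2+1-1)^4
      -3/2*(p^2+1-1)^5 := by unfold m6 at hp; grind

lemma final_alg {A B0 B1 B2 C0 C1 C2 Y1 Y2 G L m t : ℂ} (hA : A ≠ 0) (h1 : Y1 ≠ 0) (h2 : Y2 ≠ 0)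
    (hL : A * B0 * C0 = L ^ 2) (hy1 : Y1 ^ 2 = B0 * B1 * B2) (hy2 : Y2 ^ 2 = C0 * C1 * C2)
    (hG : (A * B1 * C2) * (A * B2 * C1) = t * G ^ 2) (hm : m = G * L / (A * Y1 * Y2)) :
    A = t * m ^ 2 := by
  rw [hm, div_pow, mul_div_assoc', eq_div_iff (by positivity)]
  linear_combination A ^ 3 * Y2 ^ 2 * hy1 + A ^ 3 * B0 * B1 * B2 * hy2 + L ^ 2 * hG
    + A ^ 2 * B1 * B2 * C1 * C2 * hL

theorem sq_class {F : Type} [Field F] [CharZero F] (C : CF F) (X Y l μ : F) (hXY : Y ^ 2 = cc X)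
    (q1 : X + C.s X + C.s (C.s X) = l ^ 2 - 1)
    (q2 : X * C.s X + C.s X * C.s (C.s X) + C.s (C.s X) * X = -114 - 2 * l * μ)
    (q3 : X * C.s X * C.s (C.s X) = μ ^ 2 - 1893 / 4) :
    ∃ (ι : F →+* ℂ) (ξ : ℂ) (a : ℕ) (u v w : F), cc ξ = 0 ∧ a < 2 ∧
      ι X - ξ = 3 ^ a * (ι u + ι v * ξ + ι w * ξ ^ 2) ^ 2 := by
  obtain ⟨p, hp⟩ := exists_m6
  obtain ⟨ι, hι, hξ⟩ := exists_real_xi C p hp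
  have hee := C.he_map ι
  have hg := gg_ne p hp
  have hh0 := hh_eq p hp
  obtain ⟨a, b, c, hX⟩ := C.rep X
  obtain ⟨ζ, n, a', γ, hγ, hn, hζ, ha, hβ⟩ := complex_decomp C ι p hp X Y hXY a b c hX
  have hpt : p = -5/2+9/2*(p^2+1-1)+11/2*(p^2+1-1)^2-29/2*(p^2+1-1)^3-19/2*(p^2+1-1)^4
      -3/2*(p^2+1-1)^5 := pt_eq hp
  have hom := s3_eq hp
  set w3 := 2 * om p + 1
  set t := p ^ 2 + 1
  set e := ι C.e with he
  have hce : conj e = e := hι _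
  have s1 := xi_sum hee rfl rfl hg
  have s2 := xi_pairs hee rfl rfl hg
  have s3 := xi_prod hee rfl rfl hg
  rw [hh0, mul_zero, zero_div, add_zero] at s3
  rw [bet_eq hee rfl rfl hg] at hβ
  have hr1 : conj (2 + e - e ^ 2) = 2 + e - e ^ 2 := by simp [map_ofNat, hce]
  have hnr : conj t ≠ t := by
    intro ht
    refine not_all_real s1 s2 s3 hξ ?_
    rw [conj_xi _ _ hr1, ht]
  have hxe : xi e t = (-14 - 21 * e + 14 * e ^ 2) * (t - e) / gg t + 7 * e - 5 := rfl
  set r0 := xi e t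
  set r1 := xi (2 + e - e ^ 2) t
  set r2 := xi (e ^ 2 - 2 * e) t
  have hr := cc_root s1 s2 s3
  have hc1 : conj r1 = r2 := by
    have h1 : cc (conj r1) = 0 := by
      rw [← conj_cc, hr]; simp
    rw [hr] at h1
    rcases mul_eq_zero.1 h1 with h | h
    · rcases mul_eq_zero.1 h with h | h
      · exfalso
        have h2 : r1 = r0 := by
          have := congrArg conj (sub_eq_zero.1 h)
          rw [hξ, Complex.conj_conj] at this; exact this
        have := cc_disc s1 s2 s3
        rw [h2] at this; norm_num at this
      · exact (not_all_real s1 s2 s3 hξ (sub_eq_zero.1 h)).elim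
    · exact sub_eq_zero.1 h
  have hc2 : conj r2 = r1 := by rw [← hc1, Complex.conj_conj]
  have x0 : ι X = a + b * e + c * e ^ 2 := by rw [hX]; simp [he]
  have x1 : ι (C.s X) = a + b * (2 + e - e ^ 2) + c * (2 + e - e ^ 2) ^ 2 := by
    rw [hX]; simp [he, C.hs, map_ofNat]
  have x2 : ι (C.s (C.s X)) = a + b * (e ^ 2 - 2 * e) + c * (e ^ 2 - 2 * e) ^ 2 := by
    rw [hX]; simp only [map_add, map_mul, map_sub, map_pow, C.hs, map_ratCast, map_ofNat, ← he]
    rw [e_tw hee]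
  rw [← x0, ← x1, ← x2] at hβ
  have hβ' := congrArg conj hβ
  simp only [map_mul, map_sub, map_pow, hι, hξ, hc1, hc2] at hβ'
  have hζ1 : ζ * conj ζ = 1 := by
    rw [Complex.mul_conj, Complex.normSq_eq_norm_sq, Complex.norm_eq_one_of_pow_eq_one hζ hn.ne']
    simp
  have hw3 : w3 * conj w3 = 3 := by
    have h1 : ‖w3‖ ^ 2 = 3 := by rw [← norm_pow, hom]; simp
    rw [Complex.mul_conj, Complex.normSq_eq_norm_sq, h1]; simp
  -- the field N
  let _ : Algebra F ℂ := ι.toAlgebra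
  have halg : ∀ x, algebraMap F ℂ x = ι x := fun _ => rfl
  have hcc0 : cc r0 = 0 := by rw [hr]; ring
  set N := IntermediateField.adjoin F {r0} with hN
  have hrN : r0 ∈ N := IntermediateField.mem_adjoin_simple_self F r0
  have hιN : ∀ x, ι x ∈ N := fun x => N.algebraMap_mem x
  have hNreal : ∀ x ∈ N, conj x = x := by
    intro x hx
    obtain ⟨u, v, w, rfl⟩ := adjoin_rep r0 hcc0 x hx
    simp only [halg, map_add, map_mul, map_pow, hι, hξ]
  obtain ⟨z, hz⟩ : ∃ z, z = (r0 - 7 * e + 5) / (-14 - 21 * e + 14 * e ^ 2) := ⟨_, rfl⟩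
  have hk1 : (-14 - 21 * e + 14 * e ^ 2) ≠ 0 := k1_ne hee
  have hzt : z * gg t = t - e := by
    rw [hz, hxe]; field_simp; ring
  have hnum : ∀ k : ℕ, (k : ℂ) ∈ N := fun k => natCast_mem N k
  have heN : e ∈ N := hιN _
  have hzN : z ∈ N := by
    rw [hz]
    have : (r0 - 7 * e + 5) / (-14 - 21 * e + 14 * e ^ 2) =
      (r0 - (7 : ℕ) * e + (5 : ℕ)) / ((14 : ℕ) * e ^ 2 - (14 : ℕ) - (21 : ℕ) * e) := by
      push_cast; congr 1; ring
    rw [this]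
    exact div_mem (add_mem (sub_mem hrN (mul_mem (hnum 7) heN)) (hnum 5))
      (sub_mem (sub_mem (mul_mem (hnum 14) (pow_mem heN 2)) (hnum 14)) (mul_mem (hnum 21) heN))
  have hz0 : z ≠ 0 := by
    intro h
    rw [h, zero_mul] at hzt
    have : t = e := (sub_eq_zero.1 hzt.symm)
    exact hnr (by rw [this, hce])
  have hzc : conj z = z := hNreal z hzN
  have hzt' : z * gg (conj t) = conj t - e := by
    have := congrArg conj hzt
    rw [map_mul, map_sub, hzc, hce] at this
    rw [← this]; unfold gg; simp
  unfold gg at hzt hzt'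
  have hsum : z * (t + conj t) = z + 1 := by
    have h0 : t - conj t ≠ 0 := sub_ne_zero.2 hnr.symm
    apply mul_right_cancel₀ h0
    linear_combination hzt - hzt'
  have hpr : z * (t * conj t) = z + e := by
    linear_combination t * hsum - hzt
  have hS : ∃ u ∈ N, ∃ v ∈ N, γ = u + v * t := by
    have hmul : ∀ x y : ℂ, (∃ u ∈ N, ∃ v ∈ N, x = u + v * t) → (∃ u ∈ N, ∃ v ∈ N, y = u + v * t) →
        ∃ u ∈ N, ∃ v ∈ N, x * y = u + v * t := by
      rintro x y ⟨u, hu, v, hv, rfl⟩ ⟨u', hu', v', hv', rfl⟩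
      refine ⟨u * u' - v * v' * ((z + e) / z), sub_mem (mul_mem hu hu') (mul_mem (mul_mem hv hv')
        (div_mem (add_mem hzN heN) hzN)), u * v' + v * u' + v * v' * ((z + 1) / z),
        add_mem (add_mem (mul_mem hu hv') (mul_mem hv hu')) (mul_mem (mul_mem hv hv')
        (div_mem (add_mem hzN (one_mem N)) hzN)), ?_⟩
      field_simp
      linear_combination v * v' * hzt
    have hadd : ∀ x y : ℂ, (∃ u ∈ N, ∃ v ∈ N, x = u + v * t) → (∃ u ∈ N, ∃ v ∈ N, y = u + v * t) →
        ∃ u ∈ N, ∃ v ∈ N, x + y = u + v * t := by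
      rintro x y ⟨u, hu, v, hv, rfl⟩ ⟨u', hu', v', hv', rfl⟩
      exact ⟨u + u', add_mem hu hu', v + v', add_mem hv hv', by ring⟩
    have hrat : ∀ q : ℚ, ∃ u ∈ N, ∃ v ∈ N, (q : ℂ) = u + v * t := fun q =>
      ⟨q, SubfieldClass.ratCast_mem N q, 0, zero_mem N, by ring⟩
    have hpS : ∃ u ∈ N, ∃ v ∈ N, p = u + v * t := by
      have ht : ∃ u ∈ N, ∃ v ∈ N, (t - 1) = u + v * t :=
        ⟨-1, neg_mem (one_mem N), 1, one_mem N, by ring⟩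
      have hpow : ∀ k : ℕ, ∃ u ∈ N, ∃ v ∈ N, (t - 1) ^ k = u + v * t := by
        intro k
        induction k with
        | zero => simpa using hrat 1
        | succ k ih => rw [pow_succ]; exact hmul _ _ ih ht
      have : p = ((-5/2 : ℚ) : ℂ) + ((9/2 : ℚ) : ℂ) * (t - 1) ^ 1 + ((11/2 : ℚ) : ℂ) * (t - 1) ^ 2
        + ((-29/2 : ℚ) : ℂ) * (t - 1) ^ 3 + ((-19/2 : ℚ) : ℂ) * (t - 1) ^ 4
        + ((-3/2 : ℚ) : ℂ) * (t - 1) ^ 5 := by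
        push_cast; linear_combination hpt
      rw [this]
      exact hadd _ _ (hadd _ _ (hadd _ _ (hadd _ _ (hadd _ _ (hrat _) (hmul _ _ (hrat _) (hpow 1)))
        (hmul _ _ (hrat _) (hpow 2))) (hmul _ _ (hrat _) (hpow 3)))
        (hmul _ _ (hrat _) (hpow 4))) (hmul _ _ (hrat _) (hpow 5))
    clear hβ hβ'
    induction hγ using Algebra.adjoin_induction with
    | mem x hx => rw [Set.mem_singleton_iff.1 hx]; exact hpS
    | algebraMap q => exact hrat q
    | add x y _ _ hx hy => exact hadd _ _ hx hy
    | mul x y _ _ hx hy => exact hmul _ _ hx hy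
  obtain ⟨u, hu, v, hv, huv⟩ := hS
  have hγN : γ * conj γ ∈ N := by
    have : γ * conj γ = u ^ 2 + u * v * ((z + 1) / z) + v ^ 2 * ((z + e) / z) := by
      rw [huv]
      simp only [map_add, map_mul, hNreal u hu, hNreal v hv]
      rw [← hsum, ← hpr]
      field_simp
      ring
    rw [this]
    exact add_mem (add_mem (pow_mem hu 2) (mul_mem (mul_mem hu hv)
      (div_mem (add_mem hzN (one_mem N)) hzN))) (mul_mem (pow_mem hv 2)
      (div_mem (add_mem hzN heN) hzN))
  have hcι : ∀ Z : F, ι (cc Z) = cc (ι Z) := by intro Z; unfold cc; simp [map_ofNat]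
  have hcs : ∀ Z : F, C.s (cc Z) = cc (C.s Z) := by intro Z; unfold cc; simp [map_ofNat]
  have hY0 : Y ≠ 0 := by
    rintro rfl; exact C.cc_ne X (by rw [← hXY]; ring)
  have y0 : ι Y ^ 2 = (ι X - r0) * (ι X - r1) * (ι X - r2) := by
    rw [← hr, ← map_pow, hXY, hcι]
  have y1 : ι (C.s Y) ^ 2 = (ι (C.s X) - r0) * (ι (C.s X) - r1) * (ι (C.s X) - r2) := by
    rw [← hr, ← map_pow, ← map_pow, hXY, hcs, hcι]
  have y2 : ι (C.s (C.s Y)) ^ 2 = (ι (C.s (C.s X)) - r0) * (ι (C.s (C.s X)) - r1)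
      * (ι (C.s (C.s X)) - r2) := by
    rw [← hr, ← map_pow, ← map_pow, ← map_pow, hXY, hcs, hcs, hcι]
  have d0 : ι X - r0 ≠ 0 := by
    intro h; rw [h] at y0; simp at y0; exact hY0 y0
  have n1 : ι (C.s Y) ≠ 0 := by simpa using hY0
  have n2 : ι (C.s (C.s Y)) ≠ 0 := by simpa using hY0
  have Q1 := congrArg ι q1
  have Q2 := congrArg ι q2
  have Q3 := congrArg ι q3
  simp only [map_add, map_mul, map_sub, map_pow, map_neg, map_one, map_ofNat, map_div₀] at Q1 Q2 Q3
  have hline : (ι X - r0) * (ι (C.s X) - r0) * (ι (C.s (C.s X)) - r0) = (ι l * r0 + ι μ) ^ 2 := by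
    unfold cc at hcc0
    linear_combination r0 ^ 2 * Q1 - r0 * Q2 + Q3 - hcc0
  obtain ⟨m, hm⟩ : ∃ m, m = γ * conj γ * (ι l * r0 + ι μ) /
    ((ι X - r0) * ι (C.s Y) * ι (C.s (C.s Y))) := ⟨_, rfl⟩
  have hmN : m ∈ N := by
    rw [hm]
    exact div_mem (mul_mem hγN (add_mem (mul_mem (hιN _) hrN) (hιN _)))
      (mul_mem (mul_mem (sub_mem (hιN _) hrN) (hιN _)) (hιN _))
  have hββ : ((ι X - r0) * (ι (C.s X) - r1) * (ι (C.s (C.s X)) - r2)) *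
      ((ι X - r0) * (ι (C.s X) - r2) * (ι (C.s (C.s X)) - r1)) = 3 ^ a' * (γ * conj γ) ^ 2 := by
    rw [hβ, hβ', ← hw3]
    rw [mul_pow w3]
    linear_combination w3 ^ a' * conj w3 ^ a' * (γ * conj γ) ^ 2 * hζ1
  obtain ⟨u', v', w', hfin⟩ := adjoin_rep r0 hcc0 m hmN
  refine ⟨ι, r0, a', u', v', w', hcc0, ha, ?_⟩
  rw [← halg u', ← halg v', ← halg w', ← hfin]
  exact final_alg d0 n1 n2 hline y1 y2 hββ hm

end Q14

namespace Q14

open Polynomial in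
lemma xi_indep {F : Type} [Field F] [CharZero F] (C : CF F) (ι : F →+* ℂ) (ξ : ℂ) (hξ : cc ξ = 0)
    (a b c : F) (h : ι a + ι b * ξ + ι c * ξ ^ 2 = 0) : a = 0 ∧ b = 0 ∧ c = 0 := by
  let _ : Algebra F ℂ := ι.toAlgebra
  have halg : ∀ x, algebraMap F ℂ x = ι x := fun _ => rfl
  set f : F[X] := X ^ 3 + X ^ 2 - 114 * X + Polynomial.C (1893 / 4) with hf
  have hdeg : f.natDegree = 3 := by rw [hf]; compute_degree!
  have hmon : f.Monic := by rw [hf]; monicity!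
  have hroot : aeval ξ f = 0 := by
    rw [hf]; unfold cc at hξ; simpa [map_ofNat] using hξ
  have hirr : Irreducible f := by
    apply irreducible_of_degree_le_three_of_not_isRoot
    · rw [hdeg]; decide
    · intro x hx
      apply C.cc_ne x
      rw [hf] at hx
      unfold cc
      simpa [Polynomial.IsRoot] using hx
  have hmin : f = minpoly F ξ := minpoly.eq_of_irreducible_of_monic hirr hroot hmon
  set g : F[X] := Polynomial.C a + Polynomial.C b * X + Polynomial.C c * X ^ 2 with hg
  have hg0 : aeval ξ g = 0 := by
    rw [hg]; simp only [map_add, map_mul, aeval_C, aeval_X, map_pow, halg]; exact h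
  have hgz : g = 0 := by
    by_contra hne
    have h1 := natDegree_le_of_dvd (minpoly.dvd F ξ hg0) hne
    rw [← hmin, hdeg] at h1
    have h2 : g.natDegree ≤ 2 := by rw [hg]; compute_degree
    omega
  have e0 := congrArg (fun q : F[X] => q.coeff 0) hgz
  have e1 := congrArg (fun q : F[X] => q.coeff 1) hgz
  have e2 := congrArg (fun q : F[X] => q.coeff 2) hgz
  simp [hg, coeff_X, coeff_C] at e0 e1 e2
  exact ⟨e0, e1, e2⟩

theorem halving {F : Type} [Field F] [CharZero F] (C : CF F) (X Y l μ : F) (hXY : Y ^ 2 = cc X)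
    (q1 : X + C.s X + C.s (C.s X) = l ^ 2 - 1)
    (q2 : X * C.s X + C.s X * C.s (C.s X) + C.s (C.s X) * X = -114 - 2 * l * μ)
    (q3 : X * C.s X * C.s (C.s X) = μ ^ 2 - 1893 / 4) :
    ∃ r m n : F, m ^ 2 - X - 2 * r - 1 = 0 ∧ 2 * m * n + r ^ 2 + 2 * X * r + 114 = 0 ∧
      n ^ 2 - X * r ^ 2 - 1893 / 4 = 0 := by
  obtain ⟨ι, ξ, a, u, v, w, hξ, ha, hX⟩ := sq_class C X Y l μ hXY q1 q2 q3
  have hξ' := hξ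
  unfold cc at hξ'
  have hY0 : Y ≠ 0 := by
    rintro rfl; exact C.cc_ne X (by rw [← hXY]; ring)
  have hw : w ≠ 0 := by
    rintro rfl
    obtain ⟨-, h1, h2⟩ := xi_indep C ι ξ hξ (X - 3 ^ a * u ^ 2) (-1 - 2 * 3 ^ a * u * v) (-3 ^ a * v ^ 2) (by
      simp only [map_sub, map_mul, map_pow, map_neg, map_one, map_ofNat]
      simp only [map_zero] at hX
      linear_combination hX)
    have : v = 0 := by simpa using h2
    rw [this] at h1
    simp at h1
  obtain ⟨r, hr⟩ : ∃ r, r * w = v - w := ⟨(v - w) / w, by field_simp⟩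
  have hr' := congrArg ι hr
  simp only [map_sub, map_mul] at hr'
  obtain ⟨m, hm⟩ : ∃ m, m = u - r * v + 114 * w := ⟨_, rfl⟩
  obtain ⟨n, hn⟩ : ∃ n, n = - r * u - w * 1893 / 4 := ⟨_, rfl⟩
  have hm' := congrArg ι hm
  have hn' := congrArg ι hn
  simp only [map_sub, map_add, map_neg, map_div₀, map_mul, map_ofNat] at hm' hn'
  have key : (ι u + ι v * ξ + ι w * ξ ^ 2) * (ξ - ι r) = ι m * ξ + ι n := by
    rw [hm', hn']
    linear_combination ι w * hξ' - ξ ^ 2 * hr'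
  have key2 : (ι X - ξ) * (ξ - ι r) ^ 2 = 3 ^ a * (ι m * ξ + ι n) ^ 2 := by
    rw [hX, ← key]; ring
  obtain ⟨h0, h1, h2⟩ := xi_indep C ι ξ hξ (3 ^ a * n ^ 2 - X * r ^ 2 - 1893 / 4)
    (3 ^ a * 2 * m * n + r ^ 2 + 2 * X * r + 114) (3 ^ a * m ^ 2 - X - 2 * r - 1) (by
      simp only [map_sub, map_add, map_mul, map_pow, map_neg, map_one, map_ofNat, map_div₀]
      linear_combination - key2 - hξ')
  interval_cases a
  · exact ⟨r, m, n, by linear_combination h2, by linear_combination h1, by linear_combination h0⟩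
  · exfalso
    have h3 : Y ^ 2 = 3 * (m * X + n) ^ 2 := by
      rw [hXY]; unfold cc; linear_combination - X ^ 2 * h2 - X * h1 - h0
    have h4 : m * X + n ≠ 0 := by
      intro h; rw [h] at h3; simp at h3; exact hY0 h3
    apply C.three_not_sq (Y / (m * X + n))
    rw [div_pow, h3]; field_simp

end Q14

namespace Q14

def EW (K : Type) [Field K] [CharZero K] : WeierstrassCurve.Affine K := ⟨0, 1, 0, -114, 1893 / 4⟩

lemma ew_eq {K : Type} [Field K] [CharZero K] (x y : K) : (EW K).Equation x y ↔ y ^ 2 = cc x := by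
  rw [WeierstrassCurve.Affine.equation_iff]
  unfold EW cc
  simp only
  constructor <;> intro h <;> linear_combination h

lemma ew_ns {K : Type} [Field K] [CharZero K] {x y : K} (h : y ^ 2 = cc x) :
    (EW K).Nonsingular x y := by
  rw [← WeierstrassCurve.Affine.equation_iff_nonsingular_of_Δ_ne_zero, ew_eq]
  · exact h
  · unfold EW WeierstrassCurve.Δ WeierstrassCurve.b₂ WeierstrassCurve.b₄ WeierstrassCurve.b₆ WeierstrassCurve.b₈
    simp only
    norm_num

def Pt (K : Type) [Field K] [CharZero K] : Type := (EW K).Point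

noncomputable instance {K : Type} [Field K] [CharZero K] : AddCommGroup (Pt K) :=
  letI := Classical.decEq K
  inferInstanceAs (AddCommGroup (EW K).Point)

def pt {K : Type} [Field K] [CharZero K] (x y : K) (h : y ^ 2 = cc x) : Pt K :=
  WeierstrassCurve.Affine.Point.some x y (ew_ns h)

lemma pt_congr {K : Type} [Field K] [CharZero K] {x y x' y' : K} {h : y ^ 2 = cc x}
    {h' : y' ^ 2 = cc x'} (hx : x = x') (hy : y = y') : pt x y h = pt x' y' h' := by
  subst hx hy; rfl

lemma pt_inj {K : Type} [Field K] [CharZero K] {x y x' y' : K} {h : y ^ 2 = cc x}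
    {h' : y' ^ 2 = cc x'} (hp : pt x y h = pt x' y' h') : x = x' ∧ y = y' := by
  unfold pt at hp
  injection hp with h1 h2
  exact ⟨h1, h2⟩

lemma pt_ne {K : Type} [Field K] [CharZero K] {x y : K} (h : y ^ 2 = cc x) : pt x y h ≠ 0 :=
  WeierstrassCurve.Affine.Point.some_ne_zero _

lemma pt_cases {K : Type} [Field K] [CharZero K] (P : Pt K) : P = 0 ∨ ∃ x y h, P = pt x y h := by
  rcases P with _ | ⟨x, y, h⟩
  · left; rfl
  · exact Or.inr ⟨x, y, (ew_eq x y).1 h.1, rfl⟩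

lemma pt_neg {K : Type} [Field K] [CharZero K] {x y : K} (h : y ^ 2 = cc x) :
    -(pt x y h) = pt x (-y) (by rw [neg_sq, h]) := by
  classical
  have := WeierstrassCurve.Affine.Point.neg_some (ew_ns h)
  unfold pt
  refine Eq.trans this ?_
  have hn : (EW K).negY x y = -y := by simp [EW, WeierstrassCurve.Affine.negY]
  simp only [hn]
  rfl

lemma pt_add_aux {K : Type} [Field K] [CharZero K] {x1 y1 x2 y2 l : K} (h1 : y1 ^ 2 = cc x1)
    (h2 : y2 ^ 2 = cc x2) (hx : x1 ≠ x2) (hl : l * (x1 - x2) = y1 - y2) :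
    ∃ h, pt x1 y1 h1 + pt x2 y2 h2 = pt (l ^ 2 - 1 - x1 - x2)
      (- (l * ((l ^ 2 - 1 - x1 - x2) - x1) + y1)) h := by
  let _ := Classical.decEq K
  have hs : (EW K).slope x1 x2 y1 y2 = l := by
    rw [WeierstrassCurve.Affine.slope_of_X_ne hx, div_eq_iff (sub_ne_zero.2 hx), hl]
  have hX : (EW K).addX x1 x2 l = l ^ 2 - 1 - x1 - x2 := by
    simp [EW, WeierstrassCurve.Affine.addX]
  have hY : (EW K).addY x1 x2 y1 l = - (l * ((l ^ 2 - 1 - x1 - x2) - x1) + y1) := by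
    unfold WeierstrassCurve.Affine.addY WeierstrassCurve.Affine.negAddY
    rw [hX]; simp [EW, WeierstrassCurve.Affine.negY]
  have hadd := WeierstrassCurve.Affine.Point.add_of_X_ne (h₁ := ew_ns h1) (h₂ := ew_ns h2) hx
  have hns := WeierstrassCurve.Affine.nonsingular_add (ew_ns h1) (ew_ns h2) (fun h => hx h.1)
  simp only [hs, hX, hY] at hadd hns
  exact ⟨(ew_eq _ _).1 hns.1, hadd⟩

lemma pt_dbl_aux {K : Type} [Field K] [CharZero K] {x y l : K} (h : y ^ 2 = cc x)
    (hy : y ≠ 0) (hl : l * (2 * y) = 3 * x ^ 2 + 2 * x - 114) :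
    ∃ h', pt x y h + pt x y h = pt (l ^ 2 - 1 - 2 * x)
      (- (l * ((l ^ 2 - 1 - 2 * x) - x) + y)) h' := by
  let _ := Classical.decEq K
  have hny : y ≠ (EW K).negY x y := by
    simp only [EW, WeierstrassCurve.Affine.negY]
    intro h; apply hy; linear_combination h / 2
  have hs : (EW K).slope x x y y = l := by
    rw [WeierstrassCurve.Affine.slope_of_Y_ne rfl hny, div_eq_iff (sub_ne_zero.2 hny)]
    simp only [EW, WeierstrassCurve.Affine.negY]
    linear_combination -hl
  have hX : (EW K).addX x x l = l ^ 2 - 1 - 2 * x := by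
    simp only [EW, WeierstrassCurve.Affine.addX]; ring
  have hY : (EW K).addY x x y l = - (l * ((l ^ 2 - 1 - 2 * x) - x) + y) := by
    unfold WeierstrassCurve.Affine.addY WeierstrassCurve.Affine.negAddY
    rw [hX]; simp [EW, WeierstrassCurve.Affine.negY]
  have hadd := WeierstrassCurve.Affine.Point.add_self_of_Y_ne (h₁ := ew_ns h) hny
  have hns := WeierstrassCurve.Affine.nonsingular_add (ew_ns h) (ew_ns h) (fun h => hny h.2)
  simp only [hs, hX, hY] at hadd hns
  exact ⟨(ew_eq _ _).1 hns.1, hadd⟩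

lemma pt_add {K : Type} [Field K] [CharZero K] {x1 y1 x2 y2 x3 y3 : K} (l : K) (h1 : y1 ^ 2 = cc x1)
    (h2 : y2 ^ 2 = cc x2) (h3 : y3 ^ 2 = cc x3) (hx : x1 ≠ x2) (hl : l * (x1 - x2) = y1 - y2)
    (hx3 : x3 = l ^ 2 - 1 - x1 - x2) (hy3 : y3 = -(l * (x3 - x1) + y1)) :
    pt x1 y1 h1 + pt x2 y2 h2 = pt x3 y3 h3 := by
  obtain ⟨h, H⟩ := pt_add_aux h1 h2 hx hl
  rw [H]
  exact pt_congr hx3.symm (by rw [hy3, hx3])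

lemma pt_dbl {K : Type} [Field K] [CharZero K] {x y x3 y3 : K} (l : K) (h : y ^ 2 = cc x)
    (h3 : y3 ^ 2 = cc x3)
    (hy : y ≠ 0) (hl : l * (2 * y) = 3 * x ^ 2 + 2 * x - 114) (hx3 : x3 = l ^ 2 - 1 - 2 * x)
    (hy3 : y3 = -(l * (x3 - x) + y)) :
    pt x y h + pt x y h = pt x3 y3 h3 := by
  obtain ⟨h', H⟩ := pt_dbl_aux h hy hl
  rw [H]
  exact pt_congr hx3.symm (by rw [hy3, hx3])

lemma cc_map {K L : Type} [Field K] [CharZero K] [Field L] [CharZero L] (f : K →+* L) (x : K) :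
    f (cc x) = cc (f x) := by unfold cc; simp [map_ofNat]

lemma map_on {K L : Type} [Field K] [CharZero K] [Field L] [CharZero L] (f : K →+* L) {x y : K}
    (h : y ^ 2 = cc x) : f y ^ 2 = cc (f x) := by rw [← map_pow, h, cc_map]

def mpf {K L : Type} [Field K] [CharZero K] [Field L] [CharZero L] (f : K →+* L) : Pt K → Pt L
  | .zero => .zero
  | .some x y h => pt (f x) (f y) (map_on f ((ew_eq x y).1 h.1))

lemma mpf_zero {K L : Type} [Field K] [CharZero K] [Field L] [CharZero L] (f : K →+* L) :
  mpf f (0 : Pt K) = 0 := rfl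

lemma mpf_pt {K L : Type} [Field K] [CharZero K] [Field L] [CharZero L] (f : K →+* L) {x y : K}
    (h : y ^ 2 = cc x) : mpf f (pt x y h) = pt (f x) (f y) (map_on f h) := rfl

lemma mpf_neg {K L : Type} [Field K] [CharZero K] [Field L] [CharZero L] (f : K →+* L) (P : Pt K) :
    mpf f (-P) = - mpf f P := by
  rcases pt_cases P with rfl | ⟨x, y, h, rfl⟩
  · rw [neg_zero, mpf_zero, neg_zero]
  · rw [pt_neg, mpf_pt, mpf_pt, pt_neg]; exact pt_congr rfl (by simp)

lemma same_x {K : Type} [Field K] [CharZero K] {x y y' : K} (h : y ^ 2 = cc x) (h' : y' ^ 2 = cc x) :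
    pt x y' h' = pt x y h ∨ pt x y' h' = - pt x y h := by
  rcases sq_eq_sq_iff_eq_or_eq_neg.1 (h'.trans h.symm) with h | h
  · left; exact pt_congr rfl h
  · right; rw [pt_neg]; exact pt_congr rfl h

lemma mpf_add {K L : Type} [Field K] [CharZero K] [Field L] [CharZero L] (f : K →+* L) (P Q : Pt K) :
    mpf f (P + Q) = mpf f P + mpf f Q := by
  rcases pt_cases P with rfl | ⟨x1, y1, h1, rfl⟩
  · rw [zero_add, mpf_zero, zero_add]
  rcases pt_cases Q with rfl | ⟨x2, y2, h2, rfl⟩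
  · rw [add_zero, mpf_zero, add_zero]
  by_cases hx : x1 = x2
  · subst hx
    rcases same_x h1 h2 with h | h
    · rw [h]
      by_cases hy : y1 = 0
      · have : pt x1 y1 h1 = - pt x1 y1 h1 := by rw [pt_neg]; exact pt_congr rfl (by simp [hy])
        have h2 : mpf f (pt x1 y1 h1) = - mpf f (pt x1 y1 h1) := by rw [← mpf_neg, ← this]
        rw [eq_neg_iff_add_eq_zero] at this h2
        rw [this, h2, mpf_zero]
      · have hl : (3 * x1 ^ 2 + 2 * x1 - 114) / (2 * y1) * (2 * y1) = 3 * x1 ^ 2 + 2 * x1 - 114 := by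
          field_simp
        generalize (3 * x1 ^ 2 + 2 * x1 - 114) / (2 * y1) = l at hl
        obtain ⟨h3, H⟩ := pt_dbl_aux h1 hy hl
        rw [H, mpf_pt, mpf_pt]
        symm
        apply pt_dbl (f l)
        · simpa using hy
        · have := congrArg f hl; simpa [map_ofNat] using this
        · simp [map_ofNat]
        · simp [map_ofNat]
    · rw [h, add_neg_cancel, mpf_neg, add_neg_cancel, mpf_zero]
  · have hl : (y1 - y2) / (x1 - x2) * (x1 - x2) = y1 - y2 := by
      rw [div_mul_cancel₀ _ (sub_ne_zero.2 hx)]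
    generalize (y1 - y2) / (x1 - x2) = l at hl
    obtain ⟨h3, H⟩ := pt_add_aux h1 h2 hx hl
    rw [H, mpf_pt, mpf_pt, mpf_pt]
    symm
    apply pt_add (f l)
    · exact fun h => hx (f.injective h)
    · have := congrArg f hl; simpa using this
    · simp
    · simp

def mp {K L : Type} [Field K] [CharZero K] [Field L] [CharZero L] (f : K →+* L) : Pt K →+ Pt L where
  toFun := mpf f
  map_zero' := mpf_zero f
  map_add' := mpf_add f

lemma mp_pt {K L : Type} [Field K] [CharZero K] [Field L] [CharZero L] (f : K →+* L) {x y : K}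
    (h : y ^ 2 = cc x) : mp f (pt x y h) = pt (f x) (f y) (map_on f h) := rfl

lemma mp_inj {K L : Type} [Field K] [CharZero K] [Field L] [CharZero L] (f : K →+* L) (P : Pt K)
    (h : mp f P = 0) : P = 0 := by
  rcases pt_cases P with rfl | ⟨x, y, h1, rfl⟩
  · rfl
  · rw [mp_pt] at h; exact (pt_ne _ h).elim

end Q14

namespace Q14

lemma CF.s3 {F : Type} [Field F] [CharZero F] (C : CF F) (x : F) : C.s (C.s (C.s x)) = x := by
  obtain ⟨a, b, c, rfl⟩ := C.rep x
  have h1 : C.s (C.s (C.s C.e)) = C.e := by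
    have he := C.he
    simp only [C.hs, map_sub, map_add, map_pow, map_ofNat]
    generalize C.e = e at he
    grind
  simp only [map_add, map_mul, map_pow, map_ratCast, h1]

def CF.S {F : Type} [Field F] [CharZero F] (C : CF F) : Pt F →+ Pt F := mp C.s

noncomputable def CF.tr {F : Type} [Field F] [CharZero F] (C : CF F) : Pt F →+ Pt F :=
  AddMonoidHom.id _ + C.S + C.S.comp C.S

lemma CF.tr_apply {F : Type} [Field F] [CharZero F] (C : CF F) (P : Pt F) :
    C.tr P = P + C.S P + C.S (C.S P) := rfl

lemma CF.S_pt {F : Type} [Field F] [CharZero F] (C : CF F) {x y : F} (h : y ^ 2 = cc x) :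
    C.S (pt x y h) = pt (C.s x) (C.s y) (map_on C.s h) := rfl

lemma CF.y_ne {F : Type} [Field F] [CharZero F] (C : CF F) {x y : F} (h : y ^ 2 = cc x) : y ≠ 0 := by
  rintro rfl; exact C.cc_ne x (by rw [← h]; ring)

lemma CF.two_inj {F : Type} [Field F] [CharZero F] (C : CF F) (P : Pt F) (h : P + P = 0) :
    P = 0 := by
  rcases pt_cases P with rfl | ⟨x, y, hh, rfl⟩
  · rfl
  · rw [← eq_neg_iff_add_eq_zero, pt_neg] at h
    have := (pt_inj h).2
    exact (C.y_ne hh (by linear_combination this / 2)).elim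

lemma line_eqs {F : Type} [Field F] [CharZero F] {X Y X' Y' Z l : F} (h : Y ^ 2 = cc X)
    (h' : Y' ^ 2 = cc X') (hx : X ≠ X') (hl : l * (X - X') = Y - Y') (hZ : l ^ 2 - 1 - X - X' = Z) :
    X * X' + X' * Z + Z * X = -114 - 2 * l * (Y - l * X) ∧
    X * X' * Z = (Y - l * X) ^ 2 - 1893 / 4 := by
  unfold cc at h h'
  have hd : X - X' ≠ 0 := sub_ne_zero.2 hx
  have hY' : Y' = Y - l * (X - X') := by linear_combination hl
  rw [hY'] at h'
  have q2 : X * X' + X' * Z + Z * X = -114 - 2 * l * (Y - l * X) := by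
    apply mul_left_cancel₀ hd
    rw [← hZ]
    linear_combination h - h'
  refine ⟨q2, ?_⟩
  linear_combination X * q2 + X^2 * hZ - h

theorem CF.descent {F : Type} [Field F] [CharZero F] (C : CF F) (P : Pt F) (hP : C.tr P = 0) :
    ∃ Q, C.tr Q = 0 ∧ Q + Q = P := by
  suffices h : ∃ Q, Q + Q = P by
    obtain ⟨Q, hQ⟩ := h
    refine ⟨Q, C.two_inj _ ?_, hQ⟩
    rw [← map_add, hQ, hP]
  rw [C.tr_apply] at hP
  rcases pt_cases P with rfl | ⟨X, Y, h, rfl⟩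
  · exact ⟨0, by simp⟩
  by_cases hx : X = C.s X
  · have h2 : C.S (pt X Y h) = pt X (C.s Y) (by rw [map_on C.s h, ← hx]) := by
      rw [C.S_pt]; exact pt_congr hx.symm rfl
    rcases same_x h (show (C.s Y) ^ 2 = cc X by rw [map_on C.s h, ← hx]) with h3 | h3
    · rw [h2, h3, h2, h3] at hP
      refine ⟨- pt X Y h, ?_⟩
      rw [← sub_eq_zero, ← neg_eq_zero, ← hP]; abel
    · rw [h2, h3, map_neg, h2, h3] at hP
      simp at hP
      exact (pt_ne _ hP).elim
  · have hl : (Y - C.s Y) / (X - C.s X) * (X - C.s X) = Y - C.s Y := by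
      rw [div_mul_cancel₀ _ (sub_ne_zero.2 hx)]
    generalize (Y - C.s Y) / (X - C.s X) = l at hl
    obtain ⟨h3, H⟩ := pt_add_aux h (map_on C.s h) hx hl
    rw [C.S_pt, H, C.S_pt, add_eq_zero_iff_eq_neg, pt_neg] at hP
    have hZ := (pt_inj hP).1
    obtain ⟨q2, q3⟩ := line_eqs h (map_on C.s h) hx hl hZ
    obtain ⟨r, m, n, e2, e1, e0⟩ := halving C X Y l (Y - l * X) h (by rw [← hZ]; ring) q2 q3
    have hQ : (m * r + n) ^ 2 = cc r := by
      unfold cc; linear_combination r ^ 2 * e2 + r * e1 + e0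
    have hP' : (-(m * X + n)) ^ 2 = cc X := by
      unfold cc; linear_combination X ^ 2 * e2 + X * e1 + e0
    have hd : pt r (m * r + n) hQ + pt r (m * r + n) hQ = pt X (-(m * X + n)) hP' := by
      apply pt_dbl m _ _ (C.y_ne hQ)
      · linear_combination 2 * r * e2 + e1
      · linear_combination -e2
      · ring
    rcases same_x hP' h with h4 | h4
    · exact ⟨_, hd.trans h4.symm⟩
    · refine ⟨- pt r (m * r + n) hQ, ?_⟩
      rw [h4, ← hd]; abel

end Q14

namespace Q14

section
variable {F : Type} [Field F] [CharZero F] {V : DV F}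

lemma v_even (h2 : V.v 2 = 1) {x : F} (hx : V.ge 0 x) : V.ge 1 (2 * x) := by
  have := DV.ge_mul (V := V) (m := 1) (n := 0) (x := 2) (Or.inr (by omega)) hx
  simpa using this

lemma v_half (h2 : V.v 2 = 1) {x : F} (hx : V.ge 1 x) : V.ge 0 (x / 2) := by
  rcases hx with rfl | hx
  · left; simp
  · by_cases h0 : x = 0
    · left; simp [h0]
    · right; rw [V.div h0 (by norm_num)]; omega

lemma v_half' (h2 : V.v 2 = 1) {n : ℤ} {x : F} (hx : V.ge (n + 1) (2 * x)) : V.ge n x := by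
  by_cases h0 : x = 0
  · left; exact h0
  · have := DV.v_of_ge hx (by simpa using h0)
    rw [V.mul' _ _ (by norm_num) h0] at this
    right; omega

lemma v_sqrt {x : F} (hx : V.ge 0 (x ^ 2)) : V.ge 0 x := by
  by_cases h0 : x = 0
  · left; exact h0
  · have := DV.v_of_ge hx (by simpa using h0)
    rw [V.pow h0] at this
    right; push_cast at this; omega

lemma v_sqrt1 {x : F} (hx : V.ge 1 (x ^ 2)) : V.ge 1 x := by
  by_cases h0 : x = 0
  · left; exact h0
  · have := DV.v_of_ge hx (by simpa using h0)
    rw [V.pow h0] at this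
    right; push_cast at this; omega

lemma v1893 (h2 : V.v 2 = 1) : V.v (1893 : F) = 0 := by
  have := DV.v_odd (V := V) (by omega) 1893 (by decide)
  simpa using this

lemma fourc_int (h2 : V.v 2 = 1) {x : F} (hx : V.ge 0 x) : 4 * cc x ≠ 0 ∧ V.v (4 * cc x) = 0 := by
  have h : 4 * cc x = 1893 + 2 * (2 * x ^ 3 + 2 * x ^ 2 - 228 * x) := by unfold cc; ring
  have := DV.add_eq (V := V) (x := (1893 : F)) (by norm_num) (y := 2 * (2 * x ^ 3 + 2 * x ^ 2 - 228 * x)) (by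
    rw [v1893 h2]
    apply v_even h2
    exact DV.ge_sub (DV.ge_add (DV.ge_mul0 (DV.ge_ofNat 2) (DV.ge_pow hx 3))
      (DV.ge_mul0 (DV.ge_ofNat 2) (DV.ge_pow hx 2))) (DV.ge_mul0 (DV.ge_ofNat 228) hx))
  rw [← h, v1893 h2] at this
  exact this

lemma y_val (h2 : V.v 2 = 1) {x y : F} (hx : V.ge 0 x) (h : y ^ 2 = cc x) (hy : y ≠ 0) :
    V.v (2 * y) = 0 := by
  have h1 := (fourc_int h2 hx).2
  rw [← h, show 4 * y ^ 2 = (2 * y) ^ 2 by ring, V.pow (by simpa using hy)] at h1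
  push_cast at h1; omega

lemma dbl_int (h2 : V.v 2 = 1) {x X : F} (hx : V.ge 0 x)
    (h : 4 * cc x * X = x ^ 4 + 228 * x ^ 2 - 3786 * x + 11103) : V.ge 0 X := by
  obtain ⟨h0, h1⟩ := fourc_int h2 hx
  by_cases hX : X = 0
  · left; exact hX
  have h3 : V.ge 0 (4 * cc x * X) := by
    rw [h]
    exact DV.ge_add (DV.ge_sub (DV.ge_add (DV.ge_pow hx 4) (DV.ge_mul0 (DV.ge_ofNat 228) (DV.ge_pow hx 2)))
      (DV.ge_mul0 (DV.ge_ofNat 3786) hx)) (DV.ge_ofNat 11103)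
  have := DV.v_of_ge h3 (mul_ne_zero h0 hX)
  rw [V.mul' _ _ h0 hX, h1] at this
  right; omega

lemma dbl_nonint (h2 : V.v 2 = 1) {x X : F} (hx0 : x ≠ 0) (hx : V.v x < 0)
    (h : 4 * cc x * X = x ^ 4 + 228 * x ^ 2 - 3786 * x + 11103) : X ≠ 0 ∧ V.v X = V.v x - 2 := by
  have e4 : V.v (4 : F) = 2 := by
    rw [show (4 : F) = 2 ^ 2 by norm_num, V.pow (by norm_num)]; push_cast; omega
  have p1 : V.v (4 * x ^ 3) = 2 + 3 * V.v x := by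
    rw [V.mul' _ _ (by norm_num) (pow_ne_zero _ hx0), V.pow hx0, e4]; norm_cast
  have p2 : V.v (x ^ 4) = 4 * V.v x := by rw [V.pow hx0]; norm_cast
  have g1 : V.ge (V.v x) x := Or.inr le_rfl
  have g2 : V.ge (2 * V.v x) (x ^ 2) := Or.inr (by rw [V.pow hx0]; norm_cast)
  have g4 : V.ge 2 (4 : F) := Or.inr e4.ge
  obtain ⟨a0, a1⟩ := DV.add_eq (V := V) (x := 4 * x ^ 3) (by simpa using hx0)
    (y := 4 * x ^ 2 - 4 * (114 * x) + 1893) (by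
      rw [p1]
      refine DV.ge_add (DV.ge_sub (DV.ge_mono ?_ (DV.ge_mul g4 g2)) (DV.ge_mono ?_ (DV.ge_mul g4
        (DV.ge_mul0 (DV.ge_ofNat 114) g1)))) (DV.ge_mono ?_ (DV.ge_ofNat 1893)) <;> omega)
  obtain ⟨b0, b1⟩ := DV.add_eq (V := V) (x := x ^ 4) (by simpa using hx0)
    (y := 228 * x ^ 2 - 3786 * x + 11103) (by
      rw [p2]
      refine DV.ge_add (DV.ge_sub (DV.ge_mono ?_ (DV.ge_mul0 (DV.ge_ofNat 228) g2)) (DV.ge_mono ?_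
        (DV.ge_mul0 (DV.ge_ofNat 3786) g1))) (DV.ge_mono ?_ (DV.ge_ofNat 11103)) <;> omega)
  rw [show 4 * x ^ 3 + (4 * x ^ 2 - 4 * (114 * x) + 1893) = 4 * cc x by unfold cc; ring] at a0 a1
  rw [show x ^ 4 + (228 * x ^ 2 - 3786 * x + 11103) = 4 * cc x * X by rw [h]; ring] at b0 b1
  have hX : X ≠ 0 := right_ne_zero_of_mul b0
  refine ⟨hX, ?_⟩
  rw [V.mul' _ _ a0 hX, a1, p1, p2] at b1
  omega

lemma dbl_X (C : CF F) {x y X Y : F} (h : y ^ 2 = cc x) (hX : Y ^ 2 = cc X)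
    (hd : pt x y h + pt x y h = pt X Y hX) :
    4 * cc x * X = x ^ 4 + 228 * x ^ 2 - 3786 * x + 11103 := by
  have hy := C.y_ne h
  have hl : (3 * x ^ 2 + 2 * x - 114) / (2 * y) * (2 * y) = 3 * x ^ 2 + 2 * x - 114 := by
    field_simp
  generalize (3 * x ^ 2 + 2 * x - 114) / (2 * y) = l at hl
  obtain ⟨h3, H⟩ := pt_dbl_aux h hy hl
  rw [H] at hd
  rw [← (pt_inj hd).1, ← h]
  unfold cc at h
  linear_combination (l * (2 * y) + (3 * x ^ 2 + 2 * x - 114)) * hl - (4 + 8 * x) * h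

lemma B_int (C : CF F) (h2 : V.v 2 = 1) (n : ℕ) : ∀ (X Y : F) (h : Y ^ 2 = cc X),
    C.tr (pt X Y h) = 0 → -(n : ℤ) ≤ V.v X → V.ge 0 X := by
  induction n with
  | zero => intro X Y h _ hX; right; simpa using hX
  | succ n ih =>
    intro X Y h hP hX
    obtain ⟨Q, hQ, hd⟩ := C.descent _ hP
    rcases pt_cases Q with rfl | ⟨x, y, h', rfl⟩
    · rw [add_zero] at hd; exact (pt_ne _ hd.symm).elim
    have e := dbl_X C h' h hd
    by_cases hx : V.ge 0 x
    · exact dbl_int h2 hx e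
    · exfalso
      have hx0 : x ≠ 0 := fun h => hx (Or.inl h)
      have hx1 : V.v x < 0 := by
        by_contra h; exact hx (Or.inr (by omega))
      obtain ⟨-, h5⟩ := dbl_nonint h2 hx0 hx1 e
      apply hx
      apply ih x y h' hQ
      push_cast at hX; omega

lemma B_int' (C : CF F) (h2 : V.v 2 = 1) {X Y : F} (h : Y ^ 2 = cc X)
    (hP : C.tr (pt X Y h) = 0) : V.ge 0 X :=
  B_int C h2 (V.v X).natAbs X Y h hP (by omega)

lemma B_cong (C : CF F) (h2 : V.v 2 = 1) {X Y X0 Y0 : F} (h : Y ^ 2 = cc X) (h0 : Y0 ^ 2 = cc X0)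
    (hP : C.tr (pt X Y h) = 0) (hP0 : C.tr (pt X0 Y0 h0) = 0) (hc : V.ge 1 (X - X0)) : X = X0 := by
  by_contra hx
  have hd : X - X0 ≠ 0 := sub_ne_zero.2 hx
  have i1 := B_int' C h2 h hP
  have i0 := B_int' C h2 h0 hP0
  have key : ∀ (y : F) (hy : y ^ 2 = cc X0), C.tr (pt X0 y hy) = 0 → V.ge 0 ((Y - y) / (X - X0)) := by
    intro y hy hyt
    have hl : (Y - y) / (X - X0) * (X - X0) = Y - y := by rw [div_mul_cancel₀ _ hd]
    generalize (Y - y) / (X - X0) = l at hl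
    obtain ⟨h3, H⟩ := pt_add_aux h hy hx hl
    have ht : C.tr (pt _ _ h3) = 0 := by rw [← H, map_add, hP, hyt, add_zero]
    have := B_int' C h2 h3 ht
    apply v_sqrt
    rw [show l ^ 2 = (l ^ 2 - 1 - X - X0) + 1 + X + X0 by ring]
    exact DV.ge_add (DV.ge_add (DV.ge_add this DV.ge_one) i1) i0
  have k1 := key Y0 h0 hP0
  have k2 := key (-Y0) (by rw [neg_sq, h0]) (by rw [← pt_neg h0, map_neg, hP0, neg_zero])
  have k3 := DV.ge_sub k2 k1
  rw [show (Y - -Y0) / (X - X0) - (Y - Y0) / (X - X0) = 2 * Y0 / (X - X0) by ring] at k3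
  have hy := C.y_ne h0
  have hy2 : 2 * Y0 ≠ 0 := by simpa using hy
  have := DV.v_of_ge k3 (div_ne_zero hy2 hd)
  rw [V.div hy2 hd, y_val h2 i0 h0 hy] at this
  have := DV.v_of_ge hc hd
  omega

lemma odd_const (C : CF F) (h2 : V.v 2 = 1) (a b c : ℤ) (ha : Odd a) :
    ¬ V.ge 1 ((a : F) + b * C.e + c * C.e ^ 2) := by
  intro hge
  have hie : V.ge 0 C.e := DV.cub_int _ C.he
  have hint : ∀ a b c : ℤ, V.ge 0 ((a : F) + b * C.e + c * C.e ^ 2) := fun a b c =>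
    DV.ge_add (DV.ge_add (DV.ge_int _) (DV.ge_mul0 (DV.ge_int _) hie))
      (DV.ge_mul0 (DV.ge_int _) (DV.ge_pow hie 2))
  have key := CF.nm_eq C.e C.he (a : F) b c
  have hn : Odd (CF.nm a b c) := CF.nm_odd a b c (fun h => by
    rcases ha with ⟨k, hk⟩; have := h.1; omega)
  have hnm : (CF.nm (a : F) b c) = ((CF.nm a b c : ℤ) : F) := by unfold CF.nm; push_cast; ring
  rw [hnm] at key
  have hn0 : ((CF.nm a b c : ℤ) : F) ≠ 0 := by
    have : CF.nm a b c ≠ 0 := by intro h; rw [h] at hn; simp at hn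
    exact_mod_cast this
  have h3 := hint (2*a*b+6*a*c+a^2-b*c-b^2+3*c^2) (-a*b-4*b*c-2*b^2+c^2) (-a*c+2*b*c+b^2-c^2)
  push_cast at h3
  have h4 := DV.ge_mul0 h3 hge
  rw [mul_comm, key] at h4
  have := DV.v_of_ge h4 hn0
  rw [DV.v_odd (by omega) _ hn] at this
  omega

lemma no_res (C : CF F) (h2 : V.v 2 = 1)
    (hres : ∀ x, V.ge 0 x → ∃ a b c : ℤ, (a = 0 ∨ a = 1) ∧ (b = 0 ∨ b = 1) ∧ (c = 0 ∨ c = 1) ∧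
      V.ge 1 (x - (a + b * C.e + c * C.e ^ 2)))
    {X Y : F} (h : Y ^ 2 = cc X) (hX : V.ge 0 X) (hc : V.ge 1 (X * (X + 1))) : False := by
  have hv := y_val h2 hX h (C.y_ne h)
  have e : (2 * Y) ^ 2 = 4 * (X * (X * (X + 1))) - 456 * X + 1893 := by
    unfold cc at h; linear_combination 4 * h
  have hw : V.ge 0 (2 * Y) := Or.inr hv.ge
  obtain ⟨w, hw'⟩ : ∃ w, w = 2 * Y := ⟨_, rfl⟩
  rw [← hw'] at hw e
  have h5 : V.ge 1 (w - 1) := by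
    apply v_sqrt1
    rw [show (w - 1) ^ 2 = 2 * (2 * (X * (X * (X + 1))) - 228 * X + 946 - (w - 1)) by
      linear_combination e]
    apply v_even h2
    refine DV.ge_sub (DV.ge_add (DV.ge_sub ?_ (DV.ge_mul0 (DV.ge_ofNat 228) hX)) (DV.ge_ofNat 946))
      (DV.ge_sub hw DV.ge_one)
    exact DV.ge_mul0 (DV.ge_ofNat 2) (DV.ge_mul0 hX (DV.ge_mono (by norm_num) hc))
  have h6 := v_half h2 h5
  obtain ⟨z, hz⟩ : ∃ z, z = (w - 1) / 2 := ⟨_, rfl⟩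
  rw [← hz] at h6
  have hz' : w = 1 + 2 * z := by rw [hz]; ring
  have h7 : V.ge 1 (z ^ 2 + z + 1) := by
    rw [show z ^ 2 + z + 1 = X * (X * (X + 1)) + 2 * (237 - 57 * X) by
      rw [hz'] at e; linear_combination e / 4]
    exact DV.ge_add (DV.ge_mul0 hX hc) (v_even h2 (DV.ge_sub (DV.ge_ofNat 237)
      (DV.ge_mul0 (DV.ge_ofNat 57) hX)))
  obtain ⟨a, b, c, -, -, -, h8⟩ := hres z h6
  obtain ⟨u, hu⟩ : ∃ u : F, u = a + b * C.e + c * C.e ^ 2 := ⟨_, rfl⟩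
  rw [← hu] at h8
  have hui : V.ge 0 u := by
    rw [show u = z - (z - u) by ring]
    exact DV.ge_sub h6 (DV.ge_mono (by norm_num) h8)
  have h9 : V.ge 1 (u ^ 2 + u + 1) := by
    rw [show u ^ 2 + u + 1 = (z ^ 2 + z + 1) - (z + u + 1) * (z - u) by ring]
    exact DV.ge_sub h7 (DV.ge_mul0 (DV.ge_add (DV.ge_add h6 hui) DV.ge_one) h8)
  apply odd_const C h2 (a ^ 2 + a + 1 - 2 * b * c - 2 * c ^ 2) (2 * a * b + 2 * b * c + c ^ 2 + b)
    (b ^ 2 + 2 * a * c + 4 * b * c + 5 * c ^ 2 + c)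
  · have := Int.even_mul_succ_self a
    obtain ⟨k, hk⟩ := this
    exact ⟨k - b * c - c ^ 2, by linear_combination hk⟩
  · convert h9 using 1
    rw [hu]; push_cast
    linear_combination (-2 * b * c - c ^ 2 * C.e - 2 * c ^ 2) * C.he
end
end Q14

namespace Q14

section
variable {F : Type} [Field F] [CharZero F]

lemma CF.tr_S (C : CF F) (P : Pt F) (h : C.tr P = 0) : C.tr (C.S P) = 0 := by
  have : C.tr (C.S P) = C.S (C.tr P) := by
    rw [C.tr_apply, C.tr_apply, map_add, map_add]
  rw [this, h, map_zero]

lemma CF.se2 (C : CF F) : C.s (C.e ^ 2) = 4 + 3 * C.e - 2 * C.e ^ 2 := by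
  rw [map_pow, C.hs]
  linear_combination C.e * C.he

lemma pts1 {e : F} (he : e ^ 3 - 2 * e ^ 2 - e + 1 = 0) : (-49 / 2 : F) ^ 2 = cc (-5 + 7 * e) := by
  unfold cc
  linear_combination (-343) * he

lemma pts2 {e : F} (he : e ^ 3 - 2 * e ^ 2 - e + 1 = 0) :
    (7 * (16 - 21 * e + 7 * e ^ 2) - 77 / 2) ^ 2 = cc (16 - 21 * e + 7 * e ^ 2) := by
  unfold cc
  grind

lemma e_ne {C : CF F} {a b c : ℚ} (h : b ≠ 0 ∨ c ≠ 0) : (a : F) + b * C.e + c * C.e ^ 2 ≠ 0 := by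
  intro h0
  have := C.coords (a := a) (b := b) (c := c) (a' := 0) (b' := 0) (c' := 0) (by simpa using h0)
  tauto

lemma tr1 (C : CF F) : C.tr (pt _ _ (pts1 C.he)) = 0 := by
  have s1 : C.s (-5 + 7 * C.e) = 9 + 7 * C.e - 7 * C.e ^ 2 := by
    simp only [map_add, map_neg, map_mul, map_ofNat, C.hs]; ring
  have s2 : C.s (9 + 7 * C.e - 7 * C.e ^ 2) = -5 - 14 * C.e + 7 * C.e ^ 2 := by
    rw [map_sub, map_mul, C.se2]
    simp only [map_add, map_neg, map_mul, map_ofNat, C.hs]; ring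
  have sy : C.s (-49 / 2) = -49 / 2 := by simp [map_ofNat]
  have h1 : (-49 / 2 : F) ^ 2 = cc (9 + 7 * C.e - 7 * C.e ^ 2) := by
    have := map_on C.s (pts1 C.he); rwa [s1, sy] at this
  have h2 : (-49 / 2 : F) ^ 2 = cc (-5 - 14 * C.e + 7 * C.e ^ 2) := by
    have := map_on C.s h1; rwa [s2, sy] at this
  have e1 : C.S (pt _ _ (pts1 C.he)) = pt _ _ h1 := by
    rw [C.S_pt]; exact pt_congr s1 sy
  have e2 : C.S (pt _ _ h1) = pt _ _ h2 := by
    rw [C.S_pt]; exact pt_congr s2 sy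
  rw [C.tr_apply, e1, e2, add_eq_zero_iff_eq_neg, pt_neg]
  apply pt_add 0
  · intro h
    refine e_ne (C := C) (a := -14) (b := 0) (c := 7) (by norm_num) ?_
    push_cast; linear_combination h
  · ring
  · ring
  · ring

lemma tr2 (C : CF F) : C.tr (pt _ _ (pts2 C.he)) = 0 := by
  have s1 : C.s (16 - 21 * C.e + 7 * C.e ^ 2) = 2 + 7 * C.e ^ 2 := by
    rw [map_add, map_mul, C.se2]
    simp only [map_sub, map_neg, map_mul, map_ofNat, C.hs]; ring
  have s2 : C.s (2 + 7 * C.e ^ 2) = 30 + 21 * C.e - 14 * C.e ^ 2 := by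
    rw [map_add, map_mul, C.se2]
    simp only [map_ofNat]; ring
  have sy : C.s (7 * (16 - 21 * C.e + 7 * C.e ^ 2) - 77 / 2) = 7 * (2 + 7 * C.e ^ 2) - 77 / 2 := by
    rw [map_sub, map_mul, s1]; simp [map_ofNat]
  have sy2 : C.s (7 * (2 + 7 * C.e ^ 2) - 77 / 2) = 7 * (30 + 21 * C.e - 14 * C.e ^ 2) - 77 / 2 := by
    rw [map_sub, map_mul, s2]; simp [map_ofNat]
  have h1 : (7 * (2 + 7 * C.e ^ 2) - 77 / 2) ^ 2 = cc (2 + 7 * C.e ^ 2) := by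
    have := map_on C.s (pts2 C.he); rwa [s1, sy] at this
  have h2 : (7 * (30 + 21 * C.e - 14 * C.e ^ 2) - 77 / 2) ^ 2 = cc (30 + 21 * C.e - 14 * C.e ^ 2) := by
    have := map_on C.s h1; rwa [s2, sy2] at this
  have e1 : C.S (pt _ _ (pts2 C.he)) = pt _ _ h1 := by
    rw [C.S_pt]; exact pt_congr s1 sy
  have e2 : C.S (pt _ _ h1) = pt _ _ h2 := by
    rw [C.S_pt]; exact pt_congr s2 sy2
  rw [C.tr_apply, e1, e2, add_eq_zero_iff_eq_neg, pt_neg]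
  apply pt_add 7
  · intro h
    refine e_ne (C := C) (a := 14) (b := -21) (c := 0) (by norm_num) ?_
    push_cast; linear_combination h
  · ring
  · ring
  · ring

theorem CF.six (C : CF F) {X Y : F} (h : Y ^ 2 = cc X) (hP : C.tr (pt X Y h) = 0) :
    X = -5 + 7 * C.e ∨ X = 9 + 7 * C.e - 7 * C.e ^ 2 ∨ X = -5 - 14 * C.e + 7 * C.e ^ 2 ∨
    X = 16 - 21 * C.e + 7 * C.e ^ 2 ∨ X = 2 + 7 * C.e ^ 2 ∨ X = 30 + 21 * C.e - 14 * C.e ^ 2 := by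
  obtain ⟨V, h2, -, hres⟩ := C.exists_V
  have hX := B_int' C h2 h hP
  have hie : V.ge 0 C.e := DV.cub_int _ C.he
  have key : ∀ (X0 Y0 : F) (h0 : Y0 ^ 2 = cc X0), C.tr (pt X0 Y0 h0) = 0 →
      V.ge 1 (X - X0) → X = X0 := fun X0 Y0 h0 hP0 hc => B_cong C h2 h h0 hP hP0 hc
  have s1 : C.s (-5 + 7 * C.e) = 9 + 7 * C.e - 7 * C.e ^ 2 := by
    simp only [map_add, map_neg, map_mul, map_ofNat, C.hs]; ring
  have s2 : C.s (9 + 7 * C.e - 7 * C.e ^ 2) = -5 - 14 * C.e + 7 * C.e ^ 2 := by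
    rw [map_sub, map_mul, C.se2]
    simp only [map_add, map_neg, map_mul, map_ofNat, C.hs]; ring
  have s3 : C.s (16 - 21 * C.e + 7 * C.e ^ 2) = 2 + 7 * C.e ^ 2 := by
    rw [map_add, map_mul, C.se2]
    simp only [map_sub, map_neg, map_mul, map_ofNat, C.hs]; ring
  have s4 : C.s (2 + 7 * C.e ^ 2) = 30 + 21 * C.e - 14 * C.e ^ 2 := by
    rw [map_add, map_mul, C.se2]
    simp only [map_ofNat]; ring
  have k1 := key _ _ (pts1 C.he) (tr1 C)
  have k2 := key _ _ (map_on C.s (pts1 C.he)) (C.tr_S _ (tr1 C))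
  have k3 := key _ _ (map_on C.s (map_on C.s (pts1 C.he))) (C.tr_S _ (C.tr_S _ (tr1 C)))
  have k4 := key _ _ (pts2 C.he) (tr2 C)
  have k5 := key _ _ (map_on C.s (pts2 C.he)) (C.tr_S _ (tr2 C))
  have k6 := key _ _ (map_on C.s (map_on C.s (pts2 C.he))) (C.tr_S _ (C.tr_S _ (tr2 C)))
  rw [s1] at k2 k3
  rw [s2] at k3
  rw [s3] at k5 k6
  rw [s4] at k6
  have step : ∀ (a b c a' b' c' : ℤ), V.ge 1 (X - (a + b * C.e + c * C.e ^ 2)) →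
      V.ge 1 (X - ((a + 2 * a' : ℤ) + (b + 2 * b' : ℤ) * C.e + (c + 2 * c' : ℤ) * C.e ^ 2)) := by
    intro a b c a' b' c' hh
    rw [show X - (((a + 2 * a' : ℤ) : F) + ((b + 2 * b' : ℤ) : F) * C.e + ((c + 2 * c' : ℤ) : F) * C.e ^ 2)
      = (X - (a + b * C.e + c * C.e ^ 2)) - 2 * (a' + b' * C.e + c' * C.e ^ 2) by push_cast; ring]
    exact DV.ge_sub hh (v_even h2 (DV.ge_add (DV.ge_add (DV.ge_int _) (DV.ge_mul0 (DV.ge_int _) hie))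
      (DV.ge_mul0 (DV.ge_int _) (DV.ge_pow hie 2))))
  obtain ⟨a, b, c, ha, hb, hc, hh⟩ := hres X hX
  rcases hb with rfl | rfl <;> rcases hc with rfl | rfl
  · exfalso
    apply no_res C h2 hres h hX
    rcases ha with rfl | rfl
    · have : V.ge 1 X := by simpa using hh
      rw [mul_comm]; exact DV.ge_mul0 (DV.ge_add hX DV.ge_one) this
    · have : V.ge 1 (X - 1) := by simpa using hh
      rw [show X * (X + 1) = X * (X - 1) + 2 * X by ring]
      exact DV.ge_add (DV.ge_mul0 hX this) (v_even h2 hX)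
  · rcases ha with rfl | rfl
    · have := k5 (by convert step 0 0 1 1 0 3 hh using 2; push_cast; ring)
      exact Or.inr (Or.inr (Or.inr (Or.inr (Or.inl this))))
    · have := k3 (by convert step 1 0 1 (-3) (-7) 3 hh using 2; push_cast; ring)
      exact Or.inr (Or.inr (Or.inl this))
  · rcases ha with rfl | rfl
    · have := k6 (by convert step 0 1 0 15 10 (-7) hh using 2; push_cast; ring)
      exact Or.inr (Or.inr (Or.inr (Or.inr (Or.inr (this)))))
    · have := k1 (by convert step 1 1 0 (-3) 3 0 hh using 2; push_cast; ring)
      exact Or.inl this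
  · rcases ha with rfl | rfl
    · have := k4 (by convert step 0 1 1 8 (-11) 3 hh using 2; push_cast; ring)
      exact Or.inr (Or.inr (Or.inr (Or.inl this)))
    · have := k2 (by convert step 1 1 1 4 3 (-4) hh using 2; push_cast; ring)
      exact Or.inr (Or.inl this)
end
end Q14

namespace Q14
section
def GG {K : Type} [Field K] (s n : K) : K := n ^ 2 - n * s + s ^ 2 - n - s + 1
def WW {K : Type} [Field K] (e s n Z : K) : K :=
  (n - 1 + e * (1 - s)) ^ 2 * ((-3 - 3 * e + 2 * e ^ 2) * ((n * s - 2 * n + s) - e * (s ^ 2 - 2 * n - s + 2))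
    + GG s n * (Z + e - 1))

lemma ww1 {K : Type} [Field K] {e : K} (he : e ^ 3 - 2 * e ^ 2 - e + 1 = 0) (s n : K) :
    WW e s n (0 + 0 * e + 0 * e ^ 2) = (-2 * n - n ^ 2 + 5 * n ^ 3 - n ^ 4 + 3 * s + 2 * s * n - 6 * s * n ^ 2 - 2 * s * n ^ 3 - 4 * s ^ 2 + 3 * s ^ 2 * n + 4 * s ^ 2 * n ^ 2 + s ^ 3 - 2 * s ^ 3 * n)
      + (2 - 2 * n + 3 * n ^ 2 - n ^ 3 + n ^ 4 - 5 * s - 3 * s * n ^ 2 - 2 * s * n ^ 3 + 6 * s ^ 2 + 3 * s ^ 2 * n + 3 * s ^ 2 * n ^ 2 - 4 * s ^ 3 - 2 * s ^ 3 * n + s ^ 4) * e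
      + (-1 + n - n ^ 2 + 2 * s + s * n ^ 2 - 2 * s ^ 2 - s ^ 2 * n + s ^ 3) * e ^ 2 := by
  unfold WW GG
  grind

lemma fin1 {F : Type} [Field F] [CharZero F] (C : CF F) {s n v : ℚ} (hn : n ≠ 0) (h1 : 1 - s + n ≠ 0)
    (hG : GG s n ≠ 0) (h : (v : F) ^ 2 = 4 * GG (s : F) n * WW C.e s n (0 + 0 * C.e + 0 * C.e ^ 2)) :
    False := by
  rw [ww1 C.he] at h
  have hc := C.coords (a := v ^ 2) (b := 0) (c := 0) (a' := 4 * GG s n * (-2 * n - n ^ 2 + 5 * n ^ 3 - n ^ 4 + 3 * s + 2 * s * n - 6 * s * n ^ 2 - 2 * s * n ^ 3 - 4 * s ^ 2 + 3 * s ^ 2 * n + 4 * s ^ 2 * n ^ 2 + s ^ 3 - 2 * s ^ 3 * n))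
    (b' := 4 * GG s n * (2 - 2 * n + 3 * n ^ 2 - n ^ 3 + n ^ 4 - 5 * s - 3 * s * n ^ 2 - 2 * s * n ^ 3 + 6 * s ^ 2 + 3 * s ^ 2 * n + 3 * s ^ 2 * n ^ 2 - 4 * s ^ 3 - 2 * s ^ 3 * n + s ^ 4))
    (c' := 4 * GG s n * (-1 + n - n ^ 2 + 2 * s + s * n ^ 2 - 2 * s ^ 2 - s ^ 2 * n + s ^ 3)) (by
      unfold GG at *; push_cast; linear_combination h)
  obtain ⟨-, d1, d2⟩ := hc
  replace d1 := (mul_eq_zero.1 d1.symm).resolve_left (by simpa using hG)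
  replace d2 := (mul_eq_zero.1 d2.symm).resolve_left (by simpa using hG)
  obtain rfl : s = 1 := by
    rcases mul_eq_zero.1 (show (s - 1) * GG s n = 0 by unfold GG; linear_combination d2) with h | h
    · linarith
    · exact (hG h).elim
  have h3 : n * (n - 1) ^ 3 = 0 := by linear_combination d1
  have : n = 1 := by
    rcases mul_eq_zero.1 h3 with h | h
    · exact (hn h).elim
    · linarith [pow_eq_zero_iff (three_ne_zero) |>.1 h]
  subst this
  exact hG (by unfold GG; norm_num)

lemma ww2 {K : Type} [Field K] {e : K} (he : e ^ 3 - 2 * e ^ 2 - e + 1 = 0) (s n : K) :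
    WW e s n (2 - 1 * e + 0 * e ^ 2) = (3 - 9 * n + 8 * n ^ 2 - n ^ 3 + n ^ 4 - 2 * s + 5 * s * n - 6 * s * n ^ 2 - 4 * s * n ^ 3 + 2 * s ^ 2 + 7 * s ^ 2 * n ^ 2 - 2 * s ^ 3 - 3 * s ^ 3 * n + s ^ 4)
      + (-4 + 10 * n - 10 * n ^ 2 + 6 * n ^ 3 + 7 * s - 10 * s * n + 2 * s * n ^ 2 - 5 * s * n ^ 3 - 7 * s ^ 2 + 8 * s ^ 2 * n + 5 * s ^ 2 * n ^ 2 + 3 * s ^ 3 - 5 * s ^ 3 * n) * e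
      + (1 - 3 * n + 3 * n ^ 2 - 2 * n ^ 3 - 2 * s + 4 * s * n - s * n ^ 2 + 2 * s * n ^ 3 + 2 * s ^ 2 - 3 * s ^ 2 * n - 2 * s ^ 2 * n ^ 2 - s ^ 3 + 2 * s ^ 3 * n) * e ^ 2 := by
  unfold WW GG
  grind

lemma fin2 {F : Type} [Field F] [CharZero F] (C : CF F) {s n v : ℚ} (hn : n ≠ 0) (h1 : 1 - s + n ≠ 0)
    (hG : GG s n ≠ 0) (h : (v : F) ^ 2 = 4 * GG (s : F) n * WW C.e s n (2 - 1 * C.e + 0 * C.e ^ 2)) :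
    s = 2 ∧ n = 1 / 2 := by
  rw [ww2 C.he] at h
  have hc := C.coords (a := v ^ 2) (b := 0) (c := 0) (a' := 4 * GG s n * (3 - 9 * n + 8 * n ^ 2 - n ^ 3 + n ^ 4 - 2 * s + 5 * s * n - 6 * s * n ^ 2 - 4 * s * n ^ 3 + 2 * s ^ 2 + 7 * s ^ 2 * n ^ 2 - 2 * s ^ 3 - 3 * s ^ 3 * n + s ^ 4))
    (b' := 4 * GG s n * (-4 + 10 * n - 10 * n ^ 2 + 6 * n ^ 3 + 7 * s - 10 * s * n + 2 * s * n ^ 2 - 5 * s * n ^ 3 - 7 * s ^ 2 + 8 * s ^ 2 * n + 5 * s ^ 2 * n ^ 2 + 3 * s ^ 3 - 5 * s ^ 3 * n))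
    (c' := 4 * GG s n * (1 - 3 * n + 3 * n ^ 2 - 2 * n ^ 3 - 2 * s + 4 * s * n - s * n ^ 2 + 2 * s * n ^ 3 + 2 * s ^ 2 - 3 * s ^ 2 * n - 2 * s ^ 2 * n ^ 2 - s ^ 3 + 2 * s ^ 3 * n)) (by
      unfold GG at *; push_cast; linear_combination h)
  obtain ⟨-, d1, d2⟩ := hc
  replace d1 := (mul_eq_zero.1 d1.symm).resolve_left (by simpa using hG)
  replace d2 := (mul_eq_zero.1 d2.symm).resolve_left (by simpa using hG)
  rcases mul_eq_zero.1 (show (2 - s) * (1 - n) * GG s n = 0 by unfold GG; linear_combination -d1 - 2 * d2) with h | h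
  · rcases mul_eq_zero.1 h with h | h
    · obtain rfl : s = 2 := by linarith
      rcases mul_eq_zero.1 (show (2 * n - 1) * GG 2 n = 0 by unfold GG; linear_combination d2) with h | h
      · exact ⟨rfl, by linarith⟩
      · exact (hG h).elim
    · exfalso
      obtain rfl : n = 1 := by linarith
      have h3 : (s - 1) ^ 3 = 0 := by linear_combination d2
      have : s = 1 := by linarith [pow_eq_zero_iff (three_ne_zero) |>.1 h3]
      subst this
      exact hG (by unfold GG; norm_num)
  · exact (hG h).elim

lemma ww3 {K : Type} [Field K] {e : K} (he : e ^ 3 - 2 * e ^ 2 - e + 1 = 0) (s n : K) :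
    WW e s n (2 + 1 * e - 1 * e ^ 2) = (1 - 5 * n + 4 * n ^ 2 + n ^ 3 + n ^ 4 + 2 * s + s * n - 4 * s * n ^ 2 - 6 * s * n ^ 3 - 2 * s ^ 2 + 2 * s ^ 2 * n + 9 * s ^ 2 * n ^ 2 - 5 * s ^ 3 * n + s ^ 4)
      + (1 - n + 3 * n ^ 2 - 2 * n ^ 3 + 2 * n ^ 4 - 2 * s - 3 * s * n - 5 * s * n ^ 3 + 3 * s ^ 2 + 3 * s ^ 2 * n + 6 * s ^ 2 * n ^ 2 - 2 * s ^ 3 - 4 * s ^ 3 * n + s ^ 4) * e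
      + (-1 + n - 2 * n ^ 2 + n ^ 3 - n ^ 4 + 2 * s + 2 * s * n + 3 * s * n ^ 3 - 3 * s ^ 2 - 2 * s ^ 2 * n - 4 * s ^ 2 * n ^ 2 + 2 * s ^ 3 + 3 * s ^ 3 * n - s ^ 4) * e ^ 2 := by
  unfold WW GG
  grind

lemma fin3 {F : Type} [Field F] [CharZero F] (C : CF F) {s n v : ℚ} (hn : n ≠ 0) (h1 : 1 - s + n ≠ 0)
    (hG : GG s n ≠ 0) (h : (v : F) ^ 2 = 4 * GG (s : F) n * WW C.e s n (2 + 1 * C.e - 1 * C.e ^ 2)) :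
    False := by
  rw [ww3 C.he] at h
  have hc := C.coords (a := v ^ 2) (b := 0) (c := 0) (a' := 4 * GG s n * (1 - 5 * n + 4 * n ^ 2 + n ^ 3 + n ^ 4 + 2 * s + s * n - 4 * s * n ^ 2 - 6 * s * n ^ 3 - 2 * s ^ 2 + 2 * s ^ 2 * n + 9 * s ^ 2 * n ^ 2 - 5 * s ^ 3 * n + s ^ 4))
    (b' := 4 * GG s n * (1 - n + 3 * n ^ 2 - 2 * n ^ 3 + 2 * n ^ 4 - 2 * s - 3 * s * n - 5 * s * n ^ 3 + 3 * s ^ 2 + 3 * s ^ 2 * n + 6 * s ^ 2 * n ^ 2 - 2 * s ^ 3 - 4 * s ^ 3 * n + s ^ 4))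
    (c' := 4 * GG s n * (-1 + n - 2 * n ^ 2 + n ^ 3 - n ^ 4 + 2 * s + 2 * s * n + 3 * s * n ^ 3 - 3 * s ^ 2 - 2 * s ^ 2 * n - 4 * s ^ 2 * n ^ 2 + 2 * s ^ 3 + 3 * s ^ 3 * n - s ^ 4)) (by
      unfold GG at *; push_cast; linear_combination h)
  obtain ⟨-, d1, d2⟩ := hc
  replace d1 := (mul_eq_zero.1 d1.symm).resolve_left (by simpa using hG)
  replace d2 := (mul_eq_zero.1 d2.symm).resolve_left (by simpa using hG)
  obtain rfl : n = s := by
    rcases mul_eq_zero.1 (show n * (n - s) * GG s n = 0 by unfold GG; linear_combination d1 + d2) with h | h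
    · rcases mul_eq_zero.1 h with h | h
      · exact (hn h).elim
      · linarith
    · exact (hG h).elim
  have h3 : (n - 1) ^ 3 = 0 := by linear_combination -d1
  have : n = 1 := by linarith [pow_eq_zero_iff (three_ne_zero) |>.1 h3]
  subst this
  exact hG (by unfold GG; norm_num)

lemma ww4 {K : Type} [Field K] {e : K} (he : e ^ 3 - 2 * e ^ 2 - e + 1 = 0) (s n : K) :
    WW e s n (-1 - 2 * e + 1 * e ^ 2) = (1 - 3 * n - n ^ 2 + 6 * n ^ 3 - 2 * n ^ 4 + 5 * s * n - 9 * s * n ^ 2 + s * n ^ 3 - s ^ 2 + 3 * s ^ 2 * n + s ^ 2 * n ^ 2 - s ^ 3)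
      + (-1 + 5 * n - 6 * n ^ 2 + 5 * n ^ 3 - n ^ 4 - 3 * s * n - 3 * s * n ^ 2 + 6 * s ^ 2 * n - s ^ 3 - s ^ 3 * n) * e
      + (-2 * n + 3 * n ^ 2 - 3 * n ^ 3 + n ^ 4 + s + s * n + 2 * s * n ^ 2 - s * n ^ 3 - s ^ 2 - 3 * s ^ 2 * n + s ^ 2 * n ^ 2 + s ^ 3) * e ^ 2 := by
  unfold WW GG
  grind

lemma fin4 {F : Type} [Field F] [CharZero F] (C : CF F) {s n v : ℚ} (hn : n ≠ 0) (h1 : 1 - s + n ≠ 0)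
    (hG : GG s n ≠ 0) (h : (v : F) ^ 2 = 4 * GG (s : F) n * WW C.e s n (-1 - 2 * C.e + 1 * C.e ^ 2)) :
    False := by
  rw [ww4 C.he] at h
  have hc := C.coords (a := v ^ 2) (b := 0) (c := 0) (a' := 4 * GG s n * (1 - 3 * n - n ^ 2 + 6 * n ^ 3 - 2 * n ^ 4 + 5 * s * n - 9 * s * n ^ 2 + s * n ^ 3 - s ^ 2 + 3 * s ^ 2 * n + s ^ 2 * n ^ 2 - s ^ 3))
    (b' := 4 * GG s n * (-1 + 5 * n - 6 * n ^ 2 + 5 * n ^ 3 - n ^ 4 - 3 * s * n - 3 * s * n ^ 2 + 6 * s ^ 2 * n - s ^ 3 - s ^ 3 * n))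
    (c' := 4 * GG s n * (-2 * n + 3 * n ^ 2 - 3 * n ^ 3 + n ^ 4 + s + s * n + 2 * s * n ^ 2 - s * n ^ 3 - s ^ 2 - 3 * s ^ 2 * n + s ^ 2 * n ^ 2 + s ^ 3)) (by
      unfold GG at *; push_cast; linear_combination h)
  obtain ⟨-, d1, d2⟩ := hc
  replace d1 := (mul_eq_zero.1 d1.symm).resolve_left (by simpa using hG)
  replace d2 := (mul_eq_zero.1 d2.symm).resolve_left (by simpa using hG)
  obtain rfl : n = 1 := by
    rcases mul_eq_zero.1 (show (1 - n) * (1 - s + n) * GG s n = 0 by unfold GG; linear_combination -d1 - 2 * d2) with h | h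
    · rcases mul_eq_zero.1 h with h | h
      · linarith
      · exact (h1 h).elim
    · exact (hG h).elim
  have h3 : (s - 1) ^ 3 = 0 := by linear_combination d2
  have : s = 1 := by linarith [pow_eq_zero_iff (three_ne_zero) |>.1 h3]
  subst this
  exact hG (by unfold GG; norm_num)

lemma ww5 {K : Type} [Field K] {e : K} (he : e ^ 3 - 2 * e ^ 2 - e + 1 = 0) (s n : K) :
    WW e s n (6 + 4 * e - 3 * e ^ 2) = (2 - 10 * n + 13 * n ^ 2 - 7 * n ^ 3 + 5 * n ^ 4 + 3 * s - 2 * s * n + 2 * s * n ^ 2 - 14 * s * n ^ 3 - 2 * s ^ 2 - s ^ 2 * n + 18 * s ^ 2 * n ^ 2 + s ^ 3 - 10 * s ^ 3 * n + 2 * s ^ 4)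
      + (1 - 3 * n + 8 * n ^ 2 - 7 * n ^ 3 + 5 * n ^ 4 - 7 * s * n + 5 * s * n ^ 2 - 12 * s * n ^ 3 + 2 * s ^ 2 + 2 * s ^ 2 * n + 14 * s ^ 2 * n ^ 2 - s ^ 3 - 9 * s ^ 3 * n + 2 * s ^ 4) * e
      + (-1 + 3 * n - 6 * n ^ 2 + 5 * n ^ 3 - 3 * n ^ 4 + 4 * s * n - 4 * s * n ^ 2 + 7 * s * n ^ 3 - s ^ 2 - 8 * s ^ 2 * n ^ 2 + 5 * s ^ 3 * n - s ^ 4) * e ^ 2 := by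
  unfold WW GG
  grind

lemma fin5 {F : Type} [Field F] [CharZero F] (C : CF F) {s n v : ℚ} (hn : n ≠ 0) (h1 : 1 - s + n ≠ 0)
    (hG : GG s n ≠ 0) (h : (v : F) ^ 2 = 4 * GG (s : F) n * WW C.e s n (6 + 4 * C.e - 3 * C.e ^ 2)) :
    s = -2 ∧ n = -1 := by
  rw [ww5 C.he] at h
  have hc := C.coords (a := v ^ 2) (b := 0) (c := 0) (a' := 4 * GG s n * (2 - 10 * n + 13 * n ^ 2 - 7 * n ^ 3 + 5 * n ^ 4 + 3 * s - 2 * s * n + 2 * s * n ^ 2 - 14 * s * n ^ 3 - 2 * s ^ 2 - s ^ 2 * n + 18 * s ^ 2 * n ^ 2 + s ^ 3 - 10 * s ^ 3 * n + 2 * s ^ 4))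
    (b' := 4 * GG s n * (1 - 3 * n + 8 * n ^ 2 - 7 * n ^ 3 + 5 * n ^ 4 - 7 * s * n + 5 * s * n ^ 2 - 12 * s * n ^ 3 + 2 * s ^ 2 + 2 * s ^ 2 * n + 14 * s ^ 2 * n ^ 2 - s ^ 3 - 9 * s ^ 3 * n + 2 * s ^ 4))
    (c' := 4 * GG s n * (-1 + 3 * n - 6 * n ^ 2 + 5 * n ^ 3 - 3 * n ^ 4 + 4 * s * n - 4 * s * n ^ 2 + 7 * s * n ^ 3 - s ^ 2 - 8 * s ^ 2 * n ^ 2 + 5 * s ^ 3 * n - s ^ 4)) (by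
      unfold GG at *; push_cast; linear_combination h)
  obtain ⟨-, d1, d2⟩ := hc
  replace d1 := (mul_eq_zero.1 d1.symm).resolve_left (by simpa using hG)
  replace d2 := (mul_eq_zero.1 d2.symm).resolve_left (by simpa using hG)
  rcases mul_eq_zero.1 (show (2 * n - s) * (n - s) * GG s n = 0 by unfold GG; linear_combination d1 + d2) with h | h
  · rcases mul_eq_zero.1 h with h | h
    · obtain rfl : s = 2 * n := by linarith
      rcases mul_eq_zero.1 (show ((n - 1) * (n + 1)) * GG (2 * n) n = 0 by unfold GG; linear_combination -d1) with h | h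
      · rcases mul_eq_zero.1 h with h | h
        · exact (h1 (by linarith)).elim
        · constructor <;> linarith
      · exact (hG h).elim
    · exfalso
      obtain rfl : n = s := by linarith
      have h3 : (n - 1) ^ 3 = 0 := by linear_combination d2
      have : n = 1 := by linarith [pow_eq_zero_iff (three_ne_zero) |>.1 h3]
      subst this
      exact hG (by unfold GG; norm_num)
  · exact (hG h).elim

lemma ww6 {K : Type} [Field K] {e : K} (he : e ^ 3 - 2 * e ^ 2 - e + 1 = 0) (s n : K) :
    WW e s n (1 + 0 * e + 0 * e ^ 2) = (1 - 5 * n + 3 * n ^ 2 + 2 * n ^ 3 + 2 * s + 3 * s * n - 5 * s * n ^ 2 - 3 * s * n ^ 3 - 3 * s ^ 2 + s ^ 2 * n + 5 * s ^ 2 * n ^ 2 + s ^ 3 - 2 * s ^ 3 * n)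
      + (2 * n - n ^ 2 + n ^ 3 + n ^ 4 - s - 4 * s * n - s * n ^ 2 - 4 * s * n ^ 3 + 2 * s ^ 2 + 5 * s ^ 2 * n + 5 * s ^ 2 * n ^ 2 - 2 * s ^ 3 - 4 * s ^ 3 * n + s ^ 4) * e
      + (-s + s * n - s * n ^ 2 + 2 * s ^ 2 + s ^ 2 * n ^ 2 - 2 * s ^ 3 - s ^ 3 * n + s ^ 4) * e ^ 2 := by
  unfold WW GG
  grind

lemma fin6 {F : Type} [Field F] [CharZero F] (C : CF F) {s n v : ℚ} (hn : n ≠ 0) (h1 : 1 - s + n ≠ 0)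
    (hG : GG s n ≠ 0) (h : (v : F) ^ 2 = 4 * GG (s : F) n * WW C.e s n (1 + 0 * C.e + 0 * C.e ^ 2)) :
    s = 0 ∧ n = -2 := by
  rw [ww6 C.he] at h
  have hc := C.coords (a := v ^ 2) (b := 0) (c := 0) (a' := 4 * GG s n * (1 - 5 * n + 3 * n ^ 2 + 2 * n ^ 3 + 2 * s + 3 * s * n - 5 * s * n ^ 2 - 3 * s * n ^ 3 - 3 * s ^ 2 + s ^ 2 * n + 5 * s ^ 2 * n ^ 2 + s ^ 3 - 2 * s ^ 3 * n))
    (b' := 4 * GG s n * (2 * n - n ^ 2 + n ^ 3 + n ^ 4 - s - 4 * s * n - s * n ^ 2 - 4 * s * n ^ 3 + 2 * s ^ 2 + 5 * s ^ 2 * n + 5 * s ^ 2 * n ^ 2 - 2 * s ^ 3 - 4 * s ^ 3 * n + s ^ 4))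
    (c' := 4 * GG s n * (-s + s * n - s * n ^ 2 + 2 * s ^ 2 + s ^ 2 * n ^ 2 - 2 * s ^ 3 - s ^ 3 * n + s ^ 4)) (by
      unfold GG at *; push_cast; linear_combination h)
  obtain ⟨-, d1, d2⟩ := hc
  replace d1 := (mul_eq_zero.1 d1.symm).resolve_left (by simpa using hG)
  replace d2 := (mul_eq_zero.1 d2.symm).resolve_left (by simpa using hG)
  rcases mul_eq_zero.1 (show s * (s - 1) * GG s n = 0 by unfold GG; linear_combination d2) with h | h
  · rcases mul_eq_zero.1 h with h | h
    · subst h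
      rcases mul_eq_zero.1 (show (n * (n + 2)) * GG 0 n = 0 by unfold GG; linear_combination d1) with h | h
      · rcases mul_eq_zero.1 h with h | h
        · exact (hn h).elim
        · exact ⟨rfl, by linarith⟩
      · exact (hG h).elim
    · exfalso
      obtain rfl : s = 1 := by linarith
      have h3 : n * (n - 1) ^ 3 = 0 := by linear_combination d1
      have : n = 1 := by
        rcases mul_eq_zero.1 h3 with h | h
        · exact (hn h).elim
        · linarith [pow_eq_zero_iff (three_ne_zero) |>.1 h]
      subst this
      exact hG (by unfold GG; norm_num)
  · exact (hG h).elim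
end
end Q14

namespace Q14
section
structure BG (F L : Type) [Field F] [CharZero F] [Field L] [CharZero L] where
  C : CF F
  i : F →+* L
  st : L →+* L
  ct : L →+* L
  hsi : ∀ z, st (i z) = i (C.s z)
  hci : ∀ z, ct (i z) = i z
  hfix : ∀ z, ct z = z → ∃ w, i w = z
  hcc : ∀ z, ct (ct z) = z
  hcs : ∀ z, st (ct z) = ct (st z)

variable {F L : Type} [Field F] [CharZero F] [Field L] [CharZero L]

lemma mp_comm {A B D E : Type} [Field A] [CharZero A] [Field B] [CharZero B] [Field D] [CharZero D]
    [Field E] [CharZero E] (f : A →+* B) (g : B →+* D) (f' : A →+* E) (g' : E →+* D)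
    (h : ∀ z, g (f z) = g' (f' z)) (P : Pt A) : mp g (mp f P) = mp g' (mp f' P) := by
  rcases pt_cases P with rfl | ⟨x, y, hh, rfl⟩
  · simp
  · rw [mp_pt, mp_pt, mp_pt, mp_pt]; exact pt_congr (h x) (h y)

/-- elements fixed by everything are rational -/
lemma BG.rat (B : BG F L) (z : L) (h1 : B.ct z = z) (h2 : B.st z = z) : ∃ q : ℚ, z = q := by
  obtain ⟨w, rfl⟩ := B.hfix z h1
  rw [B.hsi] at h2
  have h3 := B.i.injective h2
  obtain ⟨a, b, c, rfl⟩ := B.C.rep w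
  have := B.C.coords (a := a + 2 * b + 4 * c) (b := b + 3 * c) (c := -b - 2 * c) (a' := a) (b' := b) (c' := c) (by
    rw [← h3]
    simp only [map_add, map_mul, map_ratCast, B.C.se2, B.C.hs]
    push_cast; ring)
  obtain ⟨-, hb, hc⟩ := this
  have c0 : c = 0 := by linarith
  have b0 : b = 0 := by linarith
  subst c0 b0
  exact ⟨a, by simp⟩

lemma phi_on {e x y : L} (he : e ^ 3 - 2 * e ^ 2 - e + 1 = 0) (hxy : y ^ 2 = gg x * hh x)
    (hg : gg x ≠ 0) : (49 * y / (2 * gg x ^ 2)) ^ 2 = cc (xi e x) := by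
  have a1 := xi_sum he rfl rfl hg
  have a2 := xi_pairs he rfl rfl hg
  have a3 := xi_prod he rfl rfl hg
  have : cc (xi e x) = 2401 * hh x / (4 * gg x ^ 3) := by
    unfold cc
    linear_combination (xi e x) ^ 2 * a1 - (xi e x) * a2 + a3
  rw [this, div_pow, mul_pow, hxy]
  field_simp
  ring

lemma xi_map (f : L →+* L) (e x : L) : f (xi e x) = xi (f e) (f x) := by
  unfold xi gg
  simp only [map_add, map_sub, map_mul, map_div₀, map_pow, map_neg, map_ofNat, map_one]

lemma gg_map (f : L →+* L) (x : L) : f (gg x) = gg (f x) := by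
  unfold gg
  simp only [map_add, map_sub, map_pow, map_one]

lemma xi_diff {e x x' : L} (hg : gg x ≠ 0) (hg' : gg x' ≠ 0) :
    (xi e x - xi e x') * (gg x * gg x') =
    -(-14 - 21 * e + 14 * e ^ 2) * (x - x') * (x * x' - 1 + e * (1 - (x + x'))) := by
  unfold xi
  field_simp
  unfold gg
  ring

lemma xi_add {e x x' : L} (hg : gg x ≠ 0) (hg' : gg x' ≠ 0) :
    (xi e x + xi e x' - 14 * e + 10) * (gg x * gg x') = (-14 - 21 * e + 14 * e ^ 2) *
    ((x * x' * (x + x') - 2 * (x * x') + (x + x')) - e * ((x + x') ^ 2 - 2 * (x * x') - (x + x') + 2)) := by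
  unfold xi
  field_simp
  unfold gg
  ring

/-- the trace of `φ` vanishes -/
lemma BG.tr_phi (B : BG F L) {x y : L} (hsx : B.st x = x) (hsy : B.st y = y)
    (hg : gg x ≠ 0) (hP : (49 * y / (2 * gg x ^ 2)) ^ 2 = cc (xi (B.i B.C.e) x)) :
    pt _ _ hP + mp B.st (pt _ _ hP) + mp B.st (mp B.st (pt _ _ hP)) = 0 := by
  have he : (B.i B.C.e) ^ 3 - 2 * (B.i B.C.e) ^ 2 - (B.i B.C.e) + 1 = 0 := by
    have := congrArg B.i B.C.he
    simpa [map_ofNat] using this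
  have se : B.st (B.i B.C.e) = 2 + (B.i B.C.e) - (B.i B.C.e) ^ 2 := by
    rw [B.hsi, B.C.hs]; simp [map_ofNat]
  have sse : B.st (2 + (B.i B.C.e) - (B.i B.C.e) ^ 2) = (B.i B.C.e) ^ 2 - 2 * (B.i B.C.e) := by
    rw [map_sub, map_add, map_pow, se, map_ofNat]
    generalize B.i B.C.e = e at he
    grind
  generalize B.i B.C.e = e at *
  have sg : B.st (49 * y / (2 * gg x ^ 2)) = 49 * y / (2 * gg x ^ 2) := by
    simp only [map_div₀, map_mul, map_pow, map_ofNat, gg_map, hsx, hsy]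
  have s1 : B.st (xi e x) = xi (2 + e - e ^ 2) x := by rw [xi_map, se, hsx]
  have s2 : B.st (xi (2 + e - e ^ 2) x) = xi (e ^ 2 - 2 * e) x := by rw [xi_map, sse, hsx]
  have a1 := xi_sum he rfl rfl hg
  have a2 := xi_pairs he rfl rfl hg
  generalize hX : xi e x = X at *
  generalize hX1 : xi (2 + e - e ^ 2) x = X1 at *
  generalize hX2 : xi (e ^ 2 - 2 * e) x = X2 at *
  generalize 49 * y / (2 * gg x ^ 2) = Y at *
  have hP1 : Y ^ 2 = cc X1 := by have := map_on B.st hP; rwa [s1, sg] at this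
  have hP2 : Y ^ 2 = cc X2 := by have := map_on B.st hP1; rwa [s2, sg] at this
  have e1 : mp B.st (pt X Y hP) = pt X1 Y hP1 := by rw [mp_pt]; exact pt_congr s1 sg
  have e2 : mp B.st (pt X1 Y hP1) = pt X2 Y hP2 := by rw [mp_pt]; exact pt_congr s2 sg
  rw [e1, e2, add_eq_zero_iff_eq_neg, pt_neg]
  apply pt_add 0
  · intro h
    have h12 : X1 = X2 := by rw [← s1, ← s2, h]
    rw [← h12, ← h] at a1 a2
    have : X = -1 / 3 := by linear_combination a1 / 3
    rw [this] at a2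
    norm_num at a2
  · ring
  · linear_combination a1
  · ring
end
end Q14

namespace Q14
section
variable {F L : Type} [Field F] [CharZero F] [Field L] [CharZero L]

/-- the algebraic identity at the end -/
lemma key_id {e x x' y y' l XR v k1 ℓ g g' S : L} (hk0 : k1 ≠ 0) (hℓ : ℓ ≠ 0)
    (hg : g ≠ 0) (hg' : g' ≠ 0) (hd : x - x' ≠ 0) {X X' : L}
    (hX : (X - X') * (g * g') = -k1 * (x - x') * ℓ)
    (hS : (X + X' - 14 * e + 10) * (g * g') = k1 * S)
    (hl : l * (X - X') = 49 * y / (2 * g ^ 2) - 49 * y' / (2 * g' ^ 2))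
    (hR : XR = l ^ 2 - 1 - X - X')
    (hv : v * (x - x') = y * g' ^ 2 - y' * g ^ 2) :
    2401 * v ^ 2 = 4 * (g * g') * (ℓ ^ 2 * (k1 ^ 3 * S + (g * g') * (k1 ^ 2 * (XR + 14 * e - 9)))) := by
  have h1 : l * (2 * g * g' * k1 * ℓ) = - 49 * v := by
    apply mul_left_cancel₀ hd
    have h2 : 2 * (g * g') ^ 2 * (l * (X - X')) = 49 * (y * g' ^ 2 - y' * g ^ 2) := by
      rw [hl]; field_simp
    rw [← hv] at h2
    linear_combination -h2 + 2 * (g * g') * l * hX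
  have h3 : 2401 * v ^ 2 = 4 * (g * g') ^ 2 * k1 ^ 2 * ℓ ^ 2 * l ^ 2 := by
    linear_combination (-(l * (2 * g * g' * k1 * ℓ)) + 49 * v) * h1
  rw [h3, hR]
  linear_combination (4 * (g * g') * ℓ ^ 2 * k1 ^ 2) * hS

lemma R_fix (B : BG F L) {X Y X' Y' : L} {h : Y ^ 2 = cc X} {h' : Y' ^ 2 = cc X'}
    (hX : B.ct X = X') (hY : B.ct Y = Y')
    (ht : pt X Y h + mp B.st (pt X Y h) + mp B.st (mp B.st (pt X Y h)) = 0)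
    {x y : L} {h3 : y ^ 2 = cc x} (hR : pt X Y h + pt X' Y' h' = pt x y h3) :
    ∃ w, x = B.i w ∧ (
    w = -5 + 7 * B.C.e ∨ w = 9 + 7 * B.C.e - 7 * B.C.e ^ 2 ∨ w = -5 - 14 * B.C.e + 7 * B.C.e ^ 2 ∨
    w = 16 - 21 * B.C.e + 7 * B.C.e ^ 2 ∨ w = 2 + 7 * B.C.e ^ 2 ∨ w = 30 + 21 * B.C.e - 14 * B.C.e ^ 2) := by
  have e1 : mp B.ct (pt X Y h) = pt X' Y' h' := by rw [mp_pt]; exact pt_congr hX hY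
  have e2 : mp B.ct (pt X' Y' h') = pt X Y h := by
    rw [mp_pt]; apply pt_congr
    · rw [← hX, B.hcc]
    · rw [← hY, B.hcc]
  have e3 : mp B.ct (pt x y h3) = pt x y h3 := by
    rw [← hR, map_add, e1, e2, add_comm]
  have e4 := e3
  rw [mp_pt] at e4
  obtain ⟨q1, q2⟩ := pt_inj e4
  obtain ⟨w, rfl⟩ := B.hfix _ q1
  obtain ⟨w', rfl⟩ := B.hfix _ q2
  have hw : w' ^ 2 = cc w := by
    apply B.i.injective
    rw [map_pow, h3, cc_map]
  refine ⟨w, rfl, B.C.six hw ?_⟩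
  apply mp_inj B.i
  have hS : ∀ P, mp B.i (B.C.S P) = mp B.st (mp B.i P) := fun P =>
    mp_comm B.C.s B.i B.i B.st (fun z => (B.hsi z).symm) P
  have hP : mp B.i (pt w w' hw) = pt X Y h + mp B.ct (pt X Y h) := by
    rw [e1, hR, mp_pt]
  have hcs : ∀ P, mp B.st (mp B.ct P) = mp B.ct (mp B.st P) := fun P =>
    mp_comm _ _ _ _ B.hcs P
  rw [B.C.tr_apply, map_add, map_add, hS, hS, hS, hP]
  have : mp B.ct (pt X Y h + mp B.st (pt X Y h) + mp B.st (mp B.st (pt X Y h))) = 0 := by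
    rw [ht, map_zero]
  rw [map_add, map_add] at this
  rw [map_add, map_add, hcs, hcs]
  calc _ = (pt X Y h + mp B.st (pt X Y h) + mp B.st (mp B.st (pt X Y h))) +
      (mp B.ct (pt X Y h) + mp B.ct (mp B.st (pt X Y h)) + mp B.ct (mp B.st (mp B.st (pt X Y h)))) := by abel
    _ = 0 := by rw [ht, this, add_zero]

lemma k1_nz {e : L} (he : e ^ 3 - 2 * e ^ 2 - e + 1 = 0) : -14 - 21 * e + 14 * e ^ 2 ≠ 0 := by
  intro h
  grind

lemma fold_ww {e s n XR v : L} (he : e ^ 3 - 2 * e ^ 2 - e + 1 = 0) (Z : L)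
    (hZ : 7 * (1 - e + e ^ 2) * Z = XR - (7 * e - 5))
    (h : 2401 * v ^ 2 = 4 * GG s n * ((n - 1 + e * (1 - s)) ^ 2 *
      ((-14 - 21 * e + 14 * e ^ 2) ^ 3 * ((n * s - 2 * n + s) - e * (s ^ 2 - 2 * n - s + 2)) +
      GG s n * ((-14 - 21 * e + 14 * e ^ 2) ^ 2 * (XR + 14 * e - 9))))) :
    v ^ 2 = 4 * GG s n * WW e s n Z := by
  have a1 : (-14 - 21 * e + 14 * e ^ 2) ^ 3 = 2401 * (-3 - 3 * e + 2 * e ^ 2) := by grind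
  have a2 : (-14 - 21 * e + 14 * e ^ 2) ^ 2 * (XR + 14 * e - 9) = 2401 * (Z + e - 1) := by
    have : XR = 7 * (1 - e + e ^ 2) * Z + (7 * e - 5) := by linear_combination -hZ
    rw [this]; clear h hZ
    grind
  rw [a1, a2] at h
  unfold WW
  linear_combination h / 2401

theorem BG.main (B : BG F L) {x y : L} (hsx : B.st x = x) (hsy : B.st y = y)
    (hxy : y ^ 2 = gg x * hh x) (hg : gg x ≠ 0) (hx : B.ct x ≠ x) :
    ∃ s n : ℚ, x + B.ct x = s ∧ x * B.ct x = n ∧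
      (s = 2 ∧ n = 1 / 2 ∨ s = -2 ∧ n = -1 ∨ s = 0 ∧ n = -2) := by
  obtain ⟨s, hs⟩ := B.rat (x + B.ct x) (by rw [map_add, B.hcc, add_comm])
    (by rw [map_add, B.hcs, hsx])
  obtain ⟨n, hn⟩ := B.rat (x * B.ct x) (by rw [map_mul, B.hcc, mul_comm])
    (by rw [map_mul, B.hcs, hsx])
  refine ⟨s, n, hs, hn, ?_⟩
  have hsx' : B.st (B.ct x) = B.ct x := by rw [B.hcs, hsx]
  have hsy' : B.st (B.ct y) = B.ct y := by rw [B.hcs, hsy]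
  have hg' : gg (B.ct x) ≠ 0 := by
    rw [← gg_map]; exact (map_ne_zero B.ct).2 hg
  have hxy' : (B.ct y) ^ 2 = gg (B.ct x) * hh (B.ct x) := by
    rw [← map_pow, hxy]; unfold gg hh
    simp only [map_add, map_sub, map_mul, map_pow, map_ofNat, map_one]
  have hd : x - B.ct x ≠ 0 := sub_ne_zero.2 (Ne.symm hx)
  -- rational nonvanishing
  have n0 : n ≠ 0 := by
    rintro rfl
    rw [Rat.cast_zero, mul_eq_zero, map_eq_zero, or_self] at hn
    exact hx (by rw [hn, map_zero])
  have n1 : 1 - s + n ≠ 0 := by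
    intro h
    have h1 : (1 - x) * B.ct (1 - x) = 0 := by
      rw [map_sub, map_one]
      have : ((1 - s + n : ℚ) : L) = 0 := by rw [h, Rat.cast_zero]
      push_cast at this
      linear_combination this - hs + hn
    rw [mul_eq_zero, map_eq_zero, or_self] at h1
    have : x = 1 := by linear_combination -h1
    exact hx (by rw [this, map_one])
  have hGe : gg x * gg (B.ct x) = GG (s : L) n := by
    rw [← hs, ← hn]; unfold gg GG; ring
  have hG : GG s n ≠ 0 := by
    intro h
    have : GG (s : L) n = ((GG s n : ℚ) : L) := by unfold GG; push_cast; rfl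
    rw [this, h, Rat.cast_zero] at hGe
    exact mul_ne_zero hg hg' hGe
  have he : (B.i B.C.e) ^ 3 - 2 * (B.i B.C.e) ^ 2 - (B.i B.C.e) + 1 = 0 := by
    have := congrArg B.i B.C.he
    simpa [map_ofNat] using this
  have hℓ : (n : L) - 1 + B.i B.C.e * (1 - s) ≠ 0 := by
    intro h
    have h1 : ((n - 1 : ℚ) : F) + ((1 - s : ℚ) : F) * B.C.e + ((0 : ℚ) : F) * B.C.e ^ 2 =
      ((0 : ℚ) : F) + ((0 : ℚ) : F) * B.C.e + ((0 : ℚ) : F) * B.C.e ^ 2 := by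
      apply B.i.injective
      simp only [map_add, map_mul, map_ratCast, map_pow]
      push_cast
      linear_combination h
    obtain ⟨r1, r2, -⟩ := B.C.coords h1
    apply hG
    have : s = 1 := by linarith
    have : n = 1 := by linarith
    subst s n
    unfold GG; norm_num
  have hk := k1_nz he
  have hce : B.ct (B.i B.C.e) = B.i B.C.e := B.hci _
  have hP := phi_on he hxy hg
  have hP' := phi_on he hxy' hg'
  have ht := B.tr_phi hsx hsy hg hP
  have cX : B.ct (xi (B.i B.C.e) x) = xi (B.i B.C.e) (B.ct x) := by rw [xi_map, hce]
  have cY : B.ct (49 * y / (2 * gg x ^ 2)) = 49 * (B.ct y) / (2 * gg (B.ct x) ^ 2) := by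
    simp only [map_div₀, map_mul, map_pow, map_ofNat, gg_map]
  have hD := xi_diff (e := B.i B.C.e) hg hg'
  have hA := xi_add (e := B.i B.C.e) hg hg'
  rw [hs, hn] at hD hA
  have hne : xi (B.i B.C.e) x ≠ xi (B.i B.C.e) (B.ct x) := by
    intro h
    rw [h, sub_self, zero_mul] at hD
    exact mul_ne_zero (mul_ne_zero (neg_ne_zero.2 hk) hd) hℓ hD.symm
  obtain ⟨l, hl⟩ : ∃ l, l * (xi (B.i B.C.e) x - xi (B.i B.C.e) (B.ct x)) =
    49 * y / (2 * gg x ^ 2) - 49 * (B.ct y) / (2 * gg (B.ct x) ^ 2) :=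
    ⟨_, div_mul_cancel₀ _ (sub_ne_zero.2 hne)⟩
  obtain ⟨hR, HR⟩ := pt_add_aux hP hP' hne hl
  obtain ⟨w, hw, hw6⟩ := R_fix B cX cY ht HR
  -- the rational number v
  obtain ⟨v, hv⟩ := B.rat ((y * gg (B.ct x) ^ 2 - B.ct y * gg x ^ 2) / (x - B.ct x))
    (by
      simp only [map_div₀, map_sub, map_mul, map_pow, gg_map, B.hcc]
      rw [← neg_sub x, div_neg, ← neg_div, neg_sub])
    (by simp only [map_div₀, map_sub, map_mul, map_pow, gg_map, hsx, hsy, hsx', hsy'])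
  rw [div_eq_iff hd] at hv
  have hid := key_id hk hℓ hg hg' hd hD hA hl hw.symm hv.symm
  rw [hGe] at hid
  have hF : 2401 * (v : F) ^ 2 = 4 * GG (s : F) n * (((n : F) - 1 + B.C.e * (1 - s)) ^ 2 *
      ((-14 - 21 * B.C.e + 14 * B.C.e ^ 2) ^ 3 * ((n * s - 2 * n + s : F) - B.C.e * (s ^ 2 - 2 * n - s + 2)) +
      GG (s : F) n * ((-14 - 21 * B.C.e + 14 * B.C.e ^ 2) ^ 2 * (w + 14 * B.C.e - 9)))) := by
    apply B.i.injective
    unfold GG at *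
    simp only [map_add, map_sub, map_neg, map_mul, map_pow, map_ofNat, map_one, map_ratCast]
    exact hid
  have hf := fun Z hZ => fold_ww B.C.he Z hZ hF
  rcases hw6 with rfl | rfl | rfl | rfl | rfl | rfl
  · exact (fin1 B.C n0 n1 hG (hf _ (by have hE := B.C.he; clear * - hE; generalize B.C.e = e at hE ⊢; grind))).elim
  · exact (fin3 B.C n0 n1 hG (hf _ (by have hE := B.C.he; clear * - hE; generalize B.C.e = e at hE ⊢; grind))).elim
  · exact (fin4 B.C n0 n1 hG (hf _ (by have hE := B.C.he; clear * - hE; generalize B.C.e = e at hE ⊢; grind))).elim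
  · exact Or.inl (fin2 B.C n0 n1 hG (hf _ (by have hE := B.C.he; clear * - hE; generalize B.C.e = e at hE ⊢; grind)))
  · exact Or.inr (Or.inr (fin6 B.C n0 n1 hG (hf _ (by have hE := B.C.he; clear * - hE; generalize B.C.e = e at hE ⊢; grind))))
  · exact Or.inr (Or.inl (fin5 B.C n0 n1 hG (hf _ (by have hE := B.C.he; clear * - hE; generalize B.C.e = e at hE ⊢; grind))))
end
end Q14

namespace Q14
section
open Polynomial

noncomputable def pp (k : Type) [Field k] : k[X] := X ^ 3 - 2 * X ^ 2 - X + 1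

lemma pp_deg (k : Type) [Field k] : (pp k).natDegree = 3 := by
  unfold pp; compute_degree!

lemma pp_monic (k : Type) [Field k] : (pp k).Monic := by
  unfold pp; monicity!

lemma pp_eval {k L : Type} [Field k] [CommRing L] (f : k →+* L) (x : L) :
    (pp k).eval₂ f x = x ^ 3 - 2 * x ^ 2 - x + 1 := by
  unfold pp
  simp [eval₂_add, eval₂_sub, eval₂_mul, eval₂_pow]

lemma pp_irr {k : Type} [Field k] [CharZero k] (σ : k →+* k) (h2 : ∀ z, σ (σ z) = z)
    (hf : ∀ z, σ z = z → ∃ q : ℚ, z = q) : Irreducible (pp k) := by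
  apply Polynomial.irreducible_of_degree_le_three_of_not_isRoot
  · rw [pp_deg]; simp
  · intro e he
    have he : e ^ 3 - 2 * e ^ 2 - e + 1 = 0 := by
      have := pp_eval (RingHom.id k) e
      rw [← this]; exact he
    obtain ⟨s, hs⟩ := hf (e + σ e) (by rw [map_add, h2, add_comm])
    obtain ⟨n, hn⟩ := hf (e * σ e) (by rw [map_mul, h2, mul_comm])
    have h1 := CF.nm_eq e he (n : k) ((-s : ℚ) : k) ((1 : ℚ) : k)
    have h3 : (n : k) + ((-s : ℚ) : k) * e + ((1 : ℚ) : k) * e ^ 2 = 0 := by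
      push_cast; rw [← hs, ← hn]; ring
    rw [h3, zero_mul] at h1
    have h4 := CF.nm_rat n (-s) 1 (by
      unfold CF.nm at h1 ⊢
      exact_mod_cast h1.symm)
    exact one_ne_zero h4.2.2

lemma pw_rep {R : Type} [CommRing R] {e : R} (he : e ^ 3 - 2 * e ^ 2 - e + 1 = 0) (n : ℕ) :
    ∃ a b c : ℤ, e ^ n = a + b * e + c * e ^ 2 := by
  induction n with
  | zero => exact ⟨1, 0, 0, by simp⟩
  | succ n ih =>
    obtain ⟨a, b, c, h⟩ := ih
    refine ⟨-c, a + c, b + 2 * c, ?_⟩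
    rw [pow_succ, h]; push_cast
    linear_combination (c : R) * he

lemma ar_rep {k : Type} [Field k] (z : AdjoinRoot (pp k)) :
    ∃ a b c : k, z = AdjoinRoot.of _ a + AdjoinRoot.of _ b * AdjoinRoot.root _
      + AdjoinRoot.of _ c * AdjoinRoot.root _ ^ 2 := by
  have he : (AdjoinRoot.root (pp k)) ^ 3 - 2 * (AdjoinRoot.root (pp k)) ^ 2 - (AdjoinRoot.root (pp k)) + 1 = 0 := by
    rw [← pp_eval (AdjoinRoot.of (pp k))]; exact AdjoinRoot.eval₂_root _
  induction z using AdjoinRoot.induction_on with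
  | ih p =>
    induction p using Polynomial.induction_on' with
    | add p q hp hq =>
      obtain ⟨a, b, c, h⟩ := hp
      obtain ⟨a', b', c', h'⟩ := hq
      refine ⟨a + a', b + b', c + c', ?_⟩
      rw [map_add, h, h', map_add, map_add, map_add]; ring
    | monomial n r =>
      obtain ⟨a, b, c, h⟩ := pw_rep he n
      refine ⟨r * a, r * b, r * c, ?_⟩
      rw [← C_mul_X_pow_eq_monomial, map_mul, map_pow, AdjoinRoot.mk_C, AdjoinRoot.mk_X, h]
      simp only [map_mul, map_intCast]; ring

lemma ar_uniq {k : Type} [Field k] {a b c a' b' c' : k}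
    (h : AdjoinRoot.of (pp k) a + AdjoinRoot.of _ b * AdjoinRoot.root _
      + AdjoinRoot.of _ c * AdjoinRoot.root _ ^ 2 = AdjoinRoot.of _ a' + AdjoinRoot.of _ b' * AdjoinRoot.root _
      + AdjoinRoot.of _ c' * AdjoinRoot.root _ ^ 2) : a = a' ∧ b = b' ∧ c = c' := by
  have h1 : AdjoinRoot.mk (pp k) (C (a - a') + C (b - b') * X + C (c - c') * X ^ 2) = 0 := by
    simp only [map_add, map_mul, map_pow, AdjoinRoot.mk_C, AdjoinRoot.mk_X, map_sub]
    linear_combination h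
  rw [AdjoinRoot.mk_eq_zero] at h1
  have h2 := Polynomial.eq_zero_of_dvd_of_natDegree_lt h1 (by
    rw [pp_deg]
    refine lt_of_le_of_lt (b := 2) ?_ (by norm_num)
    compute_degree)
  have hz : ∀ u v w : k, C u + C v * X + C w * X ^ 2 = 0 → u = 0 ∧ v = 0 ∧ w = 0 := by
    intro u v w h
    have c0 := congrArg (fun p => coeff p 0) h
    have c1 := congrArg (fun p => coeff p 1) h
    have c2 := congrArg (fun p => coeff p 2) h
    simp [coeff_X, coeff_C] at c0 c1 c2
    exact ⟨c0, c1, c2⟩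
  obtain ⟨c0, c1, c2⟩ := hz _ _ _ h2
  exact ⟨sub_eq_zero.1 c0, sub_eq_zero.1 c1, sub_eq_zero.1 c2⟩

theorem exists_BG (k : Type) [Field k] [CharZero k] (σ : k →+* k) (h2 : ∀ z, σ (σ z) = z)
    (hf : ∀ z, σ z = z → ∃ q : ℚ, z = q) :
    ∃ (L : Type) (_ : Field L) (_ : CharZero L) (F : Type) (_ : Field F) (_ : CharZero F)
      (B : BG F L) (j : k →+* L), (∀ z, B.st (j z) = j z) ∧ ∀ z, B.ct (j z) = j (σ z) := by
  haveI : Fact (Irreducible (pp k)) := ⟨pp_irr σ h2 hf⟩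
  have hL : CharZero (AdjoinRoot (pp k)) :=
    charZero_of_injective_ringHom (AdjoinRoot.of (pp k)).injective
  have he : (AdjoinRoot.root (pp k)) ^ 3 - 2 * (AdjoinRoot.root (pp k)) ^ 2 - (AdjoinRoot.root (pp k)) + 1 = 0 := by
    rw [← pp_eval (AdjoinRoot.of (pp k))]; exact AdjoinRoot.eval₂_root _
  obtain ⟨st, st1, st2⟩ : ∃ st : AdjoinRoot (pp k) →+* AdjoinRoot (pp k),
      (∀ z, st (AdjoinRoot.of _ z) = AdjoinRoot.of _ z) ∧ st (AdjoinRoot.root _) =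
        2 + AdjoinRoot.root _ - AdjoinRoot.root _ ^ 2 := by
    have h : (pp k).eval₂ (AdjoinRoot.of (pp k)) (2 + AdjoinRoot.root _ - AdjoinRoot.root _ ^ 2) = 0 := by
      rw [pp_eval]
      generalize AdjoinRoot.root (pp k) = e at he
      grind
    exact ⟨AdjoinRoot.lift _ _ h, fun z => AdjoinRoot.lift_of h, AdjoinRoot.lift_root h⟩
  obtain ⟨ct, ct1, ct2⟩ : ∃ ct : AdjoinRoot (pp k) →+* AdjoinRoot (pp k),
      (∀ z, ct (AdjoinRoot.of _ z) = AdjoinRoot.of _ (σ z)) ∧ ct (AdjoinRoot.root _) =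
        AdjoinRoot.root _ := by
    have h : (pp k).eval₂ ((AdjoinRoot.of (pp k)).comp σ) (AdjoinRoot.root _) = 0 := by
      rw [pp_eval]; exact he
    exact ⟨AdjoinRoot.lift _ _ h, fun z => AdjoinRoot.lift_of h, AdjoinRoot.lift_root h⟩
  have hrep : ∀ z, ct z = z → ∃ a b c : ℚ, z = a + b * AdjoinRoot.root (pp k)
      + c * AdjoinRoot.root (pp k) ^ 2 := by
    intro z hz
    obtain ⟨a, b, c, rfl⟩ := ar_rep z
    simp only [map_add, map_mul, map_pow, ct1, ct2] at hz
    obtain ⟨ha, hb, hc⟩ := ar_uniq hz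
    obtain ⟨a, rfl⟩ := hf a ha
    obtain ⟨b, rfl⟩ := hf b hb
    obtain ⟨c, rfl⟩ := hf c hc
    exact ⟨a, b, c, by simp only [map_ratCast]⟩
  have hcs : ∀ z, st (ct z) = ct (st z) := by
    intro z
    obtain ⟨a, b, c, rfl⟩ := ar_rep z
    simp only [map_add, map_sub, map_mul, map_pow, ct1, ct2, st1, st2, map_ofNat]
  have hcc : ∀ z, ct (ct z) = z := by
    intro z
    obtain ⟨a, b, c, rfl⟩ := ar_rep z
    simp only [map_add, map_mul, map_pow, ct1, ct2, h2]
  let F : Subfield (AdjoinRoot (pp k)) := RingHom.eqLocusField ct (RingHom.id _)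
  have hF : CharZero F := charZero_of_injective_ringHom (f := (Rat.castHom F)) (Rat.castHom F).injective
  let C : CF F :=
    { e := ⟨AdjoinRoot.root _, ct2⟩
      he := Subtype.ext (by push_cast; exact he)
      rep := by
        rintro ⟨z, hz⟩
        obtain ⟨a, b, c, h⟩ := hrep z hz
        exact ⟨a, b, c, Subtype.ext (by push_cast; exact h)⟩
      s := (st.comp F.subtype).codRestrict F (fun z => by
        change ct (st z.1) = st z.1
        rw [← hcs]
        exact congrArg st z.2)
      hs := Subtype.ext (by push_cast; exact st2) }
  exact ⟨AdjoinRoot (pp k), inferInstance, hL, F, inferInstance, hF,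
    { C := C, i := F.subtype, st := st, ct := ct, hsi := fun z => rfl, hci := fun z => z.2,
      hfix := fun z hz => ⟨⟨z, hz⟩, rfl⟩, hcc := hcc, hcs := hcs }, AdjoinRoot.of _, st1, ct1⟩

lemma quad_conj (k : Type) [Field k] [Algebra ℚ k] (hk : Module.finrank ℚ k = 2) :
    ∃ σ : k →+* k, (∀ z, σ (σ z) = z) ∧ ∀ z, σ z = z → ∃ q : ℚ, z = algebraMap ℚ k q := by
  haveI : Algebra.IsQuadraticExtension ℚ k := { finrank_eq_two' := hk }
  haveI : FiniteDimensional ℚ k := Module.finite_of_finrank_pos (by omega)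
  haveI : IsGalois ℚ k := inferInstance
  have hc : Nat.card Gal(k/ℚ) = 2 := by rw [IsGalois.card_aut_eq_finrank, hk]
  obtain ⟨a, b, hab, hu⟩ := Nat.card_eq_two_iff.1 hc
  obtain ⟨σ, hσ, hu⟩ : ∃ σ : Gal(k/ℚ), σ ≠ 1 ∧ ∀ τ, τ = 1 ∨ τ = σ := by
    have h : ∀ τ, τ = a ∨ τ = b := fun τ => by
      have : τ ∈ ({a, b} : Set _) := hu ▸ Set.mem_univ τ
      simpa using this
    rcases h 1 with h1 | h1
    · exact ⟨b, by rw [h1]; exact hab.symm, by rw [h1]; exact h⟩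
    · exact ⟨a, by rw [h1]; exact hab, by rw [h1]; exact fun τ => (h τ).symm⟩
  refine ⟨(σ : k ≃ₐ[ℚ] k).toRingEquiv.toRingHom, ?_, ?_⟩
  · intro z
    have : σ * σ = 1 := by
      have := pow_card_eq_one' (x := σ)
      rwa [hc, pow_two] at this
    exact congrArg (fun τ : Gal(k/ℚ) => τ z) this
  · intro z hz
    have : z ∈ (⊥ : IntermediateField ℚ k) := by
      rw [IsGalois.mem_bot_iff_fixed]
      intro f
      rcases hu f with rfl | rfl
      · rfl
      · exact hz
    obtain ⟨q, hq⟩ := IntermediateField.mem_bot.1 this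
    exact ⟨q, hq.symm⟩
end
end Q14

theorem stmt_14 (k : Type) [Field k] [Algebra ℚ k]
    (hk : Module.finrank ℚ k = 2) (x y : k)
    (hxy : y ^ 2 = (x ^ 2 - x + 1) * (x ^ 6 + x ^ 5 - 6 * x ^ 4 - 3 * x ^ 3
        + 14 * x ^ 2 - 7 * x + 1))
    (hx : x ∉ Set.range (algebraMap ℚ k)) :
    (2 * x - 2) ^ 2 = 2 ∨ (x + 1) ^ 2 = 2 ∨ x ^ 2 = 2 ∨
    (2 * x - 1) ^ 2 = -3 := by
  by_cases hg : x ^ 2 - x + 1 = 0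
  · right; right; right; linear_combination 4 * hg
  haveI : CharZero k := algebraRat.charZero k
  obtain ⟨σ, h2, hf⟩ := Q14.quad_conj k hk
  have hσx : σ x ≠ x := fun h => by
    obtain ⟨q, hq⟩ := hf x h
    exact hx ⟨q, hq.symm⟩
  obtain ⟨L, _, _, F, _, _, B, j, hs, hc⟩ := Q14.exists_BG k σ h2 (fun z hz => by
    obtain ⟨q, hq⟩ := hf z hz
    exact ⟨q, by rw [hq]; exact eq_ratCast _ q⟩)
  have hgj : Q14.gg (j x) = j (x ^ 2 - x + 1) := by
    unfold Q14.gg; simp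
  have hhj : Q14.hh (j x) = j (x ^ 6 + x ^ 5 - 6 * x ^ 4 - 3 * x ^ 3 + 14 * x ^ 2 - 7 * x + 1) := by
    unfold Q14.hh
    simp only [map_add, map_sub, map_mul, map_pow, map_ofNat, map_one]
  obtain ⟨s, n, e1, e2, hcase⟩ := B.main (hs x) (hs y)
    (by rw [hgj, hhj, ← map_mul, ← hxy, map_pow])
    (by rw [hgj]; exact (map_ne_zero j).2 hg)
    (by rw [hc]; exact fun h => hσx (j.injective h))
  have hq : x ^ 2 - s * x + n = 0 := by
    apply j.injective
    simp only [map_add, map_sub, map_mul, map_pow, map_ratCast, map_zero, ← e1, ← e2]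
    ring
  rcases hcase with ⟨rfl, rfl⟩ | ⟨rfl, rfl⟩ | ⟨rfl, rfl⟩
  · left; push_cast at hq; linear_combination 4 * hq
  · right; left; push_cast at hq; linear_combination hq
  · right; right; left; push_cast at hq; linear_combination hq
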